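/- Let Gv be a closed orbit in V. The fiber π^{-1}(π(v)) is G-reduced if and only if the slice representation (N_v, G_v) is coreduced. -/

import Mathlib

/-!
Common framework: a "compact Lie group / complex reductive group acting on a
finite-dimensional module" is modelled as a subgroup of invertible `n × n`
matrices over `𝕜 = ℝ` or `ℂ` acting on `Fin n → 𝕜` by `Matrix.mulVec`.
Polynomial functions on the module are `MvPolynomial (Fin n) 𝕜`.
-/

set_option synthInstance.maxHeartbeats 1000000
set_option maxHeartbeats 1000000

noncomputable section

open MvPolynomial

namespace ZPaper

variable (𝕜 : Type) [RCLike 𝕜] (n : ℕ)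

/-- The zero set of a family of polynomials. -/
def zeroSet (S : Set (MvPolynomial (Fin n) 𝕜)) : Set (Fin n → 𝕜) :=
  {v | ∀ p ∈ S, eval v p = 0}

/-- A subset of `𝕜ⁿ` is algebraic if it is the zero set of a family of polynomials. -/
def IsAlgebraicSet (X : Set (Fin n → 𝕜)) : Prop :=
  ∃ S : Set (MvPolynomial (Fin n) 𝕜), X = zeroSet 𝕜 n S

/-- The vanishing ideal `I(X)` of a subset `X ⊆ 𝕜ⁿ`. -/
def vanishingIdeal (X : Set (Fin n → 𝕜)) : Ideal (MvPolynomial (Fin n) 𝕜) where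
  carrier := {p | ∀ x ∈ X, eval x p = 0}
  zero_mem' := by intro x _; simp
  add_mem' := by intro a b ha hb x hx; simp [ha x hx, hb x hx]
  smul_mem' := by intro c p hp x hx; simp [smul_eq_mul, hp x hx]

/-- The Zariski closure of a subset of `𝕜ⁿ`. -/
def zclosure (A : Set (Fin n → 𝕜)) : Set (Fin n → 𝕜) :=
  zeroSet 𝕜 n (vanishingIdeal 𝕜 n A : Set (MvPolynomial (Fin n) 𝕜))

/-- `A` is Zariski dense in `X`: every polynomial vanishing on `A` vanishes on `X`. -/
def ZDenseIn (A X : Set (Fin n → 𝕜)) : Prop :=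
  ∀ p : MvPolynomial (Fin n) 𝕜, (∀ a ∈ A, eval a p = 0) → ∀ x ∈ X, eval x p = 0

/-- A set of matrices is a subgroup of `GL_n(𝕜)`. -/
def IsMatSubgroup (G : Set (Matrix (Fin n) (Fin n) 𝕜)) : Prop :=
  (1 : Matrix (Fin n) (Fin n) 𝕜) ∈ G ∧ (∀ a ∈ G, ∀ b ∈ G, a * b ∈ G) ∧
    ∀ a ∈ G, IsUnit a ∧ a⁻¹ ∈ G

/-- `X` is a `G`-stable subset of `𝕜ⁿ`. -/
def Stabilizes (G : Set (Matrix (Fin n) (Fin n) 𝕜)) (X : Set (Fin n → 𝕜)) : Prop :=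
  ∀ g ∈ G, ∀ x ∈ X, Matrix.mulVec g x ∈ X

/-- A polynomial is `G`-invariant. -/
def Invariant (G : Set (Matrix (Fin n) (Fin n) 𝕜)) (p : MvPolynomial (Fin n) 𝕜) : Prop :=
  ∀ g ∈ G, ∀ v : Fin n → 𝕜, eval (Matrix.mulVec g v) p = eval v p

/-- `I_G(X)`: the ideal generated by the `G`-invariant polynomials vanishing on `X`,
i.e. by `I(X)^G = I(X) ∩ 𝕜[V]^G`. -/
def invariantIdeal (G : Set (Matrix (Fin n) (Fin n) 𝕜)) (X : Set (Fin n → 𝕜)) :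
    Ideal (MvPolynomial (Fin n) 𝕜) :=
  Ideal.span {p | Invariant 𝕜 n G p ∧ ∀ x ∈ X, eval x p = 0}

/-- `X` is `G`-reduced: `I_G(X) = I(X)`. -/
def IsGReduced (G : Set (Matrix (Fin n) (Fin n) 𝕜)) (X : Set (Fin n → 𝕜)) : Prop :=
  invariantIdeal 𝕜 n G X = vanishingIdeal 𝕜 n X

/-- `X` is almost `G`-reduced: `√I_G(X) = I(X)`. -/
def IsAlmostGReduced (G : Set (Matrix (Fin n) (Fin n) 𝕜)) (X : Set (Fin n → 𝕜)) : Prop :=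
  (invariantIdeal 𝕜 n G X).radical = vanishingIdeal 𝕜 n X

/-- The orbit `G·v`. -/
def orbit (G : Set (Matrix (Fin n) (Fin n) 𝕜)) (v : Fin n → 𝕜) : Set (Fin n → 𝕜) :=
  (fun g => Matrix.mulVec g v) '' G

/-- The isotropy group `G_v`. -/
def isotropy (G : Set (Matrix (Fin n) (Fin n) 𝕜)) (v : Fin n → 𝕜) :
    Set (Matrix (Fin n) (Fin n) 𝕜) :=
  {g ∈ G | Matrix.mulVec g v = v}

/-- Matrix exponential. -/
def mexp (A : Matrix (Fin n) (Fin n) 𝕜) : Matrix (Fin n) (Fin n) 𝕜 :=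
  ∑' k : ℕ, ((k.factorial : 𝕜)⁻¹) • A ^ k

/-- The Lie algebra of a matrix group: matrices whose one-parameter subgroup lies in `G`. -/
def lieAlgebra (G : Set (Matrix (Fin n) (Fin n) 𝕜)) : Set (Matrix (Fin n) (Fin n) 𝕜) :=
  {A | ∀ t : 𝕜, mexp 𝕜 n (t • A) ∈ G}

/-- The tangent space `T_v(G·v)` to the orbit, i.e. `𝔤·v`. -/
def orbitTangent (G : Set (Matrix (Fin n) (Fin n) 𝕜)) (v : Fin n → 𝕜) :
    Submodule 𝕜 (Fin n → 𝕜) :=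
  Submodule.span 𝕜 ((fun A => Matrix.mulVec A v) '' lieAlgebra 𝕜 n G)

/-- `N` is a `G_v`-stable complement to `T_v(G·v)` in `𝕜ⁿ` (a slice at `v`). -/
def IsSliceComplement (G : Set (Matrix (Fin n) (Fin n) 𝕜)) (v : Fin n → 𝕜)
    (N : Submodule 𝕜 (Fin n → 𝕜)) : Prop :=
  IsCompl (orbitTangent 𝕜 n G v) N ∧
    ∀ g ∈ isotropy 𝕜 n G v, ∀ x ∈ N, Matrix.mulVec g x ∈ N

/-- The image of `H` in `GL(N)` is trivial. -/
def ActsTriviallyOn (H : Set (Matrix (Fin n) (Fin n) 𝕜))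
    (N : Submodule 𝕜 (Fin n → 𝕜)) : Prop :=
  ∀ g ∈ H, ∀ x ∈ N, Matrix.mulVec g x = x

/-- The image of `H` in `GL(N)` is finite. -/
def HasFiniteImageOn (H : Set (Matrix (Fin n) (Fin n) 𝕜))
    (N : Submodule 𝕜 (Fin n → 𝕜)) : Prop :=
  Set.Finite ((fun g => fun x : N => Matrix.mulVec g (x : Fin n → 𝕜)) '' H)

/-- The orbit `G·v` is (Zariski) closed. -/
def HasClosedOrbit (G : Set (Matrix (Fin n) (Fin n) 𝕜)) (v : Fin n → 𝕜) : Prop :=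
  zclosure 𝕜 n (orbit 𝕜 n G v) ⊆ orbit 𝕜 n G v

/-- `v` lies on a principal orbit: `G·v` is closed and the isotropy group acts trivially on
some (hence any) slice at `v`. -/
def IsPrincipalPt (G : Set (Matrix (Fin n) (Fin n) 𝕜)) (v : Fin n → 𝕜) : Prop :=
  HasClosedOrbit 𝕜 n G v ∧
    ∃ N, IsSliceComplement 𝕜 n G v N ∧ ActsTriviallyOn 𝕜 n (isotropy 𝕜 n G v) N

/-- `v` lies on an almost principal orbit. -/
def IsAlmostPrincipalPt (G : Set (Matrix (Fin n) (Fin n) 𝕜)) (v : Fin n → 𝕜) : Prop :=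
  HasClosedOrbit 𝕜 n G v ∧
    ∃ N, IsSliceComplement 𝕜 n G v N ∧ HasFiniteImageOn 𝕜 n (isotropy 𝕜 n G v) N

/-- The set of principal points `V_pr`. -/
def prPoints (G : Set (Matrix (Fin n) (Fin n) 𝕜)) : Set (Fin n → 𝕜) :=
  {v | IsPrincipalPt 𝕜 n G v}

/-- The set of almost principal points `V_apr`. -/
def aprPoints (G : Set (Matrix (Fin n) (Fin n) 𝕜)) : Set (Fin n → 𝕜) :=
  {v | IsAlmostPrincipalPt 𝕜 n G v}

/-- `π⁻¹(π(Y))`: all points that the invariants cannot separate from `Y`. -/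
def saturation (G : Set (Matrix (Fin n) (Fin n) 𝕜)) (Y : Set (Fin n → 𝕜)) :
    Set (Fin n → 𝕜) :=
  {v | ∃ y ∈ Y, ∀ p, Invariant 𝕜 n G p → eval v p = eval y p}

/-- `Y` is `G`-saturated: `Y = π⁻¹(π(Y))`. -/
def IsSaturated (G : Set (Matrix (Fin n) (Fin n) 𝕜)) (Y : Set (Fin n → 𝕜)) : Prop :=
  Y = saturation 𝕜 n G Y

/-- The fiber `π⁻¹(π(v))` of the quotient morphism. -/
def piFiber (G : Set (Matrix (Fin n) (Fin n) 𝕜)) (v : Fin n → 𝕜) : Set (Fin n → 𝕜) :=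
  {u | ∀ p, Invariant 𝕜 n G p → eval u p = eval v p}

/-- The invariant ring `𝕜[V]^G` as a subalgebra of `𝕜[V]`. -/
def invariantSubalgebra (G : Set (Matrix (Fin n) (Fin n) 𝕜)) :
    Subalgebra 𝕜 (MvPolynomial (Fin n) 𝕜) where
  carrier := {p | Invariant 𝕜 n G p}
  mul_mem' := by intro a b ha hb g hg v; simp [ha g hg v, hb g hg v]
  one_mem' := by intro g hg v; simp
  add_mem' := by intro a b ha hb g hg v; simp [ha g hg v, hb g hg v]
  zero_mem' := by intro g hg v; simp
  algebraMap_mem' := by intro r g hg v; simp [MvPolynomial.algebraMap_eq]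

/-- The representation is cofree: `𝕜[V]` is a free module over `𝕜[V]^G`. -/
def IsCofree (G : Set (Matrix (Fin n) (Fin n) 𝕜)) : Prop :=
  Module.Free ↥(invariantSubalgebra 𝕜 n G) (MvPolynomial (Fin n) 𝕜)

/-- The vanishing ideal of `π(Y)` in `𝕜[V//G] = 𝕜[V]^G`. -/
def quotVanishingIdeal (G : Set (Matrix (Fin n) (Fin n) 𝕜)) (Y : Set (Fin n → 𝕜)) :
    Ideal ↥(invariantSubalgebra 𝕜 n G) where
  carrier := {p | ∀ y ∈ Y, eval y (p : MvPolynomial (Fin n) 𝕜) = 0}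
  zero_mem' := by intro y hy; simp
  add_mem' := by intro a b ha hb y hy; simp [ha y hy, hb y hy]
  smul_mem' := by intro c p hp y hy; simp [smul_eq_mul, hp y hy]

/-- The module is stable: there is a nonempty Zariski-open set of points with closed orbit. -/
def IsStableModule (G : Set (Matrix (Fin n) (Fin n) 𝕜)) : Prop :=
  ∃ U : Set (Fin n → 𝕜), U.Nonempty ∧ IsAlgebraicSet 𝕜 n Uᶜ ∧
    ∀ v ∈ U, HasClosedOrbit 𝕜 n G v

/-- `G` is Zariski closed in `GL_n(𝕜)`. -/
def IsZClosedInGL (G : Set (Matrix (Fin n) (Fin n) 𝕜)) : Prop :=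
  ∃ P : Set (MvPolynomial (Fin n × Fin n) 𝕜),
    G = {g | IsUnit g ∧ ∀ p ∈ P, eval (fun ij => g ij.1 ij.2) p = 0}

/-- `G` is a (linearly) reductive algebraic group: a Zariski closed subgroup of `GL_n`
containing a Zariski-dense compact subgroup (the unitarian trick characterization). -/
def IsReductiveGroup (G : Set (Matrix (Fin n) (Fin n) 𝕜)) : Prop :=
  IsMatSubgroup 𝕜 n G ∧ IsZClosedInGL 𝕜 n G ∧
    ∃ K : Set (Matrix (Fin n) (Fin n) 𝕜), K ⊆ G ∧ IsCompact K ∧ IsMatSubgroup 𝕜 n K ∧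
      ∀ p : MvPolynomial (Fin n × Fin n) 𝕜,
        (∀ k ∈ K, eval (fun ij => k ij.1 ij.2) p = 0) →
          ∀ g ∈ G, eval (fun ij => g ij.1 ij.2) p = 0

/-- The isotropy groups of `v` and `w` are conjugate in `G`. -/
def ConjIsotropy (G : Set (Matrix (Fin n) (Fin n) 𝕜)) (v w : Fin n → 𝕜) : Prop :=
  ∃ g ∈ G, isotropy 𝕜 n G w = (fun h => g * h * g⁻¹) '' isotropy 𝕜 n G v

/-- The (Luna) stratum of `V` determined by a point `v` with closed orbit: the inverse image
under `π` of the set of closed orbits with isotropy group conjugate to `G_v`. -/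
def stratumOf (G : Set (Matrix (Fin n) (Fin n) 𝕜)) (v : Fin n → 𝕜) : Set (Fin n → 𝕜) :=
  {u | ∃ w, HasClosedOrbit 𝕜 n G w ∧ w ∈ zclosure 𝕜 n (orbit 𝕜 n G u) ∧
    ConjIsotropy 𝕜 n G v w}

/-- Dimension of (the Zariski closure of) a subset of `𝕜ⁿ`, as the Krull dimension of its
coordinate ring. -/
def adim (X : Set (Fin n → 𝕜)) : WithBot ℕ∞ :=
  ringKrullDim (MvPolynomial (Fin n) 𝕜 ⧸ vanishingIdeal 𝕜 n X)

/-- A nonempty algebraic set with prime vanishing ideal, i.e. an irreducible algebraic set. -/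
def IsIrredAlg (Z : Set (Fin n → 𝕜)) : Prop :=
  IsAlgebraicSet 𝕜 n Z ∧ Z.Nonempty ∧ (vanishingIdeal 𝕜 n Z).IsPrime

/-- `Z` is an irreducible component of `Y`. -/
def IsIrredComponentOf (Y Z : Set (Fin n → 𝕜)) : Prop :=
  IsIrredAlg 𝕜 n Z ∧ Z ⊆ Y ∧
    ∀ Z', IsIrredAlg 𝕜 n Z' → Z ⊆ Z' → Z' ⊆ Y → Z' = Z

/-- The rank at `v` of the differential of `f = (f_1, …, f_d) : V → 𝕜^d`. -/
def jacRank {d : ℕ} (f : Fin d → MvPolynomial (Fin n) 𝕜) (v : Fin n → 𝕜) : ℕ :=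
  (Matrix.of fun (i : Fin d) (j : Fin n) => eval v (pderiv j (f i))).rank

/-- A polynomial is `H`-invariant as a function on the submodule `N`. -/
def InvariantOn (H : Set (Matrix (Fin n) (Fin n) 𝕜)) (N : Submodule 𝕜 (Fin n → 𝕜))
    (p : MvPolynomial (Fin n) 𝕜) : Prop :=
  ∀ g ∈ H, ∀ x ∈ N, eval (Matrix.mulVec g x) p = eval x p

/-- The null cone of the `H`-module `N`: points of `N` which the `H`-invariant functions on `N`
cannot separate from `0`. -/
def sliceNullCone (H : Set (Matrix (Fin n) (Fin n) 𝕜)) (N : Submodule 𝕜 (Fin n → 𝕜)) :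
    Set (Fin n → 𝕜) :=
  {x | x ∈ N ∧ ∀ p, InvariantOn 𝕜 n H N p → eval x p = eval (0 : Fin n → 𝕜) p}

/-- The `H`-module `N` is coreduced: the vanishing ideal of its null cone in `𝕜[N]` is
generated by `H`-invariant functions.  (Stated in `𝕜[V]`: the vanishing ideal of the null
cone equals the ideal generated by the invariant functions vanishing on it together with the
vanishing ideal of `N`.) -/
def CoreducedOn (H : Set (Matrix (Fin n) (Fin n) 𝕜)) (N : Submodule 𝕜 (Fin n → 𝕜)) : Prop :=
  vanishingIdeal 𝕜 n (sliceNullCone 𝕜 n H N) =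
    Ideal.span ({p | InvariantOn 𝕜 n H N p ∧ ∀ x ∈ sliceNullCone 𝕜 n H N, eval x p = 0} ∪
      {p | ∀ x ∈ (N : Set (Fin n → 𝕜)), eval x p = 0})

/-- Complexification of a real vector. -/
def cVec (w : Fin n → ℝ) : Fin n → ℂ := fun i => (w i : ℂ)

/-- The complexification `G = K_ℂ` of a compact matrix group `K ⊆ GL_n(ℝ)`: the Zariski
closure of `K` in the complex matrices. -/
def complexifiedGroup (K : Set (Matrix (Fin n) (Fin n) ℝ)) :
    Set (Matrix (Fin n) (Fin n) ℂ) :=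
  {g | ∀ p : MvPolynomial (Fin n × Fin n) ℂ,
    (∀ k ∈ K, eval (fun ij => (k ij.1 ij.2 : ℂ)) p = 0) →
      eval (fun ij => g ij.1 ij.2) p = 0}

/-- The complexification `Y = X_ℂ ⊆ ℂⁿ` of `X ⊆ ℝⁿ`: the Zariski closure of `X` in `ℂⁿ`. -/
def complexification (X : Set (Fin n → ℝ)) : Set (Fin n → ℂ) :=
  zclosure ℂ n (cVec n '' X)

end ZPaper

namespace ZPaper

section Haar
open MeasureTheory

theorem exists_haar (L : Type*) [Group L] [TopologicalSpace L] [IsTopologicalGroup L]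
    [CompactSpace L] [T2Space L] [MeasurableSpace L] [BorelSpace L] :
    ∃ μ : Measure L, IsProbabilityMeasure μ ∧ μ.IsMulLeftInvariant ∧ μ.IsMulRightInvariant ∧
      μ.IsOpenPosMeasure := by
  let K₀ : TopologicalSpace.PositiveCompacts L := ⊤
  let μ : Measure L := Measure.haarMeasure K₀
  have hp : IsProbabilityMeasure μ := ⟨by
    have := Measure.haarMeasure_self (K₀ := K₀)
    simpa [K₀, μ] using this⟩
  refine ⟨μ, hp, inferInstance, ⟨fun g => ?_⟩, inferInstance⟩
  have h1 : IsProbabilityMeasure (Measure.map (· * g) μ) :=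
    Measure.isProbabilityMeasure_map (by fun_prop)
  exact Measure.isHaarMeasure_eq_of_isProbabilityMeasure _ _

variable {n : ℕ}

instance matSubtypeMeasurable (K : Set (Matrix (Fin n) (Fin n) ℂ)) : MeasurableSpace K := borel K
instance matSubtypeBorel (K : Set (Matrix (Fin n) (Fin n) ℂ)) : BorelSpace K := ⟨rfl⟩

theorem IsMatSubgroup.continuous_inv {K : Set (Matrix (Fin n) (Fin n) ℂ)}
    (hK : IsMatSubgroup ℂ n K) : Continuous fun k : K => (k : Matrix (Fin n) (Fin n) ℂ)⁻¹ := by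
  rw [continuous_iff_continuousAt]
  intro k
  have h := (Matrix.isUnit_iff_isUnit_det _).1 (hK.2.2 _ k.2).1
  refine ContinuousAt.comp (g := fun A : Matrix (Fin n) (Fin n) ℂ => A⁻¹) ?_
    continuous_subtype_val.continuousAt
  refine continuousAt_matrix_inv _ ?_
  rw [Ring.inverse_eq_inv']
  exact continuousAt_inv₀ h.ne_zero

theorem exists_mean {K : Set (Matrix (Fin n) (Fin n) ℂ)} (hc : IsCompact K)
    (hK : IsMatSubgroup ℂ n K) : ∃ μ : Measure K, IsProbabilityMeasure μ ∧
      (∀ k₀ ∈ K, ∀ f : Matrix (Fin n) (Fin n) ℂ → ℂ, ∫ k : K, f (k₀ * k) ∂μ = ∫ k : K, f k ∂μ) ∧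
      (∀ k₀ ∈ K, ∀ f : Matrix (Fin n) (Fin n) ℂ → ℂ, ∫ k : K, f (k * k₀) ∂μ = ∫ k : K, f k ∂μ) ∧
      (∀ k₀ ∈ K, ∀ s : Set (Matrix (Fin n) (Fin n) ℂ),
        μ {k | k₀ * k ∈ s} = μ {k | (k : Matrix (Fin n) (Fin n) ℂ) ∈ s}) ∧
      μ.IsOpenPosMeasure := by
  let : Group K :=
    { mul := fun a b => ⟨a * b, hK.2.1 _ a.2 _ b.2⟩
      one := ⟨1, hK.1⟩
      inv := fun a => ⟨(a : Matrix (Fin n) (Fin n) ℂ)⁻¹, (hK.2.2 _ a.2).2⟩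
      mul_assoc := fun a b c => Subtype.ext (mul_assoc (a : Matrix (Fin n) (Fin n) ℂ) b c)
      one_mul := fun a => Subtype.ext (one_mul (a : Matrix (Fin n) (Fin n) ℂ))
      mul_one := fun a => Subtype.ext (mul_one (a : Matrix (Fin n) (Fin n) ℂ))
      inv_mul_cancel := fun a => Subtype.ext (Matrix.nonsing_inv_mul _
        ((Matrix.isUnit_iff_isUnit_det _).1 (hK.2.2 _ a.2).1)) }
  have hmul : ∀ a b : K, ((a * b : K) : Matrix (Fin n) (Fin n) ℂ) = a * b := fun _ _ => rfl
  have : IsTopologicalGroup K :=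
    { continuous_mul := by
        refine Continuous.subtype_mk
          (f := fun p : K × K => (p.1 : Matrix (Fin n) (Fin n) ℂ) * p.2) ?_ _
        fun_prop
      continuous_inv := hK.continuous_inv.subtype_mk _ }
  have : CompactSpace K := isCompact_iff_compactSpace.1 hc
  obtain ⟨μ, h1, h2, h3, h4⟩ := exists_haar K
  refine ⟨μ, h1, fun k₀ hk f => ?_, fun k₀ hk f => ?_, fun k₀ hk s => ?_, h4⟩
  · exact integral_mul_left_eq_self (fun k : K => f k) (⟨k₀, hk⟩ : K)
  · exact integral_mul_right_eq_self (fun k : K => f k) (⟨k₀, hk⟩ : K)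
  · exact measure_preimage_mul μ (⟨k₀, hk⟩ : K) {k | (k : Matrix (Fin n) (Fin n) ℂ) ∈ s}

theorem continuous_integrable_of_compact {K : Set (Matrix (Fin n) (Fin n) ℂ)} (hc : IsCompact K)
    (μ : Measure K) [IsProbabilityMeasure μ] {E : Type*} [NormedAddCommGroup E]
    [SecondCountableTopologyEither K E] {f : K → E} (hf : Continuous f) :
    Integrable f μ := by
  have : CompactSpace K := isCompact_iff_compactSpace.1 hc
  exact hf.integrable_of_hasCompactSupport (HasCompactSupport.of_compactSpace f)
end Haar

section Nice

variable {X : Type*} (𝒜 : Subalgebra ℂ (X → ℂ))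

/-- Maps `X → E` which are finite combinations of constant vectors, with coefficients in the
function algebra `𝒜`. -/
def niceMaps (E : Type*) [AddCommGroup E] [Module ℂ E] : Submodule ℂ (X → E) :=
  Submodule.span ℂ {f | ∃ c ∈ 𝒜, ∃ e : E, f = fun x => c x • e}

variable {𝒜} {E F : Type*} [AddCommGroup E] [Module ℂ E] [AddCommGroup F] [Module ℂ F]

theorem nice_single {c : X → ℂ} (hc : c ∈ 𝒜) (e : E) : (fun x => c x • e) ∈ niceMaps 𝒜 E :=
  Submodule.subset_span ⟨c, hc, e, rfl⟩

theorem nice_const (e : E) : (fun _ => e) ∈ niceMaps 𝒜 E := by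
  simpa using nice_single (𝒜 := 𝒜) (c := 1) (one_mem _) e

theorem nice_map (l : E →ₗ[ℂ] F) {f : X → E} (hf : f ∈ niceMaps 𝒜 E) :
    (fun x => l (f x)) ∈ niceMaps 𝒜 F := by
  induction hf using Submodule.span_induction with
  | mem f h =>
    obtain ⟨c, hc, e, rfl⟩ := h
    simpa using nice_single hc (l e)
  | zero => simpa using nice_const (𝒜 := 𝒜) (0 : F)
  | add f g _ _ h1 h2 => simp only [Pi.add_apply, map_add]; exact add_mem h1 h2
  | smul a f _ h => simp only [Pi.smul_apply, map_smul]; exact Submodule.smul_mem _ a h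

theorem nice_mem {f : X → ℂ} (hf : f ∈ niceMaps 𝒜 ℂ) : f ∈ 𝒜 := by
  induction hf using Submodule.span_induction with
  | mem f h =>
    obtain ⟨c, hc, e, rfl⟩ := h
    have : (fun x => c x • e) = e • c := by ext x; simp [mul_comm]
    rw [this]
    exact Subalgebra.smul_mem _ hc _
  | zero => exact zero_mem _
  | add f g _ _ h1 h2 => exact add_mem h1 h2
  | smul a f _ h => exact Subalgebra.smul_mem _ h _

theorem nice_apply (l : E →ₗ[ℂ] ℂ) {f : X → E} (hf : f ∈ niceMaps 𝒜 E) :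
    (fun x => l (f x)) ∈ 𝒜 := nice_mem (nice_map l hf)

variable {A : Type*} [CommRing A] [Algebra ℂ A]

theorem nice_mul {f g : X → A} (hf : f ∈ niceMaps 𝒜 A) (hg : g ∈ niceMaps 𝒜 A) :
    (fun x => f x * g x) ∈ niceMaps 𝒜 A := by
  induction hf using Submodule.span_induction with
  | mem f h =>
    obtain ⟨c, hc, e, rfl⟩ := h
    induction hg using Submodule.span_induction with
    | mem g h =>
      obtain ⟨c', hc', e', rfl⟩ := h
      convert nice_single (mul_mem hc hc') (e * e') using 2 with x
      simp [smul_smul, mul_comm]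
    | zero => simpa using nice_const (𝒜 := 𝒜) (0 : A)
    | add f g _ _ h1 h2 => simp only [Pi.add_apply, mul_add]; exact add_mem h1 h2
    | smul a f _ h => simp only [Pi.smul_apply, mul_smul_comm]; exact Submodule.smul_mem _ a h
  | zero => simpa using nice_const (𝒜 := 𝒜) (0 : A)
  | add f g _ _ h1 h2 => simp only [Pi.add_apply, add_mul]; exact add_mem h1 h2
  | smul a f _ h => simp only [Pi.smul_apply, smul_mul_assoc]; exact Submodule.smul_mem _ a h

theorem nice_smul {c : X → ℂ} (hc : c ∈ 𝒜) {f : X → E} (hf : f ∈ niceMaps 𝒜 E) :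
    (fun x => c x • f x) ∈ niceMaps 𝒜 E := by
  induction hf using Submodule.span_induction with
  | mem f h =>
    obtain ⟨c', hc', e', rfl⟩ := h
    convert nice_single (mul_mem hc hc') e' using 2 with x
    simp [smul_smul]
  | zero => simpa using nice_const (𝒜 := 𝒜) (0 : E)
  | add f g _ _ h1 h2 => simp only [Pi.add_apply, smul_add]; exact add_mem h1 h2
  | smul a f _ h =>
    simp only [Pi.smul_apply, smul_comm _ a]
    exact Submodule.smul_mem _ a h

theorem nice_sum {ι : Type*} (s : Finset ι) {f : ι → X → E} (hf : ∀ i ∈ s, f i ∈ niceMaps 𝒜 E) :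
    (fun x => ∑ i ∈ s, f i x) ∈ niceMaps 𝒜 E := by
  have := sum_mem hf
  convert this using 1
  ext x; simp

open MeasureTheory in
theorem nice_integral [MeasurableSpace X] (μ : Measure X) (hμ : ∀ c ∈ 𝒜, Integrable c μ)
    {f : X → E} (hf : f ∈ niceMaps 𝒜 E) :
    ∃ e : E, (∀ l : E →ₗ[ℂ] ℂ, l e = ∫ x, l (f x) ∂μ) ∧
      ∀ W : Submodule ℂ E, (∀ x, f x ∈ W) → e ∈ W := by
  have h1 : ∃ e : E, (∀ l : E →ₗ[ℂ] ℂ, l e = ∫ x, l (f x) ∂μ) := by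
    induction hf using Submodule.span_induction with
    | mem f h =>
      obtain ⟨c, hc, e, rfl⟩ := h
      refine ⟨(∫ x, c x ∂μ) • e, fun l => ?_⟩
      simp [integral_mul_const]
    | zero => exact ⟨0, fun l => by simp⟩
    | add f g hf hg h1 h2 =>
      obtain ⟨e1, h1⟩ := h1
      obtain ⟨e2, h2⟩ := h2
      refine ⟨e1 + e2, fun l => ?_⟩
      simp only [map_add, h1, h2, Pi.add_apply]
      rw [integral_add (hμ _ (nice_apply l hf)) (hμ _ (nice_apply l hg))]
    | smul a f hf h =>
      obtain ⟨e, h⟩ := h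
      refine ⟨a • e, fun l => ?_⟩
      simp [h, integral_const_mul]
  obtain ⟨e, he⟩ := h1
  refine ⟨e, he, fun W hW => ?_⟩
  by_contra hne
  obtain ⟨l, hl, hl2⟩ := Submodule.exists_le_ker_of_notMem hne
  apply hl
  rw [he]
  simp [fun x => LinearMap.mem_ker.1 (hl2 (hW x))]

/-- The algebra of continuous functions. -/
def contAlg (X : Type*) [TopologicalSpace X] : Subalgebra ℂ (X → ℂ) where
  carrier := {c | Continuous c}
  mul_mem' := fun h1 h2 => h1.mul h2
  add_mem' := fun h1 h2 => h1.add h2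
  algebraMap_mem' := fun _ => continuous_const

/-- The algebra of polynomial functions. -/
def polyAlg (σ : Type*) : Subalgebra ℂ ((σ → ℂ) → ℂ) where
  carrier := {c | ∃ q : MvPolynomial σ ℂ, c = fun g => eval g q}
  mul_mem' := by rintro _ _ ⟨p, rfl⟩ ⟨q, rfl⟩; exact ⟨p * q, by ext; simp⟩
  add_mem' := by rintro _ _ ⟨p, rfl⟩ ⟨q, rfl⟩; exact ⟨p + q, by ext; simp⟩
  algebraMap_mem' := fun r => ⟨C r, by ext; simp⟩

end Nice

section Subst

variable {n : ℕ}

/-- Substitution of the affine map `x ↦ A x + b` in a polynomial. -/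
def affSub (A : Matrix (Fin n) (Fin n) ℂ) (b : Fin n → ℂ) :
    MvPolynomial (Fin n) ℂ →ₐ[ℂ] MvPolynomial (Fin n) ℂ :=
  aeval fun i => ∑ j, C (A i j) * X j + C (b i)

@[simp] theorem eval_affSub (A : Matrix (Fin n) (Fin n) ℂ) (b x : Fin n → ℂ)
    (P : MvPolynomial (Fin n) ℂ) : eval x (affSub A b P) = eval (A.mulVec x + b) P := by
  induction P using MvPolynomial.induction_on with
  | C a => simp [affSub]
  | add p q hp hq => simp [hp, hq]
  | mul_X p i hp =>
    rw [map_mul, map_mul, map_mul, hp]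
    simp [affSub, Matrix.mulVec, dotProduct]

theorem nice_affSub {X : Type*} {𝒜 : Subalgebra ℂ (X → ℂ)}
    {A : X → Matrix (Fin n) (Fin n) ℂ} {b : X → Fin n → ℂ}
    (hA : ∀ i j, (fun x => A x i j) ∈ 𝒜) (hb : ∀ i, (fun x => b x i) ∈ 𝒜)
    (P : MvPolynomial (Fin n) ℂ) :
    (fun x => affSub (A x) (b x) P) ∈ niceMaps 𝒜 (MvPolynomial (Fin n) ℂ) := by
  induction P using MvPolynomial.induction_on with
  | C a => simpa [affSub] using nice_const (𝒜 := 𝒜) (C a : MvPolynomial (Fin n) ℂ)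
  | add p q hp hq => simp only [map_add]; exact add_mem hp hq
  | mul_X p i hp =>
    simp only [map_mul]
    refine nice_mul hp ?_
    simp only [affSub, aeval_X]
    refine add_mem (nice_sum (f := fun j x => C (A x i j) * MvPolynomial.X j) _ fun j _ => ?_) ?_
    · simpa [MvPolynomial.smul_eq_C_mul] using
        nice_single (hA i j) (MvPolynomial.X j : MvPolynomial (Fin n) ℂ)
    · simpa [MvPolynomial.smul_eq_C_mul] using
        nice_single (hb i) (1 : MvPolynomial (Fin n) ℂ)

theorem totalDegree_affSub_le (A : Matrix (Fin n) (Fin n) ℂ) (b : Fin n → ℂ)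
    (P : MvPolynomial (Fin n) ℂ) : (affSub A b P).totalDegree ≤ P.totalDegree := by
  have hl : ∀ i, (∑ j, C (A i j) * X j + C (b i) : MvPolynomial (Fin n) ℂ).totalDegree ≤ 1 := by
    intro i
    refine (totalDegree_add _ _).trans (max_le ?_ (by simp))
    refine totalDegree_finsetSum_le fun j _ => ?_
    exact (totalDegree_mul _ _).trans (by simp)
  conv_lhs => rw [P.as_sum, map_sum]
  refine totalDegree_finsetSum_le fun α hα => ?_
  rw [affSub, aeval_monomial]
  refine (totalDegree_mul _ _).trans ?_
  rw [MvPolynomial.algebraMap_eq, totalDegree_C, zero_add]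
  refine le_trans ?_ (le_totalDegree hα)
  rw [Finsupp.prod, Finsupp.sum]
  refine (totalDegree_finsetProd _ _).trans (Finset.sum_le_sum fun i _ => ?_)
  exact (totalDegree_pow _ _).trans (by simpa using Nat.mul_le_mul_left (α i) (hl i))

theorem poly_ext {p q : MvPolynomial (Fin n) ℂ} (h : ∀ x, eval x p = eval x q) : p = q :=
  MvPolynomial.funext h

/-- Restriction of a polynomial to the line through `0` and `ξ`. -/
def lineMap (ξ : Fin n → ℂ) : MvPolynomial (Fin n) ℂ →ₐ[ℂ] Polynomial ℂ :=
  aeval fun i => Polynomial.C (ξ i) * Polynomial.X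

@[simp] theorem eval_lineMap (ξ : Fin n → ℂ) (z : ℂ) (P : MvPolynomial (Fin n) ℂ) :
    (lineMap ξ P).eval z = eval (z • ξ) P := by
  induction P using MvPolynomial.induction_on with
  | C a => simp [lineMap]
  | add p q hp hq => simp [hp, hq]
  | mul_X p i hp =>
    rw [map_mul, map_mul, Polynomial.eval_mul, hp]
    simp only [lineMap, aeval_X, Polynomial.eval_mul, Polynomial.eval_C, Polynomial.eval_X,
      map_mul, eval_X, Pi.smul_apply, smul_eq_mul]
    ring

/-- The value at `ξ` of the degree `j` part of a polynomial. -/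
def jet (j : ℕ) (ξ : Fin n → ℂ) : MvPolynomial (Fin n) ℂ →ₗ[ℂ] ℂ :=
  (aeval ξ).toLinearMap ∘ₗ homogeneousComponent j

theorem jet_apply (j : ℕ) (ξ : Fin n → ℂ) (P : MvPolynomial (Fin n) ℂ) :
    jet j ξ P = eval ξ (homogeneousComponent j P) := by
  simp [jet, aeval_eq_eval]

theorem eval_smul_of_isHomogeneous {j : ℕ} {Q : MvPolynomial (Fin n) ℂ} (h : Q.IsHomogeneous j)
    (z : ℂ) (ξ : Fin n → ℂ) : eval (z • ξ) Q = z ^ j * eval ξ Q := by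
  rw [eval_eq, eval_eq, Finset.mul_sum]
  refine Finset.sum_congr rfl fun α hα => ?_
  have h1 := h (mem_support_iff.1 hα)
  have h2 : ∑ i ∈ α.support, α i = j := by
    rw [← h1, Finsupp.weight_apply, Finsupp.sum]; simp
  simp only [Pi.smul_apply, smul_eq_mul, mul_pow, Finset.prod_mul_distrib,
    Finset.prod_pow_eq_pow_sum, h2]
  ring

theorem coeff_lineMap (j : ℕ) (ξ : Fin n → ℂ) (P : MvPolynomial (Fin n) ℂ) :
    (lineMap ξ P).coeff j = jet j ξ P := by
  have h1 : ∀ i, lineMap ξ (homogeneousComponent i P) =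
      Polynomial.C (jet i ξ P) * Polynomial.X ^ i := by
    intro i
    refine Polynomial.funext fun z => ?_
    rw [eval_lineMap, eval_smul_of_isHomogeneous (homogeneousComponent_isHomogeneous i P), jet_apply]
    rw [Polynomial.eval_C_mul, Polynomial.eval_pow, Polynomial.eval_X, mul_comm]
  conv_lhs => rw [← sum_homogeneousComponent P, map_sum]
  simp only [h1, Polynomial.finsetSum_coeff, Polynomial.coeff_C_mul_X_pow]
  rw [Finset.sum_ite_eq]
  split_ifs with h
  · rfl
  · rw [jet_apply, homogeneousComponent_eq_zero _ _ (by simpa using h), map_zero]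

theorem eval_eq_sum_jet {D : ℕ} (ξ : Fin n → ℂ) {P : MvPolynomial (Fin n) ℂ}
    (h : P.totalDegree ≤ D) : eval ξ P = ∑ j ∈ Finset.range (D + 1), jet j ξ P := by
  simp only [jet_apply]
  rw [← map_sum]
  congr 1
  conv_lhs => rw [← sum_homogeneousComponent P]
  refine Finset.sum_subset (by simpa using h) fun j _ hj => ?_
  exact homogeneousComponent_eq_zero _ _ (by simpa using hj)

theorem jet_affSub (j : ℕ) (A : Matrix (Fin n) (Fin n) ℂ) (ξ : Fin n → ℂ)
    (P : MvPolynomial (Fin n) ℂ) : jet j ξ (affSub A 0 P) = jet j (A.mulVec ξ) P := by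
  rw [← coeff_lineMap, ← coeff_lineMap]
  congr 1
  refine Polynomial.funext fun z => ?_
  simp [Matrix.mulVec_smul]

theorem jet_smul (j : ℕ) (z : ℂ) (ξ : Fin n → ℂ) (P : MvPolynomial (Fin n) ℂ) :
    jet j (z • ξ) P = z ^ j * jet j ξ P := by
  simp only [jet_apply]
  exact eval_smul_of_isHomogeneous (homogeneousComponent_isHomogeneous j P) z ξ

theorem jet_mul (j : ℕ) (ξ : Fin n → ℂ) (P Q : MvPolynomial (Fin n) ℂ) :
    jet j ξ (P * Q) = ∑ a ∈ Finset.HasAntidiagonal.antidiagonal j, jet a.1 ξ P * jet a.2 ξ Q := by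
  simp only [← coeff_lineMap, map_mul, Polynomial.coeff_mul]

theorem jet_zero (ξ : Fin n → ℂ) (P : MvPolynomial (Fin n) ℂ) : jet 0 ξ P = eval 0 P := by
  rw [← coeff_lineMap, Polynomial.coeff_zero_eq_eval_zero]
  simp

theorem norm_coeff_le_of_circle (q : Polynomial ℂ) {M : ℝ} (h : ∀ z : ℂ, ‖z‖ = 1 → ‖q.eval z‖ ≤ M)
    (j : ℕ) : ‖q.coeff j‖ ≤ M := by
  have h1 := Complex.norm_iteratedDeriv_le_of_forall_mem_sphere_norm_le (f := fun z => q.eval z)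
    (c := 0) (R := 1) (C := M) j one_pos q.differentiable.diffContOnCl
    (fun z hz => h z (by simpa using hz))
  have h2 : iteratedDeriv j (fun z => q.eval z) 0 = j.factorial * q.coeff j := by
    have h3 : ∀ (j : ℕ) (q : Polynomial ℂ), deriv^[j] (fun z => q.eval z) =
        fun z => (Polynomial.derivative^[j] q).eval z := by
      intro j
      induction j with
      | zero => intro q; rfl
      | succ j ih =>
        intro q
        rw [Function.iterate_succ_apply, Function.iterate_succ_apply, ← ih]
        congr 1
        ext z
        simp
    rw [iteratedDeriv_eq_iterate, h3]
    beta_reduce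
    rw [← Polynomial.coeff_zero_eq_eval_zero,
      Polynomial.coeff_iterate_derivative]
    simp [Nat.descFactorial_self]
  rw [h2, norm_mul] at h1
  simp only [one_pow, div_one, Complex.norm_natCast] at h1
  exact le_of_mul_le_mul_left h1 (by positivity)

end Subst

section Frame
open MeasureTheory Matrix
open scoped ComplexOrder MatrixOrder

variable {n : ℕ}

/-- A compact real form adapted to a closed orbit: a Zariski dense compact subgroup `K`, and a
`K`-invariant hermitian form (pulled back along `S`) for which `v` has minimal length. -/
structure Frame (G : Set (Matrix (Fin n) (Fin n) ℂ)) (v : Fin n → ℂ) where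
  K : Set (Matrix (Fin n) (Fin n) ℂ)
  sub : K ⊆ G
  cpt : IsCompact K
  grp : IsMatSubgroup ℂ n K
  dense : ∀ p : MvPolynomial (Fin n × Fin n) ℂ,
    (∀ k ∈ K, eval (fun ij => k ij.1 ij.2) p = 0) → ∀ g ∈ G, eval (fun ij => g ij.1 ij.2) p = 0
  S : (Fin n → ℂ) →ₗ[ℂ] EuclideanSpace ℂ (Fin n)
  inj : Function.Injective S
  iso : ∀ k ∈ K, ∀ x, ‖S (k *ᵥ x)‖ = ‖S x‖
  min : ∀ g ∈ G, ‖S v‖ ≤ ‖S (g *ᵥ v)‖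

theorem exists_invariant_norm {K : Set (Matrix (Fin n) (Fin n) ℂ)} (hc : IsCompact K)
    (hK : IsMatSubgroup ℂ n K) :
    ∃ S : (Fin n → ℂ) →ₗ[ℂ] EuclideanSpace ℂ (Fin n), Function.Injective S ∧
      ∀ k ∈ K, ∀ x, ‖S (k *ᵥ x)‖ = ‖S x‖ := by
  obtain ⟨μ, hμ, -, hr, -, -⟩ := exists_mean hc hK
  have hInt : ∀ i j, Integrable (fun k : K => ((k : Matrix (Fin n) (Fin n) ℂ)ᴴ * k) i j) μ :=
    fun i j => continuous_integrable_of_compact hc μ (by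
      have : Continuous fun k : K => ((k : Matrix (Fin n) (Fin n) ℂ)ᴴ * k) := by fun_prop
      exact this.matrix_elem i j)
  let P : Matrix (Fin n) (Fin n) ℂ :=
    Matrix.of fun i j => ∫ k : K, ((k : Matrix (Fin n) (Fin n) ℂ)ᴴ * k) i j ∂μ
  have hP : ∀ x : Fin n → ℂ, star x ⬝ᵥ (P *ᵥ x) =
      ∫ k : K, star ((k : Matrix (Fin n) (Fin n) ℂ) *ᵥ x) ⬝ᵥ ((k : Matrix (Fin n) (Fin n) ℂ) *ᵥ x) ∂μ := by
    intro x
    have h1 : ∀ k : Matrix (Fin n) (Fin n) ℂ, star (k *ᵥ x) ⬝ᵥ (k *ᵥ x) =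
        ∑ i, ∑ j, star (x i) * ((kᴴ * k) i j * x j) := by
      intro k
      rw [star_mulVec, ← dotProduct_mulVec, mulVec_mulVec]
      simp [dotProduct, mulVec, Finset.mul_sum]
    simp only [h1]
    rw [integral_finsetSum _ fun i _ => integrable_finsetSum _ fun j _ =>
      ((hInt i j).mul_const _).const_mul _]
    simp only [dotProduct, mulVec, Finset.mul_sum]
    refine Finset.sum_congr rfl fun i _ => ?_
    rw [integral_finsetSum _ fun j _ => ((hInt i j).mul_const _).const_mul _]
    refine Finset.sum_congr rfl fun j _ => ?_
    rw [integral_const_mul, integral_mul_const]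
    rfl
  have hre : ∀ y : Fin n → ℂ, star y ⬝ᵥ y = ((∑ i, ‖y i‖ ^ 2 : ℝ) : ℂ) := by
    intro y
    simp only [dotProduct, Pi.star_apply, RCLike.star_def, Complex.ofReal_sum, Complex.ofReal_pow]
    refine Finset.sum_congr rfl fun i _ => ?_
    rw [mul_comm, Complex.mul_conj, Complex.normSq_eq_norm_sq]; push_cast; rfl
  have hP2 : ∀ x : Fin n → ℂ, star x ⬝ᵥ (P *ᵥ x) =
      ((∫ k : K, (∑ i, ‖((k : Matrix (Fin n) (Fin n) ℂ) *ᵥ x) i‖ ^ 2 : ℝ) ∂μ : ℝ) : ℂ) := by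
    intro x
    rw [hP]
    simp only [hre]
    exact integral_ofReal
  have hpsd : P.PosSemidef := by
    refine Matrix.PosSemidef.of_dotProduct_mulVec_nonneg ?_ fun x => ?_
    · ext i j
      simp only [P, conjTranspose_apply, of_apply]
      rw [RCLike.star_def, ← integral_conj]
      congr 1
      ext k
      have := congrFun (congrFun (isHermitian_conjTranspose_mul_self (k : Matrix (Fin n) (Fin n) ℂ)) i) j
      simpa [conjTranspose_apply] using this
    · rw [hP2]
      rw [Complex.zero_le_real]
      exact integral_nonneg fun k => Finset.sum_nonneg fun i _ => by positivity
  obtain ⟨B, hB⟩ := CStarAlgebra.nonneg_iff_eq_star_mul_self.mp hpsd.nonneg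
  rw [star_eq_conjTranspose] at hB
  let S : (Fin n → ℂ) →ₗ[ℂ] EuclideanSpace ℂ (Fin n) :=
    (WithLp.linearEquiv 2 ℂ (Fin n → ℂ)).symm.toLinearMap ∘ₗ B.mulVecLin
  have hS : ∀ x, ‖S x‖ ^ 2 = ∫ k : K, (∑ i, ‖((k : Matrix (Fin n) (Fin n) ℂ) *ᵥ x) i‖ ^ 2 : ℝ) ∂μ := by
    intro x
    have h1 := hP2 x
    rw [hB, ← mulVec_mulVec, dotProduct_mulVec, ← star_mulVec, hre] at h1
    have h2 := Complex.ofReal_injective h1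
    rw [← h2, EuclideanSpace.norm_sq_eq]
    rfl
  have hcont : ∀ x, Continuous fun k : K => (∑ i, ‖((k : Matrix (Fin n) (Fin n) ℂ) *ᵥ x) i‖ ^ 2 : ℝ) := by
    intro x
    have : Continuous fun k : K => (k : Matrix (Fin n) (Fin n) ℂ) *ᵥ x := by fun_prop
    fun_prop
  refine ⟨S, ?_, fun k₀ hk x => ?_⟩
  · rw [injective_iff_map_eq_zero]
    intro x hx
    have h1 := hS x
    rw [hx, norm_zero, zero_pow two_ne_zero, eq_comm, integral_eq_zero_iff_of_nonneg
      (fun k => Finset.sum_nonneg fun i _ => by positivity)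
      (continuous_integrable_of_compact hc μ (hcont x))] at h1
    obtain ⟨k, hk⟩ := h1.exists
    have h3 : (k : Matrix (Fin n) (Fin n) ℂ) *ᵥ x = 0 := by
      ext i
      have := (Finset.sum_eq_zero_iff_of_nonneg (fun i _ => by positivity)).1 hk i (Finset.mem_univ _)
      simpa using this
    have h4 := (Matrix.isUnit_iff_isUnit_det _).1 (hK.2.2 _ k.2).1
    calc x = (k : Matrix (Fin n) (Fin n) ℂ)⁻¹ *ᵥ ((k : Matrix (Fin n) (Fin n) ℂ) *ᵥ x) := by
            rw [mulVec_mulVec, Matrix.nonsing_inv_mul _ h4, one_mulVec]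
      _ = 0 := by rw [h3, mulVec_zero]
  · have h1 := hr k₀ hk (fun k => ((∑ i, ‖(k *ᵥ x) i‖ ^ 2 : ℝ) : ℂ))
    rw [integral_complex_ofReal, integral_complex_ofReal] at h1
    have h2 := Complex.ofReal_injective h1
    have h3 : ‖S (k₀ *ᵥ x)‖ ^ 2 = ‖S x‖ ^ 2 := by
      rw [hS, hS, ← h2]
      simp only [mulVec_mulVec]
    exact (sq_eq_sq₀ (norm_nonneg _) (norm_nonneg _)).1 h3

theorem exists_conj_poly (A B : Matrix (Fin n) (Fin n) ℂ) (p : MvPolynomial (Fin n × Fin n) ℂ) :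
    ∃ q : MvPolynomial (Fin n × Fin n) ℂ, ∀ g : Matrix (Fin n) (Fin n) ℂ,
      eval (fun ij => g ij.1 ij.2) q = eval (fun ij => (A * g * B) ij.1 ij.2) p := by
  induction p using MvPolynomial.induction_on with
  | C a => exact ⟨C a, fun g => by simp⟩
  | add p q hp hq =>
    obtain ⟨p', hp⟩ := hp
    obtain ⟨q', hq⟩ := hq
    exact ⟨p' + q', fun g => by simp [hp, hq]⟩
  | mul_X p i hp =>
    obtain ⟨p', hp⟩ := hp
    refine ⟨p' * ∑ l, (∑ k, C (A i.1 k) * X (k, l)) * C (B l i.2), fun g => ?_⟩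
    rw [map_mul, map_mul, hp]
    simp [Matrix.mul_apply]

theorem IsMatSubgroup.inv_mul {G : Set (Matrix (Fin n) (Fin n) ℂ)} (hG : IsMatSubgroup ℂ n G)
    {g : Matrix (Fin n) (Fin n) ℂ} (hg : g ∈ G) : g⁻¹ * g = 1 :=
  Matrix.nonsing_inv_mul _ ((Matrix.isUnit_iff_isUnit_det _).1 (hG.2.2 _ hg).1)

theorem IsMatSubgroup.mul_inv {G : Set (Matrix (Fin n) (Fin n) ℂ)} (hG : IsMatSubgroup ℂ n G)
    {g : Matrix (Fin n) (Fin n) ℂ} (hg : g ∈ G) : g * g⁻¹ = 1 :=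
  Matrix.mul_nonsing_inv _ ((Matrix.isUnit_iff_isUnit_det _).1 (hG.2.2 _ hg).1)

theorem continuous_eval_poly {σ : Type*} (p : MvPolynomial σ ℂ) :
    Continuous fun x : σ → ℂ => eval x p := MvPolynomial.continuous_eval p

theorem exists_frame {G : Set (Matrix (Fin n) (Fin n) ℂ)} (hG : IsReductiveGroup ℂ n G)
    {v : Fin n → ℂ} (hv : HasClosedOrbit ℂ n G v) : Nonempty (Frame G v) := by
  obtain ⟨hg, -, K, hKG, hKc, hK, hd⟩ := hG
  obtain ⟨S, hinj, hiso⟩ := exists_invariant_norm hKc hK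
  have hcl : IsClosed (orbit ℂ n G v) := by
    have : orbit ℂ n G v = zclosure ℂ n (orbit ℂ n G v) :=
      Set.Subset.antisymm (fun x hx p hp => hp x hx) hv
    rw [this]
    have : zclosure ℂ n (orbit ℂ n G v) = ⋂ p ∈ (vanishingIdeal ℂ n (orbit ℂ n G v) :
        Set (MvPolynomial (Fin n) ℂ)), {x | eval x p = 0} := by
      ext x; simp [zclosure, zeroSet]
    rw [this]
    exact isClosed_biInter fun p _ => isClosed_eq (continuous_eval_poly p) continuous_const
  have hemb : Topology.IsClosedEmbedding S := LinearMap.isClosedEmbedding_of_injective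
    (LinearMap.ker_eq_bot.2 hinj)
  have hcl2 : IsClosed (S '' orbit ℂ n G v) := hemb.isClosedMap _ hcl
  obtain ⟨y, ⟨u, ⟨g₀, hg₀, rfl⟩, rfl⟩, hy⟩ := hcl2.exists_infDist_eq_dist
    ⟨S v, v, ⟨1, hg.1, by simp⟩, rfl⟩ 0
  have hi1 := hg.inv_mul hg₀
  have hi2 := hg.mul_inv hg₀
  have hinvG := (hg.2.2 _ hg₀).2
  refine ⟨⟨(fun k => g₀⁻¹ * k * g₀) '' K, ?_, hKc.image (by fun_prop), ?_, ?_,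
    S ∘ₗ g₀.mulVecLin, ?_, ?_, ?_⟩⟩
  · rintro _ ⟨k, hk, rfl⟩
    exact hg.2.1 _ (hg.2.1 _ hinvG _ (hKG hk)) _ hg₀
  · refine ⟨⟨1, hK.1, by simp [hi1]⟩, ?_, ?_⟩
    · rintro _ ⟨a, ha, rfl⟩ _ ⟨b, hb, rfl⟩
      refine ⟨a * b, hK.2.1 _ ha _ hb, ?_⟩
      simp only [mul_assoc]
      rw [← mul_assoc g₀ g₀⁻¹, hi2, one_mul]
    · rintro _ ⟨a, ha, rfl⟩
      have h1 : g₀⁻¹ * a * g₀ ∈ G := hg.2.1 _ (hg.2.1 _ hinvG _ (hKG ha)) _ hg₀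
      refine ⟨(hg.2.2 _ h1).1, a⁻¹, (hK.2.2 _ ha).2, ?_⟩
      rw [Matrix.mul_inv_rev, Matrix.mul_inv_rev, ← mul_assoc,
        Matrix.nonsing_inv_nonsing_inv _ ((Matrix.isUnit_iff_isUnit_det _).1 (hg.2.2 _ hg₀).1)]
  · intro p hp g hgG
    obtain ⟨q, hq⟩ := exists_conj_poly g₀⁻¹ g₀ p
    have h1 := hd q (fun k hk => by rw [hq]; exact hp _ ⟨k, hk, rfl⟩) (g₀ * g * g₀⁻¹)
      (hg.2.1 _ (hg.2.1 _ hg₀ _ hgG) _ hinvG)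
    rw [hq] at h1
    have h2 : g₀⁻¹ * (g₀ * g * g₀⁻¹) * g₀ = g := by
      simp only [mul_assoc]
      rw [hi1, mul_one, ← mul_assoc, hi1, one_mul]
    rwa [h2] at h1
  · refine hinj.comp ?_
    exact Function.LeftInverse.injective (g := fun x => g₀⁻¹ *ᵥ x) fun x => by
      simp [mulVec_mulVec, hi1]
  · rintro _ ⟨k, hk, rfl⟩ x
    simp only [LinearMap.comp_apply, mulVecLin_apply]
    have : g₀ * (g₀⁻¹ * k * g₀) = k * g₀ := by
      simp only [mul_assoc]
      rw [← mul_assoc g₀ g₀⁻¹, hi2, one_mul]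
    rw [mulVec_mulVec, this, ← mulVec_mulVec, hiso k hk]
  · intro g hgG
    simp only [LinearMap.comp_apply, mulVecLin_apply]
    rw [mulVec_mulVec]
    have h1 := Metric.infDist_le_dist_of_mem (x := 0) (s := S '' orbit ℂ n G v)
      (y := S ((g₀ * g) *ᵥ v)) ⟨_, ⟨g₀ * g, hg.2.1 _ hg₀ _ hgG, rfl⟩, rfl⟩
    rw [hy] at h1
    simpa using h1

end Frame

section ClosedSubgroup
open NormedSpace Filter Topology

variable {A : Type*} [NormedRing A] [NormedAlgebra ℝ A] [CompleteSpace A]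

theorem norm_exp_sub_sum_le {B : Type*} [NormedRing B] [NormedAlgebra ℝ B] [CompleteSpace B] (X : B) (hX : ‖X‖ ≤ 1) (k : ℕ) (hk : 0 < k) :
    ‖exp X - ∑ i ∈ Finset.range k, ((i.factorial : ℝ)⁻¹) • X ^ i‖ ≤ ‖X‖ ^ k * Real.exp 1 := by
  have hs := expSeries_summable' (𝕂 := ℝ) X
  rw [exp_eq_tsum ℝ]
  beta_reduce
  rw [← hs.sum_add_tsum_nat_add k, add_sub_cancel_left]
  have hs1 := Real.summable_pow_div_factorial 1
  have h1 : ∀ i, ‖(((i + k).factorial : ℝ)⁻¹) • X ^ (i + k)‖ ≤ ‖X‖ ^ k * (1 ^ i / i.factorial) := by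
    intro i
    rw [norm_smul, Real.norm_of_nonneg (by positivity), one_pow, mul_comm, one_div]
    have h2 : ‖X ^ (i + k)‖ ≤ ‖X‖ ^ k := (norm_pow_le' _ (by omega)).trans
      (pow_le_pow_of_le_one (norm_nonneg _) hX (by omega))
    refine mul_le_mul h2 ?_ (by positivity) (by positivity)
    gcongr
    omega
  have h3 : HasSum (fun i : ℕ => ‖X‖ ^ k * ((1 : ℝ) ^ i / i.factorial)) (‖X‖ ^ k * Real.exp 1) := by
    refine HasSum.mul_left _ ?_
    rw [Real.exp_eq_exp_ℝ]
    exact expSeries_div_hasSum_exp (1 : ℝ)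
  exact tsum_of_norm_bounded h3 h1

/-- The Lie algebra of a closed subgroup of the units. -/
def expSet (K : Set A) : Set A := {X | ∀ t : ℝ, exp (t • X) ∈ K}

structure IsClosedUnitGroup (K : Set A) : Prop where
  closed : IsClosed K
  one : (1 : A) ∈ K
  mul : ∀ a ∈ K, ∀ b ∈ K, a * b ∈ K
  inv : ∀ a ∈ K, ∀ b, a * b = 1 → b ∈ K

theorem exp_mul_exp_neg (X : A) : exp X * exp (-X) = 1 := by
  let := NormedAlgebra.restrictScalars ℚ ℝ A
  rw [← exp_add_of_commute ((Commute.refl X).neg_right)]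
  simp

theorem IsClosedUnitGroup.mem_expSet_of_tendsto {K : Set A} (hK : IsClosedUnitGroup K) {Y : ℕ → A}
    {r : ℕ → ℝ} (hr : ∀ i, 0 < r i) (hr0 : Tendsto r atTop (𝓝 0)) (hY : ∀ i, exp (Y i) ∈ K) {X : A}
    (hX : Tendsto (fun i => (r i)⁻¹ • Y i) atTop (𝓝 X)) : X ∈ expSet K := by
  let := NormedAlgebra.restrictScalars ℚ ℝ A
  have hpos : ∀ t : ℝ, 0 ≤ t → exp (t • X) ∈ K := by
    intro t ht
    have h1 : Tendsto (fun i => (⌊t / r i⌋₊ : ℝ) * r i) atTop (𝓝 t) := by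
      have hl : Tendsto (fun i => t - r i) atTop (𝓝 t) := by simpa using tendsto_const_nhds.sub hr0
      refine tendsto_of_tendsto_of_tendsto_of_le_of_le hl tendsto_const_nhds (fun i => ?_) fun i => ?_
      · have := (Nat.lt_floor_add_one (t / r i)).le
        rw [div_le_iff₀ (hr i)] at this
        simp only; linarith
      · have := Nat.floor_le (div_nonneg ht (hr i).le)
        rwa [le_div_iff₀ (hr i)] at this
    have h2 : Tendsto (fun i => exp ((⌊t / r i⌋₊ : ℕ) • Y i)) atTop (𝓝 (exp (t • X))) := by
      refine (NormedSpace.exp_continuous.tendsto _).comp ?_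
      refine (h1.smul hX).congr fun i => ?_
      rw [smul_smul, mul_assoc, mul_inv_cancel₀ (hr i).ne', mul_one, Nat.cast_smul_eq_nsmul]
    refine hK.closed.mem_of_tendsto h2 (Eventually.of_forall fun i => ?_)
    rw [exp_nsmul]
    generalize ⌊t / r i⌋₊ = m
    induction m with
    | zero => simpa using hK.one
    | succ m ih => rw [pow_succ]; exact hK.mul _ ih _ (hY i)
  intro t
  rcases le_total 0 t with ht | ht
  · exact hpos t ht
  · have := hpos (-t) (by linarith)
    refine hK.inv _ this _ ?_
    have h3 := exp_mul_exp_neg ((-t) • X)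
    simpa using h3

theorem IsClosedUnitGroup.exp_mem {K : Set A} {X : A} (hX : X ∈ expSet K) : exp X ∈ K := by
  simpa using hX 1

theorem strict_exp : HasStrictFDerivAt (exp : A → A)
    ((ContinuousLinearEquiv.refl ℝ A : A ≃L[ℝ] A) : A →L[ℝ] A) 0 :=
  hasStrictFDerivAt_exp_zero

theorem strict_exp_comp {B : Type*} [NormedAddCommGroup B] [NormedSpace ℝ B] (T : B →L[ℝ] A) :
    HasStrictFDerivAt (fun x => exp (T x)) T 0 := by
  have he : HasStrictFDerivAt (exp : A → A) (ContinuousLinearMap.id ℝ A) (T 0) := by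
    rw [map_zero]; exact strict_exp
  exact (he.comp (0 : B) T.hasStrictFDerivAt).congr_fderiv (ContinuousLinearMap.id_comp T)

theorem IsClosedUnitGroup.add_mem_expSet {K : Set A} (hK : IsClosedUnitGroup K) {X Y : A}
    (hX : X ∈ expSet K) (hY : Y ∈ expSet K) : X + Y ∈ expSet K := by
  set lg := strict_exp.localInverse (exp : A → A) _ (0 : A) with hlg
  have h1 : HasStrictFDerivAt lg _ (exp (0 : A)) := (strict_exp (A := A)).to_localInverse
  have hr : ∀ᶠ y in 𝓝 (exp (0 : A)), exp (lg y) = y := (strict_exp (A := A)).eventually_right_inverse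
  have hlg0 : lg (exp (0 : A)) = 0 := (strict_exp (A := A)).localInverse_apply_image
  -- the curve `s ↦ log (exp (sX) exp (sY))`
  have hd : HasDerivAt (fun s : ℝ => exp (s • X) * exp (s • Y)) (X + Y) 0 := by
    have ha := hasDerivAt_exp_smul_const X (0 : ℝ)
    have hb := hasDerivAt_exp_smul_const Y (0 : ℝ)
    have := ha.mul hb
    simpa using! this
  have he : exp ((0 : ℝ) • X) * exp ((0 : ℝ) • Y) = exp (0 : A) := by simp
  have hd2 : HasDerivAt (fun s : ℝ => lg (exp (s • X) * exp (s • Y))) (X + Y) 0 := by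
    have h2 := h1.hasFDerivAt
    rw [← he] at h2
    have := h2.comp_hasDerivAt (0 : ℝ) hd
    exact this
  have hcont : Tendsto (fun s : ℝ => exp (s • X) * exp (s • Y)) (𝓝 0) (𝓝 (exp (0 : A))) := by
    have := hd.continuousAt.tendsto
    rwa [he] at this
  have hev := hcont.eventually hr
  have hseq : Tendsto (fun i : ℕ => (1 : ℝ) / ((i : ℝ) + 1)) atTop (𝓝 0) :=
    tendsto_one_div_add_atTop_nhds_zero_nat
  obtain ⟨N, hN⟩ := eventually_atTop.1 (hseq.eventually hev)
  have hseq' := hseq.comp (tendsto_add_atTop_nat N)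
  refine hK.mem_expSet_of_tendsto (r := fun i => 1 / (((i + N : ℕ) : ℝ) + 1))
    (Y := fun i => lg (exp ((1 / (((i + N : ℕ) : ℝ) + 1)) • X) *
      exp ((1 / (((i + N : ℕ) : ℝ) + 1)) • Y))) (fun i => by positivity) hseq' ?_ ?_
  · intro i
    rw [hN (i + N) (by omega)]
    exact hK.mul _ (hX _) _ (hY _)
  · have h3 := hasDerivAt_iff_tendsto_slope_zero.1 hd2
    have h4 : Tendsto (fun i : ℕ => 1 / (((i + N : ℕ) : ℝ) + 1)) atTop (𝓝[≠] 0) :=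
      tendsto_nhdsWithin_iff.2 ⟨hseq', Eventually.of_forall fun i =>
        (by positivity : (0 : ℝ) < 1 / (((i + N : ℕ) : ℝ) + 1)).ne'⟩
    refine (h3.comp h4).congr fun i => ?_
    simp only [Function.comp_apply, zero_add, zero_smul, exp_zero, mul_one]
    rw [← exp_zero (𝔸 := A), hlg0, sub_zero]

/-- The Lie algebra of a closed subgroup, as a real subspace. -/
def lieSub {K : Set A} (hK : IsClosedUnitGroup K) : Submodule ℝ A where
  carrier := expSet K
  add_mem' := hK.add_mem_expSet
  zero_mem' := fun t => by simpa using hK.one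
  smul_mem' := fun c X hX t => by rw [smul_smul]; exact hX _

theorem IsClosedUnitGroup.exists_coord [FiniteDimensional ℝ A] {K : Set A}
    (hK : IsClosedUnitGroup K) {F : Type*} [NormedAddCommGroup F] [NormedSpace ℝ F]
    (L : A →ₗ[ℝ] F) :
    ∃ C : ℝ, 0 < C ∧ ∀ δ > 0, ∀ᶠ k in 𝓝 (1 : A), k ∈ K → ∃ M ∈ expSet K, ∃ Z ∈ expSet K,
      L Z = 0 ∧ ‖M‖ < δ ∧ ‖M‖ ≤ C * ‖L M‖ ∧ k = exp M * exp Z := by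
  set 𝔨 := lieSub hK
  set 𝔷 := 𝔨 ⊓ LinearMap.ker L with h𝔷
  obtain ⟨M', hM'⟩ := Submodule.exists_isCompl 𝔷
  obtain ⟨W, hW⟩ := Submodule.exists_isCompl 𝔨
  set 𝔪 := 𝔨 ⊓ M' with h𝔪
  have hinj : Function.Injective (L.domRestrict 𝔪) := by
    rw [injective_iff_map_eq_zero]
    rintro ⟨x, hx⟩ h
    have : x ∈ 𝔷 ⊓ M' := ⟨⟨hx.1, h⟩, hx.2⟩
    rw [hM'.inf_eq_bot] at this
    exact Subtype.ext this
  obtain ⟨C, hC, hC2⟩ := LinearMap.exists_antilipschitzWith _ (LinearMap.ker_eq_bot.2 hinj)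
  -- exponentials of small elements of `W` leave `K`
  have hWsmall : ∀ᶠ w in 𝓝 (0 : A), w ∈ W → exp w ∈ K → w = 0 := by
    by_contra hcon
    rw [not_eventually] at hcon
    have hcon2 : ∀ m : ℕ, ∃ w : A, ‖w‖ < 1 / ((m : ℝ) + 1) ∧ w ∈ W ∧ exp w ∈ K ∧ w ≠ 0 := by
      intro m
      have := hcon.and_eventually (Metric.ball_mem_nhds (0 : A) (ε := 1 / ((m : ℝ) + 1)) (by positivity))
      obtain ⟨w, hw, hb⟩ := this.exists
      push Not at hw
      exact ⟨w, by simpa using hb, hw.1, hw.2.1, hw.2.2⟩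
    choose w hw1 hw2 hw3 hw4 using hcon2
    have hn : ∀ m, 0 < ‖w m‖ := fun m => norm_pos_iff.2 (hw4 m)
    have hsph : ∀ m, (‖w m‖⁻¹ • w m) ∈ Metric.sphere (0 : A) 1 := by
      intro m
      simp [norm_smul, (hn m).ne']
    have : ProperSpace A := FiniteDimensional.proper ℝ A
    obtain ⟨x, hx, φ, hφ, hlim⟩ := (isCompact_sphere (0 : A) 1).tendsto_subseq hsph
    have hw0 : Tendsto (fun m => ‖w m‖) atTop (𝓝 0) :=
      squeeze_zero (fun m => norm_nonneg _) (fun m => (hw1 m).le) tendsto_one_div_add_atTop_nhds_zero_nat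
    have hxk : x ∈ 𝔨 := hK.mem_expSet_of_tendsto (r := fun i => ‖w (φ i)‖) (Y := fun i => w (φ i))
      (fun i => hn _) (hw0.comp hφ.tendsto_atTop) (fun i => hw3 _) hlim
    have hxW : x ∈ W := by
      refine (Submodule.closed_of_finiteDimensional W).mem_of_tendsto hlim
        (Eventually.of_forall fun i => W.smul_mem _ (hw2 _))
    have : x ∈ 𝔨 ⊓ W := ⟨hxk, hxW⟩
    rw [hW.inf_eq_bot, Submodule.mem_bot] at this
    rw [this] at hx
    simp at hx
  let Ψ : 𝔪 × W × 𝔷 → A := fun p => exp (p.1 : A) * (exp (p.2.1 : A) * exp (p.2.2 : A))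
  let Ψ' : 𝔪 × W × 𝔷 →L[ℝ] A :=
    𝔪.subtypeL ∘L ContinuousLinearMap.fst ℝ _ _ +
      (W.subtypeL ∘L ContinuousLinearMap.fst ℝ _ _ ∘L ContinuousLinearMap.snd ℝ _ _ +
        𝔷.subtypeL ∘L ContinuousLinearMap.snd ℝ _ _ ∘L ContinuousLinearMap.snd ℝ _ _)
  have hΨ : HasStrictFDerivAt Ψ Ψ' 0 := by
    have h1 := strict_exp_comp (𝔪.subtypeL ∘L ContinuousLinearMap.fst ℝ 𝔪 (W × 𝔷))
    have h2 := strict_exp_comp (W.subtypeL ∘L ContinuousLinearMap.fst ℝ _ _ ∘L ContinuousLinearMap.snd ℝ 𝔪 (W × 𝔷))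
    have h3 := strict_exp_comp (𝔷.subtypeL ∘L ContinuousLinearMap.snd ℝ _ _ ∘L ContinuousLinearMap.snd ℝ 𝔪 (W × 𝔷))
    have h4 := h1.mul' (h2.mul' h3)
    refine h4.congr_fderiv ?_
    ext p <;> simp [Ψ']
  have hsurj : Ψ'.range = ⊤ := by
    rw [eq_top_iff]
    intro x _
    have hx : x ∈ 𝔨 ⊔ W := by rw [hW.sup_eq_top]; trivial
    obtain ⟨y, hy, w, hw, rfl⟩ := Submodule.mem_sup.1 hx
    have hy2 : y ∈ 𝔷 ⊔ M' := by rw [hM'.sup_eq_top]; trivial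
    obtain ⟨z, hz, m, hm, rfl⟩ := Submodule.mem_sup.1 hy2
    have hmk : m ∈ 𝔨 := by simpa using 𝔨.sub_mem hy hz.1
    refine ⟨(⟨m, hmk, hm⟩, ⟨w, hw⟩, ⟨z, hz⟩), ?_⟩
    simp [Ψ']
    abel
  have hΨ0 : Ψ 0 = 1 := by simp [Ψ]
  have hmap := hΨ.map_nhds_eq_of_surj hsurj
  rw [hΨ0] at hmap
  refine ⟨C, by exact_mod_cast hC, fun δ hδ => ?_⟩
  rw [← hmap, eventually_map]
  have hc1 : Tendsto (fun p : 𝔪 × W × 𝔷 => (p.2.1 : A)) (𝓝 0) (𝓝 0) := by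
    have : Continuous (fun p : 𝔪 × W × 𝔷 => (p.2.1 : A)) := by fun_prop
    simpa using this.tendsto 0
  have hc2 : Tendsto (fun p : 𝔪 × W × 𝔷 => ‖(p.1 : A)‖) (𝓝 0) (𝓝 0) := by
    have : Continuous (fun p : 𝔪 × W × 𝔷 => ‖(p.1 : A)‖) := by fun_prop
    simpa using this.tendsto 0
  filter_upwards [hc1.eventually hWsmall, hc2.eventually (gt_mem_nhds hδ)] with p hp1 hp2 hpK
  have hM : (p.1 : A) ∈ expSet K := p.1.2.1
  have hZ : (p.2.2 : A) ∈ expSet K := p.2.2.2.1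
  have hW0 : (p.2.1 : A) = 0 := by
    refine hp1 p.2.1.2 ?_
    have e1 : exp (-(p.1 : A)) ∈ K := by simpa using hM (-1)
    have e2 : exp (-(p.2.2 : A)) ∈ K := by simpa using hZ (-1)
    have e3 := hK.mul _ (hK.mul _ e1 _ hpK) _ e2
    have e4 : exp (-(p.1 : A)) * exp (p.1 : A) = 1 := by simpa using exp_mul_exp_neg (-(p.1 : A))
    have e5 : exp (-(p.1 : A)) * Ψ p * exp (-(p.2.2 : A)) = exp (p.2.1 : A) := by
      simp only [Ψ]
      rw [← mul_assoc, e4, one_mul, mul_assoc, exp_mul_exp_neg, mul_one]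
    rwa [e5] at e3
  refine ⟨p.1, hM, p.2.2, hZ, p.2.2.2.2, hp2, ?_, ?_⟩
  · have := hC2.le_mul_dist p.1 0
    simpa using this
  · simp [Ψ, hW0]

end ClosedSubgroup

section Estimates
open NormedSpace Filter Topology Matrix

attribute [local instance] Matrix.linftyOpNormedRing Matrix.linftyOpNormedAlgebra

variable {n : ℕ} {G : Set (Matrix (Fin n) (Fin n) ℂ)} {v : Fin n → ℂ}

theorem mexp_eq_exp (A : Matrix (Fin n) (Fin n) ℂ) : mexp ℂ n A = exp A := by
  rw [exp_eq_tsum ℂ]; rfl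

theorem IsMatSubgroup.isClosedUnitGroup {K : Set (Matrix (Fin n) (Fin n) ℂ)} (hc : IsCompact K)
    (hK : IsMatSubgroup ℂ n K) : IsClosedUnitGroup K where
  closed := hc.isClosed
  one := hK.1
  mul := hK.2.1
  inv := by
    intro a ha b hab
    have h := (hK.2.2 a ha).2
    rwa [Matrix.inv_eq_right_inv hab] at h

theorem differentiable_exp_entry (X : Matrix (Fin n) (Fin n) ℂ) (i j : Fin n) :
    Differentiable ℂ (fun t : ℂ => exp (t • X) i j) := by
  intro t
  have h := (hasDerivAt_exp_smul_const X t).differentiableAt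
  have h2 : DifferentiableAt ℂ (fun A : Matrix (Fin n) (Fin n) ℂ => A i j) (exp (t • X)) := by
    have : DifferentiableAt ℂ (LinearMap.toContinuousLinearMap (Matrix.entryLinearMap ℂ ℂ i j))
      (exp (t • X)) := ContinuousLinearMap.differentiableAt _
    exact this
  exact h2.comp t h

theorem expSet_subset_lieAlgebra (hG : IsReductiveGroup ℂ n G) {K : Set (Matrix (Fin n) (Fin n) ℂ)}
    (hKG : K ⊆ G) {X : Matrix (Fin n) (Fin n) ℂ} (hX : X ∈ expSet K) : X ∈ lieAlgebra ℂ n G := by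
  obtain ⟨P, hP⟩ := hG.2.1
  intro t
  rw [mexp_eq_exp, hP]
  refine ⟨Matrix.isUnit_exp _, fun p hp => ?_⟩
  set f : ℂ → ℂ := fun t => eval (fun ij : Fin n × Fin n => exp (t • X) ij.1 ij.2) p with hf
  have hd : Differentiable ℂ f := by
    have : f = fun t => ∑ d ∈ p.support, p.coeff d * ∏ i, exp (t • X) i.1 i.2 ^ d i := by
      ext t; rw [hf]; simp only [eval_eq']
    rw [this]
    have := differentiable_exp_entry X
    refine Differentiable.fun_sum fun d _ => Differentiable.const_mul ?_ _
    refine Differentiable.fun_finsetProd fun i _ => (this i.1 i.2).pow _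
  have h0 : ∀ s : ℝ, f s = 0 := by
    intro s
    have := hKG (hX s)
    rw [hP] at this
    have h2 := this.2 p hp
    have e : ((s : ℂ) • X) = s • X := by ext; simp
    simp only [hf]
    rw [e]
    exact h2
  have han : AnalyticOnNhd ℂ f Set.univ := hd.differentiableOn.analyticOnNhd isOpen_univ
  have hfr : ∃ᶠ z in 𝓝[≠] (0 : ℂ), f z = 0 := by
    have h1 : Tendsto (fun s : ℝ => (s : ℂ)) (𝓝[≠] 0) (𝓝[≠] 0) := by
      refine tendsto_nhdsWithin_iff.2 ⟨?_, ?_⟩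
      · have := (Complex.continuous_ofReal.tendsto 0).mono_left (nhdsWithin_le_nhds (s := {0}ᶜ))
        simpa using this
      · filter_upwards [self_mem_nhdsWithin] with s hs
        simpa using hs
    exact h1.frequently (Eventually.of_forall h0).frequently
  exact han.eqOn_zero_of_preconnected_of_frequently_eq_zero isPreconnected_univ (Set.mem_univ 0) hfr
    (Set.mem_univ t)

theorem smul_mem_lieAlgebra {A : Matrix (Fin n) (Fin n) ℂ} (hA : A ∈ lieAlgebra ℂ n G) (c : ℂ) :
    c • A ∈ lieAlgebra ℂ n G := fun t => by rw [smul_smul]; exact hA _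

theorem Frame.inner_lie (Fr : Frame G v) {A : Matrix (Fin n) (Fin n) ℂ}
    (hA : A ∈ lieAlgebra ℂ n G) : inner ℂ (Fr.S v) (Fr.S (A *ᵥ v)) = 0 := by
  have key : ∀ B ∈ lieAlgebra ℂ n G, (inner ℂ (Fr.S v) (Fr.S (B *ᵥ v))).re = 0 := by
    intro B hB
    have h1 : HasDerivAt (fun t : ℝ => Fr.S (exp (t • B) *ᵥ v)) (Fr.S (B *ᵥ v)) 0 := by
      have h := hasDerivAt_exp_smul_const B (0 : ℝ)
      let Λ : Matrix (Fin n) (Fin n) ℂ →ₗ[ℂ] EuclideanSpace ℂ (Fin n) :=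
        Fr.S ∘ₗ ((Matrix.mulVecBilin ℂ ℂ).flip v)
      have h2 := (LinearMap.toContinuousLinearMap (Λ.restrictScalars ℝ)).hasFDerivAt.comp_hasDerivAt
        (0 : ℝ) h
      simpa [Λ] using! h2
    have h2 := h1.norm_sq
    have h3 : IsLocalMin (fun t : ℝ => ‖Fr.S (exp (t • B) *ᵥ v)‖ ^ 2) 0 := by
      refine Eventually.of_forall fun t => ?_
      have := Fr.min (exp (t • B)) (by
        have := hB (t : ℂ)
        rw [mexp_eq_exp] at this
        simpa using this)
      simp only [zero_smul, exp_zero, one_mulVec]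
      gcongr
    have h4 := h3.hasDerivAt_eq_zero h2
    simp only [zero_smul, exp_zero, one_mulVec] at h4
    have h5 : (2 : ℝ) * (inner ℂ (Fr.S v) (Fr.S (B *ᵥ v))).re = 0 := by
      rw [← h4]
      simp [PiLp.inner_apply, Complex.inner]
    linarith
  apply Complex.ext
  · simpa using key A hA
  · have := key _ (smul_mem_lieAlgebra hA Complex.I)
    rw [smul_mulVec, map_smul, inner_smul_right] at this
    simpa using this

theorem Frame.inner_mulVec (Fr : Frame G v) {k : Matrix (Fin n) (Fin n) ℂ} (hk : k ∈ Fr.K)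
    (x y : Fin n → ℂ) : inner ℂ (Fr.S (k *ᵥ x)) (Fr.S (k *ᵥ y)) = inner ℂ (Fr.S x) (Fr.S y) := by
  rw [inner_eq_sum_norm_sq_div_four, inner_eq_sum_norm_sq_div_four]
  have h : ∀ z, ‖Fr.S (k *ᵥ z)‖ = ‖Fr.S z‖ := Fr.iso k hk
  simp only [← map_add, ← map_sub, ← map_smul, ← mulVec_add, ← mulVec_sub, ← mulVec_smul, h]

/-- The displacement of `v` by `k`. -/
def Frame.rho (Fr : Frame G v) (k : Matrix (Fin n) (Fin n) ℂ) : ℝ := ‖Fr.S (k *ᵥ v - v)‖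

theorem Frame.continuous_S (Fr : Frame G v) : Continuous Fr.S := LinearMap.continuous_of_finiteDimensional _

theorem Frame.continuous_rho (Fr : Frame G v) : Continuous Fr.rho := by
  unfold Frame.rho
  have := Fr.continuous_S
  fun_prop

theorem Frame.rho_eq_zero (Fr : Frame G v) {k : Matrix (Fin n) (Fin n) ℂ} :
    Fr.rho k = 0 ↔ k *ᵥ v = v := by
  rw [Frame.rho, norm_eq_zero, map_eq_zero_iff _ Fr.inj, sub_eq_zero]

theorem Frame.rho_nonneg (Fr : Frame G v) (k : Matrix (Fin n) (Fin n) ℂ) : 0 ≤ Fr.rho k :=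
  norm_nonneg _

theorem exists_norm_le {E F : Type*} [NormedAddCommGroup E] [NormedSpace ℂ E] [FiniteDimensional ℂ E]
    [NormedAddCommGroup F] [NormedSpace ℂ F] (L : E →ₗ[ℂ] F) :
    ∃ C : ℝ, 0 < C ∧ ∀ x, ‖L x‖ ≤ C * ‖x‖ := by
  obtain ⟨C, hC, h⟩ := (LinearMap.toContinuousLinearMap L).bound
  exact ⟨C, hC, h⟩

theorem Frame.local_estimates (hG : IsReductiveGroup ℂ n G) (Fr : Frame G v)
    (pr : (Fin n → ℂ) →ₗ[ℂ] (Fin n → ℂ)) (hpr : ∀ A ∈ lieAlgebra ℂ n G, pr (A *ᵥ v) = 0) :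
    ∃ C : ℝ, 0 < C ∧ ∀ᶠ k in 𝓝 (1 : Matrix (Fin n) (Fin n) ℂ), k ∈ Fr.K →
      ‖pr (k *ᵥ v - v)‖ ≤ C * Fr.rho k ^ 2 ∧
      (∃ h ∈ Fr.K, h *ᵥ v = v ∧ ‖k - h‖ ≤ C * Fr.rho k) ∧
      |(inner ℂ (Fr.S v) (Fr.S (k *ᵥ v - v))).im| ≤ C * Fr.rho k ^ 3 := by
  have hK := IsMatSubgroup.isClosedUnitGroup Fr.cpt Fr.grp
  let ev : Matrix (Fin n) (Fin n) ℂ →ₗ[ℂ] (Fin n → ℂ) := (Matrix.mulVecBilin ℂ ℂ).flip v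
  let L₁ : Matrix (Fin n) (Fin n) ℂ →ₗ[ℂ] EuclideanSpace ℂ (Fin n) := Fr.S ∘ₗ ev
  let L₂ : Matrix (Fin n) (Fin n) ℂ →ₗ[ℂ] (Fin n → ℂ) := pr ∘ₗ ev
  let L₃ : Matrix (Fin n) (Fin n) ℂ →ₗ[ℂ] ℂ := (innerₛₗ ℂ (Fr.S v)) ∘ₗ L₁
  obtain ⟨a₁, ha₁, hL₁⟩ := exists_norm_le L₁
  obtain ⟨a₂, ha₂, hL₂⟩ := exists_norm_le L₂
  obtain ⟨a₃, ha₃, hL₃⟩ := exists_norm_le L₃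
  obtain ⟨C, hC, hcoord⟩ := hK.exists_coord (L₁.restrictScalars ℝ)
  obtain ⟨B, hB⟩ := Fr.cpt.isBounded.exists_norm_le
  set e := Real.exp 1 with he
  have he0 : 0 < e := Real.exp_pos 1
  set δ := Min.min (1 : ℝ) (1 / (2 * C * a₁ * e)) with hδ
  have hδ0 : 0 < δ := by positivity
  have hB0 : 0 ≤ B := (norm_nonneg _).trans (hB 1 Fr.grp.1)
  set D := 2 * C with hD
  have hD0 : 0 < D := by positivity
  refine ⟨a₂ * e * D ^ 2 + e * B * D + a₃ * e * D ^ 3, by positivity, ?_⟩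
  filter_upwards [hcoord δ hδ0] with k hk hkK
  obtain ⟨M, hM, Z, hZ, hLZ, hMδ, hMC, hkeq⟩ := hk hkK
  replace hkeq : k = (exp M : Matrix (Fin n) (Fin n) ℂ) * exp Z := hkeq
  subst hkeq
  set m := ‖M‖ with hm
  have hm0 : 0 ≤ m := norm_nonneg _
  have hm1 : m ≤ 1 := (hMδ.trans_le (min_le_left _ _)).le
  have hZv : Z *ᵥ v = 0 := by
    have : Fr.S (Z *ᵥ v) = 0 := hLZ
    rwa [map_eq_zero_iff _ Fr.inj] at this
  have hexpZ : exp Z *ᵥ v = v := by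
    have h1 := exp_series_hasSum_exp' (𝕂 := ℂ) Z
    have h2 := (LinearMap.toContinuousLinearMap ev).hasSum h1
    have h3 : HasSum (fun i => (LinearMap.toContinuousLinearMap ev) (((i.factorial : ℂ)⁻¹) • Z ^ i))
        ((LinearMap.toContinuousLinearMap ev) (((Nat.factorial 0 : ℂ)⁻¹) • Z ^ 0)) := by
      refine hasSum_single 0 fun i hi => ?_
      obtain ⟨j, rfl⟩ := Nat.exists_eq_succ_of_ne_zero hi
      simp [ev, pow_succ, hZv]
    have h4 := h2.unique h3
    simp [ev] at h4
    exact h4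
  have hkv : (exp M * exp Z) *ᵥ v = exp M *ᵥ v := by rw [← mulVec_mulVec, hexpZ]
  have hMlie := expSet_subset_lieAlgebra hG Fr.sub hM
  have hE1 : ‖exp M - 1‖ ≤ m * e := by
    have := norm_exp_sub_sum_le M hm1 1 (by norm_num)
    simp at this
    exact this
  have hE2 : ‖exp M - 1 - M‖ ≤ m ^ 2 * e := by
    have := norm_exp_sub_sum_le M hm1 2 (by norm_num)
    simp [Finset.sum_range_succ, ← sub_sub] at this
    exact this
  have hsub : exp M *ᵥ v - v = ev M + ev (exp M - 1 - M) := by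
    simp [ev]
  have hρ : Fr.rho (exp M * exp Z) = ‖L₁ M + L₁ (exp M - 1 - M)‖ := by
    rw [Frame.rho, hkv, hsub, map_add]; rfl
  set ρ := Fr.rho (exp M * exp Z) with hρdef
  have hmρ : m ≤ D * ρ := by
    have h1 : ‖L₁ M‖ - ‖L₁ (exp M - 1 - M)‖ ≤ ρ := by
      rw [hρ]
      have := norm_sub_le (L₁ M + L₁ (exp M - 1 - M)) (L₁ (exp M - 1 - M))
      rw [add_sub_cancel_right] at this
      linarith
    have h2 : ‖L₁ (exp M - 1 - M)‖ ≤ a₁ * (m ^ 2 * e) :=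
      (hL₁ _).trans (by gcongr)
    have h3 : m ≤ C * ‖L₁ M‖ := hMC
    have h4 : a₁ * e * m * (2 * C) ≤ 1 := by
      have : m ≤ 1 / (2 * C * a₁ * e) := (hMδ.trans_le (min_le_right _ _)).le
      rw [le_div_iff₀ (by positivity)] at this
      linarith
    have h5 : C * (a₁ * (m ^ 2 * e)) ≤ m / 2 := by nlinarith
    have h6 : C * ‖L₁ M‖ ≤ C * ρ + C * (a₁ * (m ^ 2 * e)) := by nlinarith
    rw [hD]; linarith
  have hρ0 : 0 ≤ ρ := norm_nonneg _
  have hm2 : m ^ 2 ≤ D ^ 2 * ρ ^ 2 := by rw [← mul_pow]; gcongr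
  have hm3 : m ^ 3 ≤ D ^ 3 * ρ ^ 3 := by rw [← mul_pow]; gcongr
  refine ⟨?_, ⟨exp Z, IsClosedUnitGroup.exp_mem hZ, hexpZ, ?_⟩, ?_⟩
  · rw [hkv, hsub, map_add, show pr (ev M) = 0 from hpr M hMlie, zero_add]
    calc ‖L₂ (exp M - 1 - M)‖ ≤ a₂ * (m ^ 2 * e) := (hL₂ _).trans (by gcongr)
      _ ≤ a₂ * (D ^ 2 * ρ ^ 2 * e) := by gcongr
      _ = a₂ * e * D ^ 2 * ρ ^ 2 := by ring
      _ ≤ _ := by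
        gcongr
        have h1 : 0 ≤ e * B * D := by positivity
        have h2 : 0 ≤ a₃ * e * D ^ 3 := by positivity
        linarith
  · have h1 : exp M * exp Z - exp Z = (exp M - 1) * exp Z := by rw [sub_mul, one_mul]
    rw [h1]
    calc ‖(exp M - 1) * exp Z‖ ≤ (m * e) * B :=
          (norm_mul_le _ _).trans (mul_le_mul hE1 (hB _ (IsClosedUnitGroup.exp_mem hZ)) (norm_nonneg _) (by positivity))
      _ ≤ (D * ρ * e) * B := by gcongr
      _ = e * B * D * ρ := by ring
      _ ≤ _ := by
        gcongr
        have h1 : 0 ≤ a₂ * e * D ^ 2 := by positivity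
        have h2 : 0 ≤ a₃ * e * D ^ 3 := by positivity
        linarith
  · rw [hkv]
    have hnegM : ‖-M‖ = m := norm_neg _
    have hinv : (inner ℂ (Fr.S v) (Fr.S (exp (-M) *ᵥ v))) =
        inner ℂ (Fr.S (exp M *ᵥ v)) (Fr.S v) := by
      have hMM : (exp M : Matrix (Fin n) (Fin n) ℂ) * exp (-M) = 1 := exp_mul_exp_neg M
      rw [← Fr.inner_mulVec (IsClosedUnitGroup.exp_mem hM) v (exp (-M) *ᵥ v), mulVec_mulVec]
      have hSM := congrArg (fun A => Fr.S (A *ᵥ v)) hMM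
      simp only [one_mulVec] at hSM
      exact congrArg (inner ℂ (Fr.S (exp M *ᵥ v))) hSM
    have him : (inner ℂ (Fr.S v) (Fr.S (exp (-M) *ᵥ v))).im =
        - (inner ℂ (Fr.S v) (Fr.S (exp M *ᵥ v))).im := by
      rw [hinv, ← inner_conj_symm, Complex.conj_im]
    have hvv : (inner ℂ (Fr.S v) (Fr.S v)).im = 0 := by
      have := inner_self_im (𝕜 := ℂ) (Fr.S v)
      simpa using this
    have hE3 : ‖exp M - (1 + M + (2 : ℝ)⁻¹ • M ^ 2)‖ ≤ m ^ 3 * e := by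
      have := norm_exp_sub_sum_le M hm1 3 (by norm_num)
      simp [Finset.sum_range_succ] at this
      exact this
    have hE3' : ‖exp (-M) - (1 + -M + (2 : ℝ)⁻¹ • M ^ 2)‖ ≤ m ^ 3 * e := by
      have := norm_exp_sub_sum_le (-M) (by rwa [hnegM]) 3 (by norm_num)
      simp [Finset.sum_range_succ] at this
      exact this
    have hLM : L₃ M = 0 := Fr.inner_lie hMlie
    have h1 : L₃ (exp M) - L₃ (exp (-M)) = L₃ (exp M - (1 + M + (2 : ℝ)⁻¹ • M ^ 2)) -
        L₃ (exp (-M) - (1 + -M + (2 : ℝ)⁻¹ • M ^ 2)) := by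
      simp only [map_sub, map_add, map_neg, hLM]
      ring
    have h2 : ‖L₃ (exp M) - L₃ (exp (-M))‖ ≤ 2 * (a₃ * (m ^ 3 * e)) := by
      rw [h1]
      refine (norm_sub_le _ _).trans ?_
      have e1 : ‖L₃ (exp M - (1 + M + (2 : ℝ)⁻¹ • M ^ 2))‖ ≤ a₃ * (m ^ 3 * e) :=
        (hL₃ _).trans (by gcongr)
      have e2 : ‖L₃ (exp (-M) - (1 + -M + (2 : ℝ)⁻¹ • M ^ 2))‖ ≤ a₃ * (m ^ 3 * e) :=
        (hL₃ _).trans (by gcongr)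
      linarith
    have h3 : (L₃ (exp M) - L₃ (exp (-M))).im = 2 * (inner ℂ (Fr.S v) (Fr.S (exp M *ᵥ v))).im := by
      rw [Complex.sub_im, show L₃ (exp (-M)) = inner ℂ (Fr.S v) (Fr.S (exp (-M) *ᵥ v)) from rfl, him,
        show L₃ (exp M) = inner ℂ (Fr.S v) (Fr.S (exp M *ᵥ v)) from rfl]
      ring
    have h4 := (Complex.abs_im_le_norm _).trans h2
    rw [h3, abs_mul, abs_two] at h4
    rw [map_sub, inner_sub_right, Complex.sub_im, hvv, sub_zero]
    calc _ ≤ a₃ * (m ^ 3 * e) := by linarith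
      _ ≤ a₃ * (D ^ 3 * ρ ^ 3 * e) := by gcongr
      _ = a₃ * e * D ^ 3 * ρ ^ 3 := by ring
      _ ≤ _ := by
        gcongr
        have h1 : 0 ≤ e * B * D := by positivity
        have h2 : 0 ≤ a₂ * e * D ^ 2 := by positivity
        linarith

/-- Second order control of the action of `K` near the isotropy group of `v`. -/
theorem Frame.estimates (hG : IsReductiveGroup ℂ n G) (Fr : Frame G v)
    (pr : (Fin n → ℂ) →ₗ[ℂ] (Fin n → ℂ)) (hpr : ∀ A ∈ lieAlgebra ℂ n G, pr (A *ᵥ v) = 0) :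
    ∃ C : ℝ, 0 < C ∧ ∀ k ∈ Fr.K,
      ‖pr (k *ᵥ v - v)‖ ≤ C * Fr.rho k ^ 2 ∧
      (∃ h ∈ Fr.K, h *ᵥ v = v ∧ ∀ x, ‖k *ᵥ x - h *ᵥ x‖ ≤ C * Fr.rho k * ‖x‖) ∧
      |(inner ℂ (Fr.S v) (Fr.S (k *ᵥ v - v))).im| ≤ C * Fr.rho k ^ 3 := by
  obtain ⟨C, hC, hloc⟩ := Fr.local_estimates hG pr hpr
  obtain ⟨U, hU, hUo, h1U⟩ := eventually_nhds_iff.1 hloc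
  obtain ⟨B, hB⟩ := Fr.cpt.isBounded.exists_norm_le
  have hB0 : 0 ≤ B := (norm_nonneg _).trans (hB 1 Fr.grp.1)
  set Far : Set (Matrix (Fin n) (Fin n) ℂ) := Fr.K ∩
    ⋂ h ∈ {h | h ∈ Fr.K ∧ h *ᵥ v = v}, (fun k => k * h⁻¹) ⁻¹' Uᶜ with hFar
  have hFarc : IsCompact Far := by
    refine Fr.cpt.inter_right (isClosed_biInter fun h _ => ?_)
    refine hUo.isClosed_compl.preimage ?_
    fun_prop
  have hS := Fr.continuous_S
  have hprc : Continuous pr := LinearMap.continuous_of_finiteDimensional _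
  -- a lower bound for the displacement away from the isotropy group
  obtain ⟨ρ₀, hρ₀, hfar⟩ : ∃ ρ₀ > 0, ∀ k ∈ Far, ρ₀ ≤ Fr.rho k := by
    rcases Far.eq_empty_or_nonempty with h | h
    · exact ⟨1, one_pos, by simp [h]⟩
    · obtain ⟨k₀, hk₀, hmin⟩ := hFarc.exists_isMinOn h Fr.continuous_rho.continuousOn
      refine ⟨Fr.rho k₀, lt_of_le_of_ne (Fr.rho_nonneg _) fun h0 => ?_, fun k hk => hmin hk⟩
      have hv0 := Fr.rho_eq_zero.1 h0.symm
      have := Set.mem_iInter₂.1 hk₀.2 k₀ ⟨hk₀.1, hv0⟩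
      apply this
      show k₀ * k₀⁻¹ ∈ U
      rw [Fr.grp.mul_inv hk₀.1]
      exact h1U
  obtain ⟨b₁, hb₁⟩ := Fr.cpt.exists_bound_of_continuousOn (f := fun k => pr (k *ᵥ v - v))
    (by fun_prop)
  obtain ⟨b₃, hb₃⟩ := Fr.cpt.exists_bound_of_continuousOn
    (f := fun k => inner ℂ (Fr.S v) (Fr.S (k *ᵥ v - v))) (by fun_prop)
  have hb₁0 : 0 ≤ b₁ := (norm_nonneg _).trans (hb₁ 1 Fr.grp.1)
  have hb₃0 : 0 ≤ b₃ := (norm_nonneg _).trans (hb₃ 1 Fr.grp.1)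
  refine ⟨C + C * B + b₁ / ρ₀ ^ 2 + 2 * B / ρ₀ + b₃ / ρ₀ ^ 3, by positivity, fun k hk => ?_⟩
  have hCB : 0 ≤ C * B := by positivity
  have h2 : 0 ≤ b₁ / ρ₀ ^ 2 := by positivity
  have h3 : 0 ≤ 2 * B / ρ₀ := by positivity
  have h4 : 0 ≤ b₃ / ρ₀ ^ 3 := by positivity
  have hρ := Fr.rho_nonneg k
  by_cases hkF : k ∈ Far
  · have hk0 := hfar k hkF
    refine ⟨?_, ⟨1, Fr.grp.1, one_mulVec _, fun x => ?_⟩, ?_⟩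
    · calc _ ≤ b₁ := hb₁ k hk
        _ = b₁ / ρ₀ ^ 2 * ρ₀ ^ 2 := by field_simp
        _ ≤ _ := by gcongr; linarith
    · calc ‖k *ᵥ x - 1 *ᵥ x‖ = ‖(k - 1) *ᵥ x‖ := by rw [sub_mulVec]
        _ ≤ ‖k - 1‖ * ‖x‖ := linfty_opNorm_mulVec _ _
        _ ≤ (2 * B / ρ₀ * ρ₀) * ‖x‖ := by
          gcongr
          have := (norm_sub_le k 1).trans (add_le_add (hB k hk) (hB 1 Fr.grp.1))
          rw [div_mul_cancel₀ _ hρ₀.ne']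
          linarith
        _ ≤ _ := by gcongr; linarith
    · calc _ ≤ b₃ := (Complex.abs_im_le_norm _).trans (hb₃ k hk)
        _ = b₃ / ρ₀ ^ 3 * ρ₀ ^ 3 := by field_simp
        _ ≤ _ := by gcongr; linarith
  · obtain ⟨h₀, hh₀, hv₀, hU₀⟩ : ∃ h ∈ Fr.K, h *ᵥ v = v ∧ k * h⁻¹ ∈ U := by
      by_contra hcon
      push Not at hcon
      exact hkF ⟨hk, Set.mem_iInter₂.2 fun h hh => hcon h hh.1 hh.2⟩
    have hk' : (k * h₀⁻¹) * h₀ = k := by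
      rw [mul_assoc, Fr.grp.inv_mul hh₀, mul_one]
    have hkv : (k * h₀⁻¹) *ᵥ v = k *ᵥ v := by
      conv_rhs => rw [← hk', ← mulVec_mulVec, hv₀]
    have hrho : Fr.rho (k * h₀⁻¹) = Fr.rho k := by rw [Frame.rho, Frame.rho, hkv]
    obtain ⟨e1, ⟨h, hh, hhv, hkh⟩, e3⟩ :=
      hU _ hU₀ (Fr.grp.2.1 _ hk _ (Fr.grp.2.2 _ hh₀).2)
    rw [hrho] at e1 hkh e3
    rw [hkv] at e1 e3
    refine ⟨e1.trans ?_, ⟨h * h₀, Fr.grp.2.1 _ hh _ hh₀, ?_, fun x => ?_⟩, e3.trans ?_⟩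
    · gcongr; linarith
    · rw [← mulVec_mulVec, hv₀, hhv]
    · calc ‖k *ᵥ x - (h * h₀) *ᵥ x‖ = ‖(k * h₀⁻¹ - h) *ᵥ (h₀ *ᵥ x)‖ := by
            rw [sub_mulVec, mulVec_mulVec, mulVec_mulVec, hk']
        _ ≤ ‖k * h₀⁻¹ - h‖ * (‖h₀‖ * ‖x‖) :=
            (linfty_opNorm_mulVec _ _).trans (by gcongr; exact linfty_opNorm_mulVec _ _)
        _ ≤ (C * Fr.rho k) * (B * ‖x‖) := by
            gcongr
            exact hB _ hh₀
        _ = C * B * Fr.rho k * ‖x‖ := by ring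
        _ ≤ _ := by gcongr; linarith
    · gcongr; linarith

end Estimates

section Laplace
open MeasureTheory Filter Topology

variable {X : Type*} [MeasurableSpace X]

/-- The data needed for the concentration of the measures `w ^ m • μ` near `{ρ = 0}`. -/
structure Laplace (μ : Measure X) (ρ : X → ℝ) (w : X → ℂ) : Prop where
  meas_rho : Measurable ρ
  meas_w : Measurable w
  nonneg : ∀ x, 0 ≤ ρ x
  bdd : ∃ B : ℝ, 0 ≤ B ∧ ∀ x, ρ x ≤ B
  decay : ∃ a : ℝ, 0 < a ∧ ∀ x, ‖w x‖ ≤ Real.exp (-(a * ρ x ^ 2))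
  re_nonneg : ∀ x, 0 ≤ (w x).re
  re_ge : ∀ x, 1 - ρ x ^ 2 / 2 ≤ (w x).re
  im_le : ∃ C : ℝ, 0 ≤ C ∧ ∀ x, |(w x).im| ≤ C * ρ x ^ 3
  pos : ∀ r > 0, 0 < μ.real {x | ρ x ≤ r}
  doubling : ∃ D : ℝ, 1 ≤ D ∧ ∀ r > 0, μ.real {x | ρ x ≤ 2 * r} ≤ D * μ.real {x | ρ x ≤ r}

variable {μ : Measure X} [IsProbabilityMeasure μ] {ρ : X → ℝ} {w : X → ℂ}

theorem exp_neg_le_sum {s : ℝ} (J : ℕ) :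
    Real.exp (-s) ≤ (if s ≤ 1 then Real.exp (-s) else 0) + (∑ j ∈ Finset.range J, Real.exp (-2 ^ j) * (if s ≤ 2 ^ (j + 1) then 1 else 0)) +
      Real.exp (-2 ^ J) := by
  induction J with
  | zero =>
    simp only [Finset.range_zero, Finset.sum_empty, add_zero, pow_zero]
    split_ifs with h
    · have := Real.exp_pos (-1); linarith
    · rw [zero_add]; exact Real.exp_le_exp.2 (by linarith)
  | succ J ih =>
    rw [Finset.sum_range_succ]
    by_cases h : s ≤ 2 ^ (J + 1)
    · rw [if_pos h, mul_one]
      have := Real.exp_pos (-2 ^ (J + 1)); linarith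
    · have h1 : Real.exp (-s) ≤ Real.exp (-2 ^ (J + 1)) := Real.exp_le_exp.2 (by linarith)
      have h2 : 0 ≤ ∑ j ∈ Finset.range J, Real.exp (-2 ^ j) * (if s ≤ 2 ^ (j + 1) then 1 else 0) :=
        Finset.sum_nonneg fun j _ => by positivity
      have h3 : (0 : ℝ) ≤ (if s ≤ 1 then Real.exp (-s) else 0) := by positivity
      have h4 : (0 : ℝ) ≤ Real.exp (-2 ^ J) * (if s ≤ 2 ^ (J + 1) then 1 else 0) := by positivity
      linarith

theorem summable_doubling (D : ℝ) (hD : 1 ≤ D) :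
    Summable (fun j : ℕ => Real.exp (-2 ^ j) * D ^ (j + 1)) := by
  have hD0 : 0 < D := by linarith
  refine summable_of_ratio_test_tendsto_lt_one (l := 0) zero_lt_one
    (Eventually.of_forall fun j => by positivity) ?_
  have h1 : ∀ j : ℕ, ‖Real.exp (-2 ^ (j + 1)) * D ^ (j + 1 + 1)‖ / ‖Real.exp (-2 ^ j) * D ^ (j + 1)‖ =
      D * Real.exp (-2 ^ j) := by
    intro j
    rw [Real.norm_of_nonneg (by positivity), Real.norm_of_nonneg (by positivity),
      div_eq_iff (by positivity), pow_succ D (j + 1)]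
    have : Real.exp (-2 ^ (j + 1)) = Real.exp (-2 ^ j) * Real.exp (-2 ^ j) := by
      rw [← Real.exp_add]; congr 1; ring
    rw [this]; ring
  simp only [h1]
  have h2 : Tendsto (fun j : ℕ => (2 : ℝ) ^ j) atTop atTop := tendsto_pow_atTop_atTop_of_one_lt (by norm_num)
  have h3 := (Real.tendsto_exp_neg_atTop_nhds_zero.comp h2).const_mul D
  simpa using h3

theorem Laplace.measurable_le (L : Laplace μ ρ w) (r : ℝ) : MeasurableSet {x | ρ x ≤ r} :=
  measurableSet_le L.meas_rho measurable_const

theorem Laplace.integrable_bdd {E : Type*} [NormedAddCommGroup E] {f : X → E} (hf : AEStronglyMeasurable f μ) (C : ℝ)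
    (h : ∀ x, ‖f x‖ ≤ C) : Integrable f μ :=
  Integrable.of_bound hf C (Eventually.of_forall h)

theorem Laplace.meas_pow (L : Laplace μ ρ w) {D : ℝ} (hD : 1 ≤ D)
    (hd : ∀ r > 0, μ.real {x | ρ x ≤ 2 * r} ≤ D * μ.real {x | ρ x ≤ r}) {t : ℝ} (ht : 0 < t) (j : ℕ) :
    μ.real {x | ρ x ≤ 2 ^ j * t} ≤ D ^ j * μ.real {x | ρ x ≤ t} := by
  induction j with
  | zero => simp
  | succ j ih =>
    have := hd (2 ^ j * t) (by positivity)
    rw [pow_succ', mul_assoc, pow_succ', mul_assoc]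
    exact this.trans (by gcongr)

theorem Laplace.exp_integral_le (L : Laplace μ ρ w) :
    ∃ C : ℝ, 0 < C ∧ ∀ t : ℝ, 0 < t → ∫ x, Real.exp (-(ρ x / t)) ∂μ ≤ C * μ.real {x | ρ x ≤ t} := by
  obtain ⟨D, hD, hd⟩ := L.doubling
  have hsum := summable_doubling D hD
  set T := ∑' j : ℕ, Real.exp (-2 ^ j) * D ^ (j + 1) with hT
  have hT0 : 0 ≤ T := tsum_nonneg fun j => by positivity
  refine ⟨1 + T, by positivity, fun t ht => ?_⟩
  set M := μ.real {x | ρ x ≤ t} with hM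
  have hM0 : 0 ≤ M := measureReal_nonneg
  have hmr := L.meas_rho
  have key : ∀ J : ℕ, ∫ x, Real.exp (-(ρ x / t)) ∂μ ≤ (1 + T) * M + Real.exp (-2 ^ J) := by
    intro J
    have hInt : ∀ r : ℝ, Integrable ({x | ρ x ≤ r}.indicator (fun _ => (1 : ℝ))) μ := fun r =>
      (integrable_const (1 : ℝ)).indicator (L.measurable_le r)
    have hintv : ∀ r : ℝ, ∫ x, {x | ρ x ≤ r}.indicator (fun _ => (1 : ℝ)) x ∂μ = μ.real {x | ρ x ≤ r} := by
      intro r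
      rw [integral_indicator (L.measurable_le r)]; simp
    have hpt : ∀ x, Real.exp (-(ρ x / t)) ≤ {x | ρ x ≤ t}.indicator (fun _ => (1 : ℝ)) x +
        (∑ j ∈ Finset.range J, Real.exp (-2 ^ j) * {x | ρ x ≤ 2 ^ (j + 1) * t}.indicator (fun _ => (1 : ℝ)) x) +
        Real.exp (-2 ^ J) := by
      intro x
      have h1 := exp_neg_le_sum (s := ρ x / t) J
      simp only [Set.indicator_apply, Set.mem_ofPred_eq]
      simp only [div_le_iff₀ ht, one_mul] at h1
      refine h1.trans ?_
      gcongr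
      split_ifs
      · rw [Real.exp_le_one_iff]
        have := div_nonneg (L.nonneg x) ht.le
        linarith
      · rfl
    have hi1 : Integrable (fun x => ∑ j ∈ Finset.range J, Real.exp (-2 ^ j) * {x | ρ x ≤ 2 ^ (j + 1) * t}.indicator (fun _ => (1 : ℝ)) x) μ :=
      integrable_finsetSum _ fun j _ => (hInt _).const_mul _
    calc _ ≤ ∫ x, ({x | ρ x ≤ t}.indicator (fun _ => (1 : ℝ)) x +
        (∑ j ∈ Finset.range J, Real.exp (-2 ^ j) * {x | ρ x ≤ 2 ^ (j + 1) * t}.indicator (fun _ => (1 : ℝ)) x) +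
        Real.exp (-2 ^ J)) ∂μ := by
          refine integral_mono ?_ (((hInt _).add hi1).add (integrable_const _)) hpt
          refine Laplace.integrable_bdd (by fun_prop) 1 fun x => ?_
          rw [Real.norm_of_nonneg (by positivity), Real.exp_le_one_iff]
          have := div_nonneg (L.nonneg x) ht.le
          linarith
      _ = M + (∑ j ∈ Finset.range J, Real.exp (-2 ^ j) * μ.real {x | ρ x ≤ 2 ^ (j + 1) * t}) + Real.exp (-2 ^ J) := by
          have e := integral_add ((hInt t).add hi1) (integrable_const (Real.exp (-2 ^ J)))
          simp only [Pi.add_apply] at e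
          rw [e, integral_add (hInt _) hi1,
            integral_finsetSum _ fun j _ => (hInt _).const_mul _]
          simp only [integral_const_mul, hintv]
          simp [hM]
      _ ≤ M + (∑ j ∈ Finset.range J, Real.exp (-2 ^ j) * (D ^ (j + 1) * M)) + Real.exp (-2 ^ J) := by
          gcongr with j _
          exact L.meas_pow hD hd ht _
      _ ≤ (1 + T) * M + Real.exp (-2 ^ J) := by
          have : ∑ j ∈ Finset.range J, Real.exp (-2 ^ j) * (D ^ (j + 1) * M) ≤ T * M := by
            simp only [← mul_assoc]
            rw [← Finset.sum_mul]
            gcongr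
            exact hsum.sum_le_tsum _ fun j _ => by positivity
          linarith
  have hlim : Tendsto (fun J : ℕ => (1 + T) * M + Real.exp (-2 ^ J)) atTop (𝓝 ((1 + T) * M + 0)) := by
    have h2 : Tendsto (fun j : ℕ => (2 : ℝ) ^ j) atTop atTop := tendsto_pow_atTop_atTop_of_one_lt (by norm_num)
    exact (Real.tendsto_exp_neg_atTop_nhds_zero.comp h2).const_add _
  rw [add_zero] at hlim
  exact ge_of_tendsto' hlim key

theorem exp_quad_le {a : ℝ} (ha : 0 < a) (A s : ℝ) :
    Real.exp (A * s - a * s ^ 2) ≤ Real.exp ((A + 1) ^ 2 / (4 * a)) * Real.exp (-s) := by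
  rw [← Real.exp_add]
  refine Real.exp_le_exp.2 ?_
  have : (A + 1) ^ 2 / (4 * a) - ((A + 1) * s - a * s ^ 2) = (2 * a * s - (A + 1)) ^ 2 / (4 * a) := by
    field_simp; ring
  have h2 : 0 ≤ (2 * a * s - (A + 1)) ^ 2 / (4 * a) := by positivity
  linarith

theorem norm_pow_sub_pow_le {z c : ℂ} {r : ℝ} (hz : ‖z‖ ≤ r) (hc : ‖c‖ ≤ r) (m : ℕ) :
    ‖z ^ m - c ^ m‖ ≤ m * r ^ (m - 1) * ‖z - c‖ := by
  have hr : 0 ≤ r := (norm_nonneg _).trans hz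
  induction m with
  | zero => simp
  | succ m ih =>
    have e : z ^ (m + 1) - c ^ (m + 1) = z * (z ^ m - c ^ m) + (z - c) * c ^ m := by ring
    have e2 : r * (m * r ^ (m - 1) * ‖z - c‖) = m * r ^ m * ‖z - c‖ := by
      cases m with
      | zero => simp
      | succ m => simp only [Nat.add_sub_cancel]; ring
    calc _ ≤ ‖z‖ * ‖z ^ m - c ^ m‖ + ‖z - c‖ * ‖c‖ ^ m := by
          rw [e]; refine (norm_add_le _ _).trans ?_
          rw [norm_mul, norm_mul, norm_pow]
      _ ≤ r * (m * r ^ (m - 1) * ‖z - c‖) + ‖z - c‖ * r ^ m := by gcongr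
      _ = _ := by rw [e2, Nat.add_sub_cancel]; push_cast; ring

theorem norm_pow_sub_le (z : ℂ) (hz : 0 ≤ z.re) (m : ℕ) :
    ‖z ^ m - (‖z‖ : ℂ) ^ m‖ ≤ m * ‖z‖ ^ (m - 1) * (2 * |z.im|) := by
  have h1 : ‖z - (‖z‖ : ℂ)‖ ≤ 2 * |z.im| := by
    have h2 : z - (‖z‖ : ℂ) = ((z.re - ‖z‖ : ℝ) : ℂ) + (z.im : ℂ) * Complex.I := by
      apply Complex.ext <;> simp
    rw [h2]
    refine (norm_add_le _ _).trans ?_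
    rw [norm_mul, Complex.norm_I, mul_one, Complex.norm_real, Complex.norm_real, Real.norm_eq_abs,
      Real.norm_eq_abs, abs_sub_comm, abs_of_nonneg (by
        have := Complex.re_le_norm z; linarith)]
    have := Complex.norm_le_abs_re_add_abs_im z
    rw [abs_of_nonneg hz] at this
    linarith
  have h3 : ‖z ^ m - (‖z‖ : ℂ) ^ m‖ ≤ m * ‖z‖ ^ (m - 1) * ‖z - (‖z‖ : ℂ)‖ := by
    exact norm_pow_sub_pow_le le_rfl (by simp) m
  exact h3.trans (by gcongr)

/-- The normalising constant. -/
def lapZ (μ : Measure X) (w : X → ℂ) (m : ℕ) : ℂ := ∫ x, w x ^ m ∂μ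

theorem Laplace.norm_pow_le (L : Laplace μ ρ w) {a : ℝ} (hw : ∀ x, ‖w x‖ ≤ Real.exp (-(a * ρ x ^ 2)))
    (m : ℕ) (x : X) : ‖w x ^ m‖ ≤ Real.exp (-(a * (Real.sqrt m * ρ x) ^ 2)) := by
  rw [norm_pow, mul_pow, Real.sq_sqrt (Nat.cast_nonneg m)]
  refine (pow_le_pow_left₀ (norm_nonneg _) (hw x) m).trans ?_
  rw [← Real.exp_nat_mul]
  exact Real.exp_le_exp.2 (by linarith)

theorem Laplace.norm_w_le_one (L : Laplace μ ρ w) (x : X) : ‖w x‖ ≤ 1 := by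
  obtain ⟨a, ha, hw⟩ := L.decay
  refine (hw x).trans ?_
  rw [Real.exp_le_one_iff, neg_nonpos]
  positivity

theorem Laplace.lower_bound (L : Laplace μ ρ w) :
    ∀ᶠ m : ℕ in atTop, 0 < m ∧ μ.real {x | ρ x ≤ (Real.sqrt m)⁻¹} / 4 ≤ ‖lapZ μ w m‖ := by
  obtain ⟨a, ha, hw⟩ := L.decay
  obtain ⟨B, hB0, hB⟩ := L.bdd
  obtain ⟨C, hC, him⟩ := L.im_le
  obtain ⟨C₁, hC₁, hexp⟩ := L.exp_integral_le
  have hmr := L.meas_rho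
  have hmw := L.meas_w
  set C₂ := Real.exp (a * B ^ 2) * (2 * C) * 6 * Real.exp ((1 + 1) ^ 2 / (4 * a)) with hC₂
  have hev : ∀ᶠ m : ℕ in atTop, C₂ * C₁ / Real.sqrt m ≤ 1 / 4 := by
    have h1 : Tendsto (fun m : ℕ => Real.sqrt m) atTop atTop :=
      Real.tendsto_sqrt_atTop.comp tendsto_natCast_atTop_atTop
    have h2 := h1.const_div_atTop (C₂ * C₁)
    exact (h2.eventually (gt_mem_nhds (by norm_num : (0 : ℝ) < 1 / 4))).mono fun _ h => h.le
  filter_upwards [hev, eventually_gt_atTop 0] with m hm hm0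
  refine ⟨hm0, ?_⟩
  have hm0' : (0 : ℝ) < m := by exact_mod_cast hm0
  set q := Real.sqrt m with hq
  have hq0 : 0 < q := Real.sqrt_pos.2 hm0'
  have hqq : q ^ 2 = m := Real.sq_sqrt hm0'.le
  set M := μ.real {x | ρ x ≤ q⁻¹} with hM
  have hM0 : 0 ≤ M := measureReal_nonneg
  have hiw : Integrable (fun x => w x ^ m) μ :=
    Laplace.integrable_bdd (by fun_prop) 1 fun x => by
      rw [norm_pow]; exact pow_le_one₀ (norm_nonneg _) (L.norm_w_le_one x)
  have hin : Integrable (fun x => ((‖w x‖ : ℂ)) ^ m) μ :=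
    Laplace.integrable_bdd (by fun_prop) 1 fun x => by
      rw [norm_pow, Complex.norm_real, norm_norm]; exact pow_le_one₀ (norm_nonneg _) (L.norm_w_le_one x)
  have hin' : Integrable (fun x => ‖w x‖ ^ m) μ :=
    Laplace.integrable_bdd (by fun_prop) 1 fun x => by
      rw [norm_pow, norm_norm]; exact pow_le_one₀ (norm_nonneg _) (L.norm_w_le_one x)
  have hie : Integrable (fun x => Real.exp (-(ρ x / q⁻¹))) μ :=
    Laplace.integrable_bdd (by fun_prop) 1 fun x => by
      rw [Real.norm_of_nonneg (by positivity), Real.exp_le_one_iff]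
      have := div_nonneg (L.nonneg x) (inv_pos.2 hq0).le
      linarith
  -- the phase is negligible
  have hdiff : ‖lapZ μ w m - ∫ x, ((‖w x‖ : ℂ)) ^ m ∂μ‖ ≤ M / 4 := by
    rw [lapZ, ← integral_sub hiw hin]
    have hpt : ∀ x, ‖w x ^ m - (‖w x‖ : ℂ) ^ m‖ ≤ C₂ / q * Real.exp (-(ρ x / q⁻¹)) := by
      intro x
      have hx0 := L.nonneg x
      set s := q * ρ x with hs
      have hs0 : 0 ≤ s := by positivity
      have h1 : ‖w x‖ ^ (m - 1) ≤ Real.exp (a * B ^ 2) * Real.exp (-(a * s ^ 2)) := by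
        refine (pow_le_pow_left₀ (norm_nonneg _) (hw x) _).trans ?_
        rw [← Real.exp_nat_mul, ← Real.exp_add]
        refine Real.exp_le_exp.2 ?_
        rw [hs, mul_pow, hqq, Nat.cast_sub hm0, Nat.cast_one]
        have : a * ρ x ^ 2 ≤ a * B ^ 2 := by gcongr; exact hB x
        linarith
      have h2 : s ^ 3 ≤ 6 * Real.exp s := by
        have := Real.pow_div_factorial_le_exp s hs0 3
        rw [div_le_iff₀ (by positivity)] at this
        simpa [Nat.factorial, mul_comm] using this
      have h3 : m * ρ x ^ 3 = s ^ 3 / q := by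
        rw [hs, ← hqq]; field_simp
      have h4 := exp_quad_le ha 1 s
      have h5 : Real.exp s * Real.exp (-(a * s ^ 2)) = Real.exp (1 * s - a * s ^ 2) := by
        rw [← Real.exp_add]; congr 1; ring
      calc _ ≤ m * ‖w x‖ ^ (m - 1) * (2 * |(w x).im|) := norm_pow_sub_le _ (L.re_nonneg x) m
        _ ≤ m * (Real.exp (a * B ^ 2) * Real.exp (-(a * s ^ 2))) * (2 * (C * ρ x ^ 3)) := by
          gcongr; exact him x
        _ = Real.exp (a * B ^ 2) * (2 * C) * (m * ρ x ^ 3) * Real.exp (-(a * s ^ 2)) := by ring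
        _ = Real.exp (a * B ^ 2) * (2 * C) * (s ^ 3 / q) * Real.exp (-(a * s ^ 2)) := by rw [h3]
        _ ≤ Real.exp (a * B ^ 2) * (2 * C) * ((6 * Real.exp s) / q) * Real.exp (-(a * s ^ 2)) := by
          gcongr
        _ = Real.exp (a * B ^ 2) * (2 * C) * 6 / q * (Real.exp s * Real.exp (-(a * s ^ 2))) := by ring
        _ ≤ Real.exp (a * B ^ 2) * (2 * C) * 6 / q * (Real.exp ((1 + 1) ^ 2 / (4 * a)) * Real.exp (-s)) := by
          rw [h5]; gcongr
        _ = _ := by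
          rw [hC₂, div_inv_eq_mul, mul_comm (ρ x) q]; ring
    calc _ ≤ ∫ x, C₂ / q * Real.exp (-(ρ x / q⁻¹)) ∂μ :=
          norm_integral_le_of_norm_le (hie.const_mul _) (Eventually.of_forall hpt)
      _ ≤ C₂ / q * (C₁ * M) := by
          rw [integral_const_mul]
          gcongr
          exact hexp _ (by positivity)
      _ = C₂ * C₁ / q * M := by ring
      _ ≤ 1 / 4 * M := by gcongr
      _ = M / 4 := by ring
  have hlow : M / 2 ≤ ‖∫ x, ((‖w x‖ : ℂ)) ^ m ∂μ‖ := by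
    have e1 : ∫ x, ((‖w x‖ : ℂ)) ^ m ∂μ = ((∫ x, ‖w x‖ ^ m ∂μ : ℝ) : ℂ) := by
      rw [← integral_complex_ofReal]; simp
    rw [e1, Complex.norm_real]
    refine le_trans ?_ (le_abs_self _)
    have h1 : ∫ x, {x | ρ x ≤ q⁻¹}.indicator (fun _ => (1 / 2 : ℝ)) x ∂μ = M / 2 := by
      rw [integral_indicator (L.measurable_le _)]; simp [hM]; ring
    rw [← h1]
    refine integral_mono ((integrable_const _).indicator (L.measurable_le _)) hin' fun x => ?_
    simp only [Set.indicator_apply, Set.mem_ofPred_eq]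
    split_ifs with hx
    · have hx0 := L.nonneg x
      have h2 : ρ x ^ 2 ≤ 1 / m := by
        rw [← hqq, one_div, ← inv_pow]; gcongr
      have hm1 : (1 : ℝ) ≤ m := by exact_mod_cast hm0
      have h2' : 1 / (m : ℝ) ≤ 1 := by rw [div_le_one hm0']; exact hm1
      have h3 : 1 + -(1 / (2 * m) : ℝ) ≤ ‖w x‖ := by
        have := (L.re_ge x).trans (Complex.re_le_norm _)
        have e : (1 / (2 * m) : ℝ) = 1 / m / 2 := by field_simp
        rw [e]; linarith
      have e : (1 / (2 * m) : ℝ) = 1 / m / 2 := by field_simp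
      have h4 := one_add_mul_le_pow (a := -(1 / (2 * m) : ℝ)) (by rw [e]; linarith) m
      calc (1 / 2 : ℝ) = 1 + m * -(1 / (2 * m) : ℝ) := by field_simp; ring
        _ ≤ _ := h4
        _ ≤ ‖w x‖ ^ m := by
          gcongr
          rw [e]; linarith
    · positivity
  have := norm_sub_norm_le (∫ x, ((‖w x‖ : ℂ)) ^ m ∂μ) (lapZ μ w m)
  rw [norm_sub_rev] at this
  linarith

theorem Laplace.tendsto_zero (L : Laplace μ ρ w) {f : ℕ → X → ℂ} {ε : ℕ → ℝ}
    (hε : Tendsto ε atTop (𝓝 0)) {a A : ℝ} (ha : 0 < a)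
    (hf : ∀ᶠ m : ℕ in atTop, ∀ x, ‖f m x‖ ≤ ε m * Real.exp (A * (Real.sqrt m * ρ x) - a * (Real.sqrt m * ρ x) ^ 2)) :
    Tendsto (fun m => (lapZ μ w m)⁻¹ * ∫ x, f m x ∂μ) atTop (𝓝 0) := by
  obtain ⟨C₁, hC₁, hexp⟩ := L.exp_integral_le
  have hmr := L.meas_rho
  set E := Real.exp ((A + 1) ^ 2 / (4 * a)) with hE
  have hlim : Tendsto (fun m => 4 * E * C₁ * |ε m|) atTop (𝓝 0) := by
    have := hε.abs.const_mul (4 * E * C₁)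
    simpa using this
  refine squeeze_zero_norm' ?_ hlim
  filter_upwards [L.lower_bound, hf] with m hm hfm
  obtain ⟨hm0, hlow⟩ := hm
  have hm0' : (0 : ℝ) < m := by exact_mod_cast hm0
  set q := Real.sqrt m with hq
  have hq0 : 0 < q := Real.sqrt_pos.2 hm0'
  set M := μ.real {x | ρ x ≤ q⁻¹} with hM
  have hM0 : 0 < M := L.pos _ (by positivity)
  have hie : Integrable (fun x => Real.exp (-(ρ x / q⁻¹))) μ :=
    Laplace.integrable_bdd (by fun_prop) 1 fun x => by
      rw [Real.norm_of_nonneg (by positivity), Real.exp_le_one_iff]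
      have := div_nonneg (L.nonneg x) (inv_pos.2 hq0).le
      linarith
  have h1 : ‖∫ x, f m x ∂μ‖ ≤ |ε m| * E * (C₁ * M) := by
    calc _ ≤ ∫ x, |ε m| * E * Real.exp (-(ρ x / q⁻¹)) ∂μ := by
          refine norm_integral_le_of_norm_le (hie.const_mul _) (Eventually.of_forall fun x => ?_)
          refine (hfm x).trans ?_
          rw [mul_assoc, div_inv_eq_mul, mul_comm (ρ x) q]
          exact mul_le_mul (le_abs_self _) (exp_quad_le ha _ _) (by positivity) (abs_nonneg _)
      _ ≤ _ := by
          rw [integral_const_mul]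
          gcongr
          exact hexp _ (by positivity)
  rw [norm_mul, norm_inv]
  have hZ : 0 < ‖lapZ μ w m‖ := by linarith
  rw [inv_mul_le_iff₀ hZ]
  calc _ ≤ _ := h1
    _ = (M / 4) * (4 * E * C₁ * |ε m|) := by ring
    _ ≤ _ := by gcongr

theorem Laplace.lapZ_ne_zero (L : Laplace μ ρ w) : ∀ᶠ m : ℕ in atTop, lapZ μ w m ≠ 0 := by
  filter_upwards [L.lower_bound] with m hm h0
  have hm0' : (0 : ℝ) < m := by exact_mod_cast hm.1
  have := L.pos _ (inv_pos.2 (Real.sqrt_pos.2 hm0'))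
  rw [h0, norm_zero] at hm
  linarith [hm.2]

end Laplace

section FrameLaplace
open MeasureTheory Filter Topology Matrix

variable {n : ℕ} {G : Set (Matrix (Fin n) (Fin n) ℂ)} {v : Fin n → ℂ}

/-- A bi-invariant probability measure on the compact group of a frame. -/
structure Frame.IsMean (Fr : Frame G v) (μ : Measure Fr.K) : Prop where
  prob : IsProbabilityMeasure μ
  left : ∀ k₀ ∈ Fr.K, ∀ f : Matrix (Fin n) (Fin n) ℂ → ℂ,
    ∫ k : Fr.K, f (k₀ * k) ∂μ = ∫ k : Fr.K, f k ∂μ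
  right : ∀ k₀ ∈ Fr.K, ∀ f : Matrix (Fin n) (Fin n) ℂ → ℂ,
    ∫ k : Fr.K, f (k * k₀) ∂μ = ∫ k : Fr.K, f k ∂μ
  left_set : ∀ k₀ ∈ Fr.K, ∀ s : Set (Matrix (Fin n) (Fin n) ℂ),
    μ {k | k₀ * k ∈ s} = μ {k | (k : Matrix (Fin n) (Fin n) ℂ) ∈ s}
  openPos : μ.IsOpenPosMeasure

theorem Frame.exists_isMean (Fr : Frame G v) : ∃ μ : Measure Fr.K, Fr.IsMean μ := by
  obtain ⟨μ, h1, h2, h3, h4, h5⟩ := exists_mean Fr.cpt Fr.grp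
  exact ⟨μ, h1, h2, h3, h4, h5⟩

/-- A constant bounding the quadratic form along the orbit. -/
def Frame.R (Fr : Frame G v) : ℝ := 2 * ‖Fr.S v‖ ^ 2 + 1

theorem Frame.R_pos (Fr : Frame G v) : 0 < Fr.R := by unfold Frame.R; positivity

/-- The linear form dual to `v`. -/
def Frame.ell (Fr : Frame G v) : (Fin n → ℂ) →ₗ[ℂ] ℂ := (innerₛₗ ℂ (Fr.S v)) ∘ₗ Fr.S

theorem Frame.ell_apply (Fr : Frame G v) (x : Fin n → ℂ) :
    Fr.ell x = inner ℂ (Fr.S v) (Fr.S x) := rfl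

/-- The weight concentrating near the stabilizer of `v`. -/
def Frame.wt (Fr : Frame G v) (k : Matrix (Fin n) (Fin n) ℂ) : ℂ :=
  1 + Fr.ell (k *ᵥ v - v) / (Fr.R : ℂ)

theorem Frame.continuous_ell (Fr : Frame G v) : Continuous Fr.ell :=
  LinearMap.continuous_of_finiteDimensional _

theorem Frame.continuous_wt (Fr : Frame G v) : Continuous Fr.wt := by
  unfold Frame.wt
  have := Fr.continuous_ell
  fun_prop

theorem Frame.ell_re (Fr : Frame G v) {k : Matrix (Fin n) (Fin n) ℂ} (hk : k ∈ Fr.K) :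
    (Fr.ell (k *ᵥ v - v)).re = -(Fr.rho k ^ 2 / 2) := by
  have h := Fr.iso k hk v
  have h2 := norm_add_sq (𝕜 := ℂ) (Fr.S v) (Fr.S (k *ᵥ v - v))
  rw [← map_add, add_sub_cancel, h] at h2
  rw [Frame.ell_apply, Frame.rho]
  have h3 : RCLike.re (inner ℂ (Fr.S v) (Fr.S (k *ᵥ v - v))) =
    (inner ℂ (Fr.S v) (Fr.S (k *ᵥ v - v))).re := rfl
  rw [h3] at h2
  linarith

theorem Frame.rho_le (Fr : Frame G v) {k : Matrix (Fin n) (Fin n) ℂ} (hk : k ∈ Fr.K) :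
    Fr.rho k ≤ 2 * ‖Fr.S v‖ := by
  rw [Frame.rho, map_sub]
  have := norm_sub_le (Fr.S (k *ᵥ v)) (Fr.S v)
  rw [Fr.iso k hk] at this; linarith

theorem Frame.norm_ell_le (Fr : Frame G v) (x : Fin n → ℂ) : ‖Fr.ell x‖ ≤ ‖Fr.S v‖ * ‖Fr.S x‖ :=
  norm_inner_le_norm (𝕜 := ℂ) (Fr.S v) (Fr.S x)

theorem Frame.rho_inv_mul (Fr : Frame G v) {k h : Matrix (Fin n) (Fin n) ℂ} (hk : k ∈ Fr.K) :
    Fr.rho (k⁻¹ * h) = ‖Fr.S (h *ᵥ v - v) - Fr.S (k *ᵥ v - v)‖ := by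
  have e : h *ᵥ v - v - (k *ᵥ v - v) = k *ᵥ ((k⁻¹ * h) *ᵥ v - v) := by
    rw [mulVec_sub, mulVec_mulVec, ← mul_assoc, IsMatSubgroup.mul_inv Fr.grp hk, one_mul]; abel
  rw [← map_sub, e, Fr.iso k hk]; rfl

theorem exists_finite_cover (n : ℕ) : ∃ t : Finset (EuclideanSpace ℂ (Fin n)), t.Nonempty ∧
    ∀ r > 0, ∀ x : EuclideanSpace ℂ (Fin n), ‖x‖ ≤ 2 * r → ∃ c ∈ t, ‖x - (r : ℂ) • c‖ < r / 2 := by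
  have hc := isCompact_closedBall (0 : EuclideanSpace ℂ (Fin n)) 2
  obtain ⟨t, ht, hcov⟩ := hc.elim_nhds_subcover (fun c => Metric.ball c (1 / 2))
    fun c _ => Metric.ball_mem_nhds c (by norm_num)
  have key : ∀ r > 0, ∀ x : EuclideanSpace ℂ (Fin n), ‖x‖ ≤ 2 * r →
      ∃ c ∈ t, ‖x - (r : ℂ) • c‖ < r / 2 := by
    intro r hr x hx
    have hr' : (r : ℂ) ≠ 0 := by exact_mod_cast hr.ne'
    have h1 : ((r : ℂ)⁻¹ • x) ∈ Metric.closedBall (0 : EuclideanSpace ℂ (Fin n)) 2 := by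
      rw [mem_closedBall_zero_iff, norm_smul, norm_inv, Complex.norm_real, Real.norm_of_nonneg hr.le,
        inv_mul_le_iff₀ hr]
      linarith
    obtain ⟨c, hc, hxc⟩ := Set.mem_iUnion₂.1 (hcov h1)
    refine ⟨c, hc, ?_⟩
    rw [Metric.mem_ball, dist_eq_norm] at hxc
    have e : x - (r : ℂ) • c = (r : ℂ) • ((r : ℂ)⁻¹ • x - c) := by
      rw [smul_sub, smul_smul, mul_inv_cancel₀ hr', one_smul]
    rw [e, norm_smul, Complex.norm_real, Real.norm_of_nonneg hr.le]
    nlinarith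
  obtain ⟨c, hc, -⟩ := key 1 one_pos 0 (by simp)
  exact ⟨t, ⟨c, hc⟩, key⟩

theorem Frame.laplace (hG : IsReductiveGroup ℂ n G) (Fr : Frame G v) {μ : Measure Fr.K}
    (hμ : Fr.IsMean μ) : Laplace μ (fun k => Fr.rho k) (fun k => Fr.wt k) := by
  have := hμ.prob
  have := hμ.openPos
  have hρ : Continuous fun k : Fr.K => Fr.rho k := Fr.continuous_rho.comp continuous_subtype_val
  have hw : Continuous fun k : Fr.K => Fr.wt k := Fr.continuous_wt.comp continuous_subtype_val
  have hR := Fr.R_pos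
  have hre : ∀ k : Fr.K, (Fr.wt k).re = 1 - Fr.rho k ^ 2 / (2 * Fr.R) := by
    intro k
    rw [Frame.wt, Complex.add_re, Complex.div_ofReal_re, Fr.ell_re k.2, Complex.one_re]
    field_simp; ring
  have him : ∀ k : Fr.K, (Fr.wt k).im = (Fr.ell (k *ᵥ v - v)).im / Fr.R := by
    intro k
    rw [Frame.wt, Complex.add_im, Complex.div_ofReal_im, Complex.one_im, zero_add]
  have hR1 : 1 ≤ Fr.R := by unfold Frame.R; nlinarith [sq_nonneg ‖Fr.S v‖]
  refine ⟨hρ.measurable, hw.measurable, fun k => Fr.rho_nonneg k,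
    ⟨2 * ‖Fr.S v‖, by positivity, fun k => Fr.rho_le k.2⟩, ?_, ?_, ?_, ?_, ?_, ?_⟩
  · refine ⟨1 / (4 * Fr.R), by positivity, fun k => ?_⟩
    have h1 : ‖Fr.wt k‖ ^ 2 ≤ 1 - Fr.rho k ^ 2 / (2 * Fr.R) := by
      have h2 : ‖Fr.ell (k *ᵥ v - v)‖ ≤ ‖Fr.S v‖ * Fr.rho k := Fr.norm_ell_le _
      have h3 : ‖Fr.ell (k *ᵥ v - v)‖ ^ 2 ≤ (‖Fr.S v‖ * Fr.rho k) ^ 2 := by gcongr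
      rw [← Complex.normSq_eq_norm_sq, Complex.normSq_apply] at h3 ⊢
      rw [hre, him]
      rw [Fr.ell_re k.2] at h3
      set y := (Fr.ell (k *ᵥ v - v)).im
      set s := Fr.rho k ^ 2 with hs
      have hs0 : 0 ≤ s := sq_nonneg _
      rw [mul_pow, ← hs] at h3
      have h4 : y * y + s ^ 2 / 4 ≤ (Fr.R - 1) / 2 * s := by
        unfold Frame.R; nlinarith
      have e : (1 - s / (2 * Fr.R)) * (1 - s / (2 * Fr.R)) + y / Fr.R * (y / Fr.R) =
        1 - s / Fr.R + (y * y + s ^ 2 / 4) / Fr.R ^ 2 := by field_simp; ring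
      rw [e]
      have h5 : (y * y + s ^ 2 / 4) / Fr.R ^ 2 ≤ s / (2 * Fr.R) := by
        rw [div_le_div_iff₀ (by positivity) (by positivity)]
        nlinarith [mul_nonneg hs0 hR.le, mul_le_mul_of_nonneg_right h4 hR.le]
      have e2 : s / Fr.R = s / (2 * Fr.R) + s / (2 * Fr.R) := by field_simp; ring
      linarith
    have h2 : ‖Fr.wt k‖ ^ 2 ≤ Real.exp (-(1 / (4 * Fr.R) * Fr.rho k ^ 2)) ^ 2 := by
      refine h1.trans ?_
      rw [← Real.exp_nat_mul]
      have := Real.add_one_le_exp (-(Fr.rho k ^ 2 / (2 * Fr.R)))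
      calc _ ≤ Real.exp (-(Fr.rho k ^ 2 / (2 * Fr.R))) := by linarith
        _ = _ := by congr 1; push_cast; field_simp; ring
    exact (pow_le_pow_iff_left₀ (norm_nonneg _) (Real.exp_pos _).le two_ne_zero).1 h2
  · intro k
    rw [hre]
    have h1 := Fr.rho_le k.2
    have h2 := Fr.rho_nonneg k
    have : Fr.rho k ^ 2 / (2 * Fr.R) ≤ 1 := by
      rw [div_le_one (by positivity)]; unfold Frame.R; nlinarith
    linarith
  · intro k
    rw [hre]
    have : Fr.rho k ^ 2 / (2 * Fr.R) ≤ Fr.rho k ^ 2 / 2 :=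
      div_le_div_of_nonneg_left (sq_nonneg _) two_pos (by linarith)
    linarith
  · obtain ⟨C, hC, h⟩ := Fr.estimates hG 0 (by simp)
    refine ⟨C / Fr.R, by positivity, fun k => ?_⟩
    rw [him, abs_div, abs_of_pos hR, div_mul_eq_mul_div]
    gcongr
    exact (h k k.2).2.2
  · intro r hr
    rw [Measure.real, ENNReal.toReal_pos_iff]
    refine ⟨?_, measure_lt_top _ _⟩
    have hopen : IsOpen {k : Fr.K | Fr.rho k < r} := isOpen_lt hρ continuous_const
    refine lt_of_lt_of_le (hopen.measure_pos μ ⟨⟨1, Fr.grp.1⟩, ?_⟩)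
      (measure_mono fun k (hk : Fr.rho k < r) => hk.le)
    have : Fr.rho 1 = 0 := Fr.rho_eq_zero.2 (one_mulVec v)
    rw [Set.mem_ofPred_eq]; simpa [this] using hr
  · obtain ⟨t, htn, ht⟩ := exists_finite_cover n
    refine ⟨t.card, by exact_mod_cast htn.card_pos, fun r hr => ?_⟩
    let A : EuclideanSpace ℂ (Fin n) → Set Fr.K := fun c =>
      {k | ‖Fr.S ((k : Matrix (Fin n) (Fin n) ℂ) *ᵥ v - v) - (r : ℂ) • c‖ < r / 2}
    have hA : ∀ c, μ.real (A c) ≤ μ.real {k : Fr.K | Fr.rho k ≤ r} := by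
      intro c
      by_cases hne : (A c).Nonempty
      · obtain ⟨k₀, hk₀⟩ := hne
        have h1 := hμ.left_set _ (Fr.grp.2.2 k₀ k₀.2).2 {k | Fr.rho k ≤ r}
        have h2 : μ.real {k : Fr.K | Fr.rho k ≤ r} =
            μ.real {k : Fr.K | (k₀ : Matrix (Fin n) (Fin n) ℂ)⁻¹ * k ∈ {k | Fr.rho k ≤ r}} := by
          rw [Measure.real, Measure.real, h1]; rfl
        rw [h2]
        refine measureReal_mono fun k hk => ?_
        change Fr.rho _ ≤ r
        rw [Fr.rho_inv_mul k₀.2]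
        have h3 : ‖Fr.S ((k : Matrix (Fin n) (Fin n) ℂ) *ᵥ v - v) - (r : ℂ) • c‖ < r / 2 := hk
        have h4 : ‖Fr.S ((k₀ : Matrix (Fin n) (Fin n) ℂ) *ᵥ v - v) - (r : ℂ) • c‖ < r / 2 := hk₀
        have h5 := norm_sub_le (Fr.S ((k : Matrix (Fin n) (Fin n) ℂ) *ᵥ v - v) - (r : ℂ) • c)
          (Fr.S ((k₀ : Matrix (Fin n) (Fin n) ℂ) *ᵥ v - v) - (r : ℂ) • c)
        rw [sub_sub_sub_cancel_right] at h5
        linarith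
      · rw [Set.not_nonempty_iff_eq_empty.1 hne, measureReal_empty]
        exact measureReal_nonneg
    calc μ.real {k : Fr.K | Fr.rho k ≤ 2 * r} ≤ μ.real (⋃ c ∈ t, A c) := by
          refine measureReal_mono (fun k hk => ?_) (measure_ne_top _ _)
          obtain ⟨c, hc, hxc⟩ := ht r hr _ hk
          exact Set.mem_biUnion hc hxc
      _ ≤ ∑ c ∈ t, μ.real (A c) := measureReal_biUnion_finset_le _ _
      _ ≤ ∑ c ∈ t, μ.real {k : Fr.K | Fr.rho k ≤ r} := Finset.sum_le_sum fun c _ => hA c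
      _ = _ := by rw [Finset.sum_const, nsmul_eq_mul]

/-- Continuous functions on the compact group that are constant on the stabilizer. -/
theorem Frame.tendsto_const (hG : IsReductiveGroup ℂ n G) (Fr : Frame G v) {μ : Measure Fr.K}
    (hμ : Fr.IsMean μ) {f : Fr.K → ℂ} (hf : Continuous f) {c : ℂ}
    (hc : ∀ k : Fr.K, Fr.rho k = 0 → f k = c) :
    Tendsto (fun m => (lapZ μ (fun k => Fr.wt k) m)⁻¹ * ∫ k, f k * Fr.wt k ^ m ∂μ) atTop (𝓝 c) := by
  have := hμ.prob
  have L := Fr.laplace hG hμ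
  have hρ : Continuous fun k : Fr.K => Fr.rho k := Fr.continuous_rho.comp continuous_subtype_val
  have hw : Continuous fun k : Fr.K => Fr.wt k := Fr.continuous_wt.comp continuous_subtype_val
  have : CompactSpace Fr.K := isCompact_iff_compactSpace.1 Fr.cpt
  have : Nonempty Fr.K := ⟨⟨1, Fr.grp.1⟩⟩
  obtain ⟨a, ha, hdec⟩ := L.decay
  obtain ⟨B, hB⟩ : ∃ B, ∀ k, ‖f k - c‖ ≤ B := by
    obtain ⟨B, hB⟩ := isCompact_univ.exists_bound_of_continuousOn (hf.sub continuous_const).continuousOn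
    exact ⟨B, fun k => hB k trivial⟩
  let ε : ℕ → ℝ := fun m => ⨆ k : Fr.K, ‖f k - c‖ * Real.exp (-(Real.sqrt m * Fr.rho k))
  have hle : ∀ (m : ℕ) (k : Fr.K), Real.exp (-(Real.sqrt m * Fr.rho k)) ≤ 1 := fun m k => by
    rw [Real.exp_le_one_iff]
    have := Fr.rho_nonneg k
    have : 0 ≤ Real.sqrt m * Fr.rho k := by positivity
    linarith
  have hbdd : ∀ m : ℕ, BddAbove (Set.range fun k : Fr.K =>
      ‖f k - c‖ * Real.exp (-(Real.sqrt m * Fr.rho k))) := by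
    intro m
    refine ⟨B * 1, ?_⟩
    rintro _ ⟨k, rfl⟩
    exact mul_le_mul (hB k) (hle m k) (Real.exp_pos _).le ((norm_nonneg _).trans (hB k))
  have hε0 : ∀ m, 0 ≤ ε m := fun m => Real.iSup_nonneg fun k => by positivity
  have hε : Tendsto ε atTop (𝓝 0) := by
    rw [Metric.tendsto_atTop']
    intro δ hδ
    obtain ⟨C, hC0, hC⟩ : ∃ C : ℝ, 0 < C ∧ ∀ k, ‖f k - c‖ ≤ δ / 4 + C * Fr.rho k := by
      have hcl : IsCompact {k : Fr.K | δ / 4 ≤ ‖f k - c‖} :=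
        (isClosed_le continuous_const (by fun_prop)).isCompact
      rcases Set.eq_empty_or_nonempty {k : Fr.K | δ / 4 ≤ ‖f k - c‖} with he | hne
      · refine ⟨1, one_pos, fun k => ?_⟩
        have hk : k ∉ {k : Fr.K | δ / 4 ≤ ‖f k - c‖} := by rw [he]; exact id
        rw [Set.mem_ofPred_eq, not_le] at hk
        have := Fr.rho_nonneg k
        linarith
      · obtain ⟨k₀, hk₀, hmin⟩ := hcl.exists_isMinOn hne hρ.continuousOn
        rw [Set.mem_ofPred_eq] at hk₀
        have h0 : 0 < Fr.rho k₀ := by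
          refine lt_of_le_of_ne (Fr.rho_nonneg k₀) fun h => ?_
          rw [hc k₀ h.symm, sub_self, norm_zero] at hk₀
          linarith
        have hB0 : 0 ≤ B := (norm_nonneg _).trans (hB k₀)
        refine ⟨(B + 1) / Fr.rho k₀, by positivity, fun k => ?_⟩
        by_cases hk : δ / 4 ≤ ‖f k - c‖
        · have h1 : Fr.rho k₀ ≤ Fr.rho k := hmin hk
          have h2 : B + 1 ≤ (B + 1) / Fr.rho k₀ * Fr.rho k := by
            rw [div_mul_eq_mul_div, le_div_iff₀ h0]; gcongr
          have := hB k
          linarith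
        · have := Fr.rho_nonneg k
          have : 0 ≤ (B + 1) / Fr.rho k₀ * Fr.rho k := by positivity
          linarith
    have hlim : Tendsto (fun m : ℕ => C / Real.sqrt m) atTop (𝓝 0) :=
      (Real.tendsto_sqrt_atTop.comp tendsto_natCast_atTop_atTop).const_div_atTop _
    have hev := (hlim.eventually_lt_const (show (0 : ℝ) < δ / 4 by positivity)).and
      (eventually_gt_atTop 0)
    obtain ⟨N, hN⟩ := eventually_atTop.1 hev
    refine ⟨N, fun m hm => ?_⟩
    obtain ⟨h1, h2⟩ := hN m hm.le
    have h2' : (0 : ℝ) < m := by exact_mod_cast h2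
    have hq : 0 < Real.sqrt m := Real.sqrt_pos.2 h2'
    rw [Real.dist_eq, sub_zero, abs_of_nonneg (hε0 m)]
    have : ε m ≤ δ / 2 := by
      refine ciSup_le fun k => ?_
      set x := Real.sqrt m * Fr.rho k with hx
      have hx0 : 0 ≤ x := mul_nonneg hq.le (Fr.rho_nonneg k)
      have h3 : x * Real.exp (-x) ≤ 1 := by
        have := Real.add_one_le_exp x
        rw [Real.exp_neg, ← div_eq_mul_inv, div_le_one (Real.exp_pos _)]
        linarith
      have h4 : C * Fr.rho k = C / Real.sqrt m * x := by rw [hx]; field_simp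
      calc _ ≤ (δ / 4 + C / Real.sqrt m * x) * Real.exp (-x) := by rw [← h4]; gcongr; exact hC k
        _ = δ / 4 * Real.exp (-x) + C / Real.sqrt m * (x * Real.exp (-x)) := by ring
        _ ≤ δ / 4 * 1 + δ / 4 * 1 := by
          gcongr
          exact hle m k
        _ = _ := by ring
    linarith
  have h1 := L.tendsto_zero (f := fun m k => (f k - c) * Fr.wt k ^ m) hε (A := 1) ha
    (Eventually.of_forall fun m k => by
      have h2 : ‖f k - c‖ ≤ ε m * Real.exp (Real.sqrt m * Fr.rho k) := by
        have := le_ciSup (hbdd m) k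
        change ‖f k - c‖ * Real.exp (-(Real.sqrt m * Fr.rho k)) ≤ ε m at this
        calc ‖f k - c‖ = ‖f k - c‖ * Real.exp (-(Real.sqrt m * Fr.rho k)) *
              Real.exp (Real.sqrt m * Fr.rho k) := by
              rw [mul_assoc, ← Real.exp_add]; simp
          _ ≤ _ := by gcongr
      have e : Real.exp (1 * (Real.sqrt m * Fr.rho k) - a * (Real.sqrt m * Fr.rho k) ^ 2) =
          Real.exp (Real.sqrt m * Fr.rho k) * Real.exp (-(a * (Real.sqrt m * Fr.rho k) ^ 2)) := by
        rw [← Real.exp_add, one_mul]; congr 1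
      rw [norm_mul, e, ← mul_assoc]
      exact mul_le_mul h2 (L.norm_pow_le hdec m k) (norm_nonneg _)
        (mul_nonneg (hε0 m) (Real.exp_pos _).le))
  have h2 := h1.add_const c
  rw [zero_add] at h2
  refine h2.congr' ?_
  filter_upwards [L.lapZ_ne_zero] with m hm
  have hi : ∀ g : Fr.K → ℂ, Continuous g → Integrable g μ := fun g hg =>
    continuous_integrable_of_compact Fr.cpt μ hg
  have e : ∫ k, f k * Fr.wt k ^ m ∂μ =
      (∫ k, (f k - c) * Fr.wt k ^ m ∂μ) + c * lapZ μ (fun k => Fr.wt k) m := by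
    rw [lapZ, ← integral_const_mul, ← integral_add (hi _ (by fun_prop)) (hi _ (by fun_prop))]
    congr 1; ext x; ring
  rw [e]; field_simp

end FrameLaplace

section Average
open MeasureTheory Filter Topology Matrix

variable {n : ℕ}

/-- The right action of matrices on polynomials by precomposition. -/
abbrev act (g : Matrix (Fin n) (Fin n) ℂ) : MvPolynomial (Fin n) ℂ →ₐ[ℂ] MvPolynomial (Fin n) ℂ :=
  affSub g 0

/-- Translation of polynomials. -/
abbrev shift (v : Fin n → ℂ) : MvPolynomial (Fin n) ℂ →ₐ[ℂ] MvPolynomial (Fin n) ℂ :=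
  affSub 1 v

theorem eval_act (g : Matrix (Fin n) (Fin n) ℂ) (x : Fin n → ℂ) (P : MvPolynomial (Fin n) ℂ) :
    eval x (act g P) = eval (g *ᵥ x) P := by simp [act]

theorem eval_shift (v x : Fin n → ℂ) (P : MvPolynomial (Fin n) ℂ) :
    eval x (shift v P) = eval (v + x) P := by simp [shift, add_comm]

theorem act_act (g h : Matrix (Fin n) (Fin n) ℂ) (P : MvPolynomial (Fin n) ℂ) :
    act g (act h P) = act (h * g) P :=
  poly_ext fun x => by simp only [eval_act, mulVec_mulVec]

theorem act_one (P : MvPolynomial (Fin n) ℂ) : act 1 P = P :=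
  poly_ext fun x => by simp only [eval_act, one_mulVec]

theorem act_shift {h : Matrix (Fin n) (Fin n) ℂ} {v : Fin n → ℂ} (hv : h *ᵥ v = v)
    (P : MvPolynomial (Fin n) ℂ) : act h (shift v P) = shift v (act h P) :=
  poly_ext fun x => by simp only [eval_act, eval_shift, mulVec_add, hv]

theorem act_act_inv {K : Set (Matrix (Fin n) (Fin n) ℂ)} (hK : IsMatSubgroup ℂ n K)
    {k : Matrix (Fin n) (Fin n) ℂ} (hk : k ∈ K) (P : MvPolynomial (Fin n) ℂ) :
    act k (act k⁻¹ P) = P := by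
  rw [act_act, IsMatSubgroup.inv_mul hK hk, act_one]

theorem invariant_iff_act {G : Set (Matrix (Fin n) (Fin n) ℂ)} {p : MvPolynomial (Fin n) ℂ} :
    Invariant ℂ n G p ↔ ∀ g ∈ G, act g p = p := by
  refine forall₂_congr fun g _ => ⟨fun h => poly_ext fun x => ?_, fun h x => ?_⟩
  · rw [eval_act, h x]
  · rw [← eval_act, h]

theorem nice_affSub_apply {X : Type*} {𝒜 : Subalgebra ℂ (X → ℂ)}
    {A : X → Matrix (Fin n) (Fin n) ℂ} {b : X → Fin n → ℂ}
    (hA : ∀ i j, (fun x => A x i j) ∈ 𝒜) (hb : ∀ i, (fun x => b x i) ∈ 𝒜)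
    {f : X → MvPolynomial (Fin n) ℂ} (hf : f ∈ niceMaps 𝒜 (MvPolynomial (Fin n) ℂ)) :
    (fun x => affSub (A x) (b x) (f x)) ∈ niceMaps 𝒜 (MvPolynomial (Fin n) ℂ) := by
  induction hf using Submodule.span_induction with
  | mem f h =>
    obtain ⟨c, hc, e, rfl⟩ := h
    simp only [map_smul]
    exact nice_smul hc (nice_affSub hA hb e)
  | zero => simpa using nice_const (𝒜 := 𝒜) (0 : MvPolynomial (Fin n) ℂ)
  | add f g _ _ h1 h2 => simp only [Pi.add_apply, map_add]; exact add_mem h1 h2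
  | smul a f _ h => simp only [Pi.smul_apply, map_smul]; exact Submodule.smul_mem _ a h

theorem nice_act_inv {K : Set (Matrix (Fin n) (Fin n) ℂ)} (hK : IsMatSubgroup ℂ n K)
    (P : MvPolynomial (Fin n) ℂ) :
    (fun k : K => act (k : Matrix (Fin n) (Fin n) ℂ)⁻¹ P) ∈ niceMaps (contAlg K) _ :=
  nice_affSub (A := fun k : K => (k : Matrix (Fin n) (Fin n) ℂ)⁻¹) (b := fun _ => 0)
    (fun i j => (IsMatSubgroup.continuous_inv hK).matrix_elem i j) (fun _ => continuous_const) P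

theorem nice_conj {K : Set (Matrix (Fin n) (Fin n) ℂ)} (hK : IsMatSubgroup ℂ n K)
    (T : MvPolynomial (Fin n) ℂ →ₗ[ℂ] MvPolynomial (Fin n) ℂ) (P : MvPolynomial (Fin n) ℂ) :
    (fun k : K => act (k : Matrix (Fin n) (Fin n) ℂ) (T (act (k : Matrix (Fin n) (Fin n) ℂ)⁻¹ P))) ∈
      niceMaps (contAlg K) _ :=
  nice_affSub_apply (A := fun k : K => (k : Matrix (Fin n) (Fin n) ℂ)) (b := fun _ => 0)
    (fun i j => continuous_subtype_val.matrix_elem i j) (fun _ => continuous_const)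
    (nice_map T (nice_act_inv hK P))

theorem exists_average {K : Set (Matrix (Fin n) (Fin n) ℂ)} (hc : IsCompact K)
    (hK : IsMatSubgroup ℂ n K) {μ : Measure K} (hμ : IsProbabilityMeasure μ)
    (hr : ∀ k₀ ∈ K, ∀ f : Matrix (Fin n) (Fin n) ℂ → ℂ,
      ∫ k : K, f (k * k₀) ∂μ = ∫ k : K, f k ∂μ)
    (T : MvPolynomial (Fin n) ℂ →ₗ[ℂ] MvPolynomial (Fin n) ℂ) :
    ∃ Θ : MvPolynomial (Fin n) ℂ →ₗ[ℂ] MvPolynomial (Fin n) ℂ,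
      (∀ k ∈ K, ∀ P, Θ (act k P) = act k (Θ P)) ∧
      (∀ P (l : MvPolynomial (Fin n) ℂ →ₗ[ℂ] ℂ), l (Θ P) =
        ∫ k : K, l (act (k : Matrix (Fin n) (Fin n) ℂ) (T (act (k : Matrix (Fin n) (Fin n) ℂ)⁻¹ P))) ∂μ) ∧
      (∀ P, ∀ W : Submodule ℂ (MvPolynomial (Fin n) ℂ),
        (∀ k ∈ K, act k (T (act k⁻¹ P)) ∈ W) → Θ P ∈ W) := by
  have hInt : ∀ c ∈ contAlg K, Integrable c μ := fun c hc' => continuous_integrable_of_compact hc μ hc'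
  choose θ hθ hθW using fun P => nice_integral μ hInt (nice_conj hK T P)
  have hsep : ∀ a b : MvPolynomial (Fin n) ℂ,
      (∀ l : MvPolynomial (Fin n) ℂ →ₗ[ℂ] ℂ, l a = l b) → a = b := fun a b h =>
    poly_ext fun x => by simpa [aeval_eq_eval] using h (aeval x).toLinearMap
  obtain ⟨Θ, hΘ⟩ : ∃ Θ : MvPolynomial (Fin n) ℂ →ₗ[ℂ] MvPolynomial (Fin n) ℂ, ∀ P, Θ P = θ P := by
    refine ⟨IsLinearMap.mk' θ ⟨fun a b => hsep _ _ fun l => ?_, fun c a => hsep _ _ fun l => ?_⟩,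
      fun _ => rfl⟩
    · rw [map_add, hθ, hθ, hθ, ← integral_add (hInt _ (nice_mem (nice_map l (nice_conj hK T a))))
        (hInt _ (nice_mem (nice_map l (nice_conj hK T b))))]
      simp only [map_add]
    · rw [map_smul, hθ, hθ, smul_eq_mul, ← integral_const_mul]
      simp only [map_smul, smul_eq_mul]
  have h1 : ∀ (y : Fin n → ℂ) (Q : MvPolynomial (Fin n) ℂ), eval y (Θ Q) =
      ∫ k : K, eval ((k : Matrix (Fin n) (Fin n) ℂ) *ᵥ y) (T (act (k : Matrix (Fin n) (Fin n) ℂ)⁻¹ Q)) ∂μ := by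
    intro y Q
    have := hθ Q (aeval y).toLinearMap
    simp only [AlgHom.toLinearMap_apply, aeval_eq_eval, eval_act] at this
    rw [hΘ, this]
  refine ⟨Θ, fun k₀ hk₀ P => poly_ext fun x => ?_, fun P l => by rw [hΘ, hθ],
    fun P W hW => by rw [hΘ]; exact hθW P W fun k => hW k k.2⟩
  rw [eval_act, h1, h1]
  have e := hr k₀ hk₀ (fun k => eval (k *ᵥ x) (T (act k⁻¹ (act k₀ P))))
  refine e.symm.trans (integral_congr_ae (ae_of_all _ fun k => ?_))
  beta_reduce
  rw [mulVec_mulVec, act_act, Matrix.mul_inv_rev, ← mul_assoc,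
    IsMatSubgroup.mul_inv hK hk₀, one_mul]

theorem nice_poly {f : (Fin n × Fin n → ℂ) → ℂ} (hf : f ∈ polyAlg (Fin n × Fin n)) :
    ∃ q : MvPolynomial (Fin n × Fin n) ℂ, ∀ g, f g = eval g q := by
  obtain ⟨q, rfl⟩ := hf
  exact ⟨q, fun _ => rfl⟩

theorem nice_act_poly (P : MvPolynomial (Fin n) ℂ) :
    (fun g : Fin n × Fin n → ℂ => act (Matrix.of fun i j => g (i, j)) P) ∈
      niceMaps (polyAlg (Fin n × Fin n)) _ :=
  nice_affSub (A := fun g : Fin n × Fin n → ℂ => Matrix.of fun i j => g (i, j)) (b := fun _ => 0)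
    (fun i j => show _ ∈ polyAlg _ from ⟨X (i, j), by ext; simp⟩)
    (fun _ => show _ ∈ polyAlg _ from ⟨0, by ext; simp⟩) P

theorem equivariant_of_dense {G K : Set (Matrix (Fin n) (Fin n) ℂ)}
    (hd : ∀ p : MvPolynomial (Fin n × Fin n) ℂ,
      (∀ k ∈ K, eval (fun ij => k ij.1 ij.2) p = 0) → ∀ g ∈ G, eval (fun ij => g ij.1 ij.2) p = 0)
    {Θ : MvPolynomial (Fin n) ℂ →ₗ[ℂ] MvPolynomial (Fin n) ℂ}
    (h : ∀ k ∈ K, ∀ P, Θ (act k P) = act k (Θ P)) : ∀ g ∈ G, ∀ P, Θ (act g P) = act g (Θ P) := by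
  intro g hg P
  refine poly_ext fun x => ?_
  have h1 := nice_map ((aeval x).toLinearMap ∘ₗ Θ) (nice_act_poly P)
  have h2 := nice_map (aeval x).toLinearMap (nice_act_poly (Θ P))
  obtain ⟨q, hq⟩ := nice_poly (nice_mem (sub_mem h1 h2))
  have h3 := hd q (fun k hk => by
    rw [← hq]
    simp only [Pi.sub_apply, LinearMap.comp_apply, AlgHom.toLinearMap_apply]
    exact sub_eq_zero.2 (by rw [show (Matrix.of fun i j => k i j) = k from rfl, h k hk])) g hg
  rw [← hq] at h3
  simp only [Pi.sub_apply, LinearMap.comp_apply, AlgHom.toLinearMap_apply, aeval_eq_eval] at h3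
  exact sub_eq_zero.1 h3

/-- Limits of functions in a space of functions, when everything takes place in finite dimension. -/
theorem mem_of_tendsto_of_finiteDimensional {I : Type*} (W E : Submodule ℂ (I → ℂ))
    [FiniteDimensional ℂ E] {u : ℕ → I → ℂ} {f : I → ℂ} (hW : ∀ m, u m ∈ W) (hE : ∀ m, u m ∈ E)
    (h : ∀ i, Tendsto (fun m => u m i) atTop (𝓝 (f i))) : f ∈ W := by
  have : FiniteDimensional ℂ (W ⊓ E : Submodule ℂ (I → ℂ)) :=
    Submodule.finiteDimensional_of_le inf_le_right
  have hcl : IsClosed ((W ⊓ E : Submodule ℂ (I → ℂ)) : Set (I → ℂ)) :=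
    Submodule.closed_of_finiteDimensional _
  exact (hcl.mem_of_tendsto (tendsto_pi_nhds.2 h) (Eventually.of_forall fun m => ⟨hW m, hE m⟩)).1

theorem jet_congr {P Q : MvPolynomial (Fin n) ℂ} {x y : Fin n → ℂ}
    (h : ∀ z : ℂ, eval (z • x) P = eval (z • y) Q) (j : ℕ) : jet j x P = jet j y Q := by
  rw [← coeff_lineMap, ← coeff_lineMap]
  congr 1
  exact Polynomial.funext fun z => by simpa using h z

theorem norm_jet_le (P : MvPolynomial (Fin n) ℂ) (j : ℕ) :
    ∃ C : ℝ, 0 ≤ C ∧ ∀ x, ‖jet j x P‖ ≤ C * ‖x‖ ^ j := by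
  set Q := homogeneousComponent j P with hQ
  refine ⟨∑ α ∈ Q.support, ‖Q.coeff α‖, Finset.sum_nonneg fun _ _ => norm_nonneg _, fun x => ?_⟩
  rw [jet_apply, ← hQ, eval_eq, Finset.sum_mul]
  refine (norm_sum_le _ _).trans (Finset.sum_le_sum fun α hα => ?_)
  rw [norm_mul]
  gcongr
  have h1 := homogeneousComponent_isHomogeneous j P (mem_support_iff.1 hα)
  have h2 : ∑ i, α i = j := by
    rw [← h1, Finsupp.weight_apply, Finsupp.sum_fintype _ _ (by simp)]; simp
  rw [norm_prod, ← h2, ← Finset.prod_pow_eq_pow_sum]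
  have h3 : ∏ i ∈ α.support, ‖x i ^ α i‖ = ∏ i, ‖x i‖ ^ α i := by
    simp only [norm_pow]
    exact Finset.prod_subset (Finset.subset_univ _) fun i _ hi => by
      rw [Finsupp.notMem_support_iff.1 hi, pow_zero]
  rw [h3]
  exact Finset.prod_le_prod (fun _ _ => by positivity) fun i _ => by
    gcongr; exact norm_le_pi_norm x i

theorem norm_eval_le_of_jet (P : MvPolynomial (Fin n) ℂ) (k : ℕ) :
    ∃ C : ℝ, 0 ≤ C ∧ ∀ x, ‖x‖ ≤ 1 → (∀ j < k, jet j x P = 0) → ‖eval x P‖ ≤ C * ‖x‖ ^ k := by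
  choose C hC0 hC using norm_jet_le P
  refine ⟨∑ j ∈ Finset.range (P.totalDegree + 1), C j, Finset.sum_nonneg fun _ _ => hC0 _,
    fun x hx h => ?_⟩
  rw [eval_eq_sum_jet x le_rfl, Finset.sum_mul]
  refine (norm_sum_le _ _).trans (Finset.sum_le_sum fun j _ => ?_)
  rcases lt_or_ge j k with hj | hj
  · rw [h j hj, norm_zero]; have := hC0 j; positivity
  · exact (hC j x).trans (mul_le_mul_of_nonneg_left (pow_le_pow_of_le_one (norm_nonneg _) hx hj) (hC0 j))

/-- The polynomial of a linear form. -/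
def linPoly (l : (Fin n → ℂ) →ₗ[ℂ] ℂ) : MvPolynomial (Fin n) ℂ :=
  ∑ i, C (l (Pi.single i 1)) * X i

@[simp] theorem eval_linPoly (l : (Fin n → ℂ) →ₗ[ℂ] ℂ) (x : Fin n → ℂ) :
    eval x (linPoly l) = l x := by
  conv_rhs => rw [← Finset.univ_sum_single x, map_sum]
  rw [linPoly, map_sum]
  simp only [map_mul, eval_C, eval_X]
  refine Finset.sum_congr rfl fun i _ => ?_
  have : (Pi.single i (x i) : Fin n → ℂ) = x i • Pi.single i 1 := by
    rw [← Pi.single_smul, smul_eq_mul, mul_one]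
  rw [this, map_smul, smul_eq_mul, mul_comm]

theorem jet_one_linPoly (l : (Fin n → ℂ) →ₗ[ℂ] ℂ) (x : Fin n → ℂ) : jet 1 x (linPoly l) = l x := by
  rw [← coeff_lineMap]
  have : lineMap x (linPoly l) = Polynomial.C (l x) * Polynomial.X :=
    Polynomial.funext fun z => by
      rw [eval_lineMap, eval_linPoly, map_smul, Polynomial.eval_C_mul, Polynomial.eval_X, smul_eq_mul, mul_comm]
  rw [this]; simp

/-- The evaluation of polynomials on a subset, as a linear map. -/
def evalOn {I : Type*} (e : I → Fin n → ℂ) : MvPolynomial (Fin n) ℂ →ₗ[ℂ] (I → ℂ) :=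
  LinearMap.pi fun i => (aeval (e i)).toLinearMap

@[simp] theorem evalOn_apply {I : Type*} (e : I → Fin n → ℂ) (P : MvPolynomial (Fin n) ℂ) (i : I) :
    evalOn e P i = eval (e i) P := by simp [evalOn, aeval_eq_eval]

end Average

section Linear
open MeasureTheory Filter Topology Matrix

variable {n : ℕ} {G : Set (Matrix (Fin n) (Fin n) ℂ)} {v : Fin n → ℂ}

theorem coeff_one_pow_succ (q : Polynomial ℂ) (m : ℕ) :
    (q ^ (m + 1)).coeff 1 = (m + 1) * q.coeff 0 ^ m * q.coeff 1 := by
  have h := Polynomial.coeff_derivative (q ^ (m + 1)) 0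
  have h2 := Polynomial.coeff_derivative q 0
  simp only [Nat.cast_zero, zero_add, mul_one] at h h2
  rw [← h, ← h2, Polynomial.derivative_pow]
  simp only [Polynomial.coeff_zero_eq_eval_zero, Polynomial.eval_mul, Polynomial.eval_pow,
    Polynomial.eval_C, Nat.add_sub_cancel]
  push_cast
  ring

theorem Frame.average (Fr : Frame G v) {μ : Measure Fr.K} (hμ : Fr.IsMean μ)
    (T : MvPolynomial (Fin n) ℂ →ₗ[ℂ] MvPolynomial (Fin n) ℂ) :
    ∃ Θ : MvPolynomial (Fin n) ℂ →ₗ[ℂ] MvPolynomial (Fin n) ℂ,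
      (∀ g ∈ G, ∀ P, Θ (act g P) = act g (Θ P)) ∧
      (∀ P (l : MvPolynomial (Fin n) ℂ →ₗ[ℂ] ℂ), l (Θ P) =
        ∫ k : Fr.K, l (act (k : Matrix (Fin n) (Fin n) ℂ)
          (T (act (k : Matrix (Fin n) (Fin n) ℂ)⁻¹ P))) ∂μ) := by
  obtain ⟨Θ, h1, h2, -⟩ := exists_average Fr.cpt Fr.grp hμ.prob hμ.right T
  exact ⟨Θ, equivariant_of_dense Fr.dense h1, h2⟩

theorem Frame.ell_mulVec_of_rho (Fr : Frame G v) {k : Matrix (Fin n) (Fin n) ℂ} (hk : k ∈ Fr.K)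
    (x : Fin n → ℂ) : ‖Fr.ell (k *ᵥ x) - Fr.ell x‖ ≤ Fr.rho k * ‖Fr.S x‖ := by
  have h : Fr.ell x = inner ℂ (Fr.S (k *ᵥ v)) (Fr.S (k *ᵥ x)) := by
    rw [Fr.inner_mulVec hk]; rfl
  rw [h, Fr.ell_apply, ← inner_sub_left, ← map_sub]
  refine (norm_inner_le_norm (𝕜 := ℂ) _ _).trans ?_
  rw [Fr.iso k hk, Frame.rho, ← norm_neg, ← map_neg, neg_sub]

/-- The weight as a polynomial. -/
def Frame.wtPoly (Fr : Frame G v) : MvPolynomial (Fin n) ℂ :=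
  1 + C (Fr.R : ℂ)⁻¹ * (linPoly Fr.ell - C (Fr.ell v))

theorem Frame.eval_wtPoly (Fr : Frame G v) (y : Fin n → ℂ) :
    eval y Fr.wtPoly = 1 + Fr.ell (y - v) / (Fr.R : ℂ) := by
  simp [Frame.wtPoly, div_eq_mul_inv, mul_comm]

/-- The linear parts at `v`. -/
def linPart (v : Fin n → ℂ) : MvPolynomial (Fin n) ℂ →ₗ[ℂ] ((Fin n → ℂ) → ℂ) :=
  LinearMap.pi fun x => jet 1 x ∘ₗ (shift v).toLinearMap

theorem linPart_apply (v x : Fin n → ℂ) (P : MvPolynomial (Fin n) ℂ) :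
    linPart v P x = jet 1 x (shift v P) := rfl

theorem jet_C (j : ℕ) (x : Fin n → ℂ) (a : ℂ) (hj : j ≠ 0) : jet j x (C a) = 0 := by
  rw [← coeff_lineMap, ← MvPolynomial.algebraMap_eq, AlgHom.commutes,
    Polynomial.algebraMap_eq, Polynomial.coeff_C_of_ne_zero hj]

theorem Frame.exists_invariant_linear (hG : IsReductiveGroup ℂ n G) (Fr : Frame G v) :
    ∃ p, Invariant ℂ n G p ∧ eval v p = 0 ∧ ∀ x, jet 1 x (shift v p) = Fr.ell x := by
  obtain ⟨μ, hμ⟩ := Fr.exists_isMean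
  have hR := Fr.R_pos
  have hR' : (Fr.R : ℂ) ≠ 0 := by exact_mod_cast hR.ne'
  have key : ∀ m : ℕ, ∃ p, Invariant ℂ n G p ∧ eval v p = 0 ∧ ∀ x, jet 1 x (shift v p) =
      (lapZ μ (fun k : Fr.K => Fr.wt k) m)⁻¹ * ∫ k : Fr.K, Fr.ell ((k : Matrix (Fin n) (Fin n) ℂ) *ᵥ x) * Fr.wt k ^ m ∂μ := by
    intro m
    obtain ⟨Θ, h1, h2⟩ := Fr.average hμ
      ((aeval (0 : Fin n → ℂ)).toLinearMap.smulRight (Fr.wtPoly ^ (m + 1)))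
    have hinv : Invariant ℂ n G (Θ 1) := invariant_iff_act.2 fun g hg => by
      rw [← h1 g hg, map_one]
    refine ⟨C ((Fr.R : ℂ) / (m + 1) * (lapZ μ (fun k : Fr.K => Fr.wt k) m)⁻¹) *
      (Θ 1 - C (eval v (Θ 1))), fun g hg x => by simp [hinv g hg x], by simp, fun x => ?_⟩
    have h3 := h2 1 (jet 1 x ∘ₗ (shift v).toLinearMap)
    have h4 : ∀ k : Fr.K, jet 1 x (shift v (act (k : Matrix (Fin n) (Fin n) ℂ) (Fr.wtPoly ^ (m + 1)))) =
        (m + 1) / Fr.R * (Fr.ell ((k : Matrix (Fin n) (Fin n) ℂ) *ᵥ x) * Fr.wt k ^ m) := by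
      intro k
      have h5 : lineMap x (shift v (act (k : Matrix (Fin n) (Fin n) ℂ) Fr.wtPoly)) =
          Polynomial.C (Fr.wt k) + Polynomial.C (Fr.ell ((k : Matrix (Fin n) (Fin n) ℂ) *ᵥ x) / Fr.R) * Polynomial.X := by
        refine Polynomial.funext fun z => ?_
        rw [eval_lineMap, eval_shift, eval_act, Fr.eval_wtPoly, Polynomial.eval_add,
          Polynomial.eval_C, Polynomial.eval_C_mul, Polynomial.eval_X, Frame.wt, mulVec_add,
          mulVec_smul, add_sub_right_comm, map_add, map_smul, smul_eq_mul]
        ring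
      rw [← coeff_lineMap, map_pow, map_pow, map_pow, h5, coeff_one_pow_succ]
      simp only [Polynomial.coeff_add, Polynomial.coeff_C_zero, Polynomial.coeff_C_mul,
        Polynomial.coeff_X_zero, Polynomial.coeff_X_one, Polynomial.coeff_C_succ, mul_zero, add_zero,
        zero_add, mul_one]
      ring
    have h6 : jet 1 x (shift v (Θ 1)) = (m + 1) / Fr.R *
        ∫ k : Fr.K, Fr.ell ((k : Matrix (Fin n) (Fin n) ℂ) *ᵥ x) * Fr.wt k ^ m ∂μ := by
      rw [← integral_const_mul]
      refine h3.trans (integral_congr_ae (ae_of_all _ fun k => ?_))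
      beta_reduce
      rw [← h4]
      simp
    have h7 : ∀ a, shift v (C a) = C a := fun a => AlgHom.commutes _ _
    rw [map_mul, map_sub, h7, h7, ← MvPolynomial.smul_eq_C_mul, map_smul, map_sub,
      jet_C 1 x _ one_ne_zero, sub_zero, h6, smul_eq_mul]
    have hm : (m + 1 : ℂ) ≠ 0 := by exact_mod_cast m.succ_ne_zero
    field_simp
  choose u hu1 hu2 hu3 using key
  let W : Submodule ℂ ((Fin n → ℂ) → ℂ) := Submodule.map (linPart v)
    (Subalgebra.toSubmodule (invariantSubalgebra ℂ n G) ⊓ LinearMap.ker (aeval v).toLinearMap)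
  let E : Submodule ℂ ((Fin n → ℂ) → ℂ) :=
    Submodule.map (evalOn id) (restrictTotalDegree (Fin n) ℂ 1)
  have hW : Fr.ell.toFun ∈ W := by
    refine mem_of_tendsto_of_finiteDimensional W E (u := fun m => linPart v (u m)) (fun m => ?_)
      (fun m => ?_) fun x => ?_
    · refine Submodule.mem_map_of_mem ⟨hu1 m, ?_⟩
      rw [SetLike.mem_coe, LinearMap.mem_ker]; simpa [aeval_eq_eval] using hu2 m
    · refine ⟨homogeneousComponent 1 (shift v (u m)), ?_, ?_⟩
      · rw [SetLike.mem_coe, mem_restrictTotalDegree]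
        exact (homogeneousComponent_isHomogeneous 1 _).totalDegree_le
      · ext x; rw [evalOn_apply, linPart_apply, jet_apply]; rfl
    · simp only [linPart_apply, hu3]
      have hcont := Fr.continuous_ell
      refine Fr.tendsto_const hG hμ (f := fun k => Fr.ell ((k : Matrix (Fin n) (Fin n) ℂ) *ᵥ x))
        (by fun_prop) fun k hk => ?_
      have := Fr.ell_mulVec_of_rho k.2 x
      rw [hk, zero_mul] at this
      exact sub_eq_zero.1 (norm_le_zero_iff.1 this)
  obtain ⟨p, ⟨hp1, hp2⟩, hp3⟩ := hW
  refine ⟨p, hp1, ?_, fun x => congrFun hp3 x⟩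
  rw [SetLike.mem_coe, LinearMap.mem_ker] at hp2
  simpa [aeval_eq_eval] using hp2

end Linear

section Perturb
open MeasureTheory Filter Topology Matrix

variable {n : ℕ}

theorem exists_norm_eval_add_sub_le (P : MvPolynomial (Fin n) ℂ) {Y : ℝ} (hY : 0 ≤ Y) :
    ∃ C : ℝ, 0 ≤ C ∧ ∃ D : ℕ, ∀ b y : Fin n → ℂ, ‖y‖ ≤ Y →
      ‖eval (b + y) P - eval y P‖ ≤ C * ‖b‖ * (1 + ‖b‖) ^ D := by
  induction P using MvPolynomial.induction_on with
  | C a => exact ⟨0, le_rfl, 0, fun b y _ => by simp⟩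
  | add p q hp hq =>
    obtain ⟨C₁, h1, D₁, hp⟩ := hp
    obtain ⟨C₂, h2, D₂, hq⟩ := hq
    refine ⟨C₁ + C₂, by positivity, D₁ + D₂, fun b y hy => ?_⟩
    rw [map_add, map_add, add_sub_add_comm]
    have hb : 1 ≤ 1 + ‖b‖ := by linarith [norm_nonneg b]
    refine (norm_add_le _ _).trans ((add_le_add (hp b y hy) (hq b y hy)).trans ?_)
    rw [add_mul, add_mul]
    gcongr <;> omega
  | mul_X p i hp =>
    obtain ⟨C₁, h1, D₁, hp⟩ := hp
    obtain ⟨M, hM⟩ := (isCompact_closedBall (0 : Fin n → ℂ) Y).exists_bound_of_continuousOn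
      (continuous_eval_poly p).continuousOn
    have hM0 : 0 ≤ M := (norm_nonneg _).trans (hM 0 (by simpa using hY))
    refine ⟨(1 + Y) * C₁ + M, by positivity, D₁ + 1, fun b y hy => ?_⟩
    have hb : 1 ≤ 1 + ‖b‖ := by linarith [norm_nonneg b]
    have e : eval (b + y) (p * X i) - eval y (p * X i) =
        (b + y) i * (eval (b + y) p - eval y p) + b i * eval y p := by
      simp only [map_mul, eval_X, Pi.add_apply]; ring
    rw [e]
    have h3 : ‖(b + y) i‖ ≤ (1 + Y) * (1 + ‖b‖) := by
      refine (norm_le_pi_norm _ i).trans ((norm_add_le _ _).trans ?_)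
      nlinarith [norm_nonneg b]
    calc _ ≤ ‖(b + y) i‖ * ‖eval (b + y) p - eval y p‖ + ‖b i‖ * ‖eval y p‖ := by
          refine (norm_add_le _ _).trans ?_
          rw [norm_mul, norm_mul]
      _ ≤ (1 + Y) * (1 + ‖b‖) * (C₁ * ‖b‖ * (1 + ‖b‖) ^ D₁) + ‖b‖ * (1 + ‖b‖) ^ (D₁ + 1) * M := by
          refine add_le_add (mul_le_mul h3 (hp b y hy) (norm_nonneg _) (by positivity)) ?_
          refine mul_le_mul ((norm_le_pi_norm _ i).trans ?_) (hM y (by simpa using hy))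
            (norm_nonneg _) (by positivity)
          exact le_mul_of_one_le_right (norm_nonneg _) (one_le_pow₀ hb)
      _ = _ := by ring

theorem nice_norm_eval_add_sub_le {X : Type*} [TopologicalSpace X] [CompactSpace X]
    {f : X → MvPolynomial (Fin n) ℂ} (hf : f ∈ niceMaps (contAlg X) (MvPolynomial (Fin n) ℂ))
    {Y : ℝ} (hY : 0 ≤ Y) :
    ∃ C : ℝ, 0 ≤ C ∧ ∃ D : ℕ, ∀ k, ∀ b y : Fin n → ℂ, ‖y‖ ≤ Y →
      ‖eval (b + y) (f k) - eval y (f k)‖ ≤ C * ‖b‖ * (1 + ‖b‖) ^ D := by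
  induction hf using Submodule.span_induction with
  | mem f h =>
    obtain ⟨c, hc, e, rfl⟩ := h
    obtain ⟨C, hC, D, h⟩ := exists_norm_eval_add_sub_le e hY
    obtain ⟨M, hM⟩ := isCompact_univ.exists_bound_of_continuousOn (Continuous.continuousOn (s := Set.univ) hc)
    refine ⟨|M| * C, by positivity, D, fun k b y hy => ?_⟩
    beta_reduce
    rw [smul_eval, smul_eval, ← mul_sub, norm_mul, mul_assoc, mul_assoc, ← mul_assoc C]
    exact mul_le_mul ((hM k trivial).trans (le_abs_self M)) (h b y hy) (norm_nonneg _) (abs_nonneg _)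
  | zero => exact ⟨0, le_rfl, 0, fun k b y _ => by simp⟩
  | add f g _ _ hp hq =>
    obtain ⟨C₁, h1, D₁, hp⟩ := hp
    obtain ⟨C₂, h2, D₂, hq⟩ := hq
    refine ⟨C₁ + C₂, by positivity, D₁ + D₂, fun k b y hy => ?_⟩
    rw [Pi.add_apply, map_add, map_add, add_sub_add_comm]
    have hb : 1 ≤ 1 + ‖b‖ := by linarith [norm_nonneg b]
    refine (norm_add_le _ _).trans ((add_le_add (hp k b y hy) (hq k b y hy)).trans ?_)
    rw [add_mul, add_mul]
    gcongr <;> omega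
  | smul a f _ h =>
    obtain ⟨C, hC, D, h⟩ := h
    refine ⟨‖a‖ * C, by positivity, D, fun k b y hy => ?_⟩
    rw [Pi.smul_apply, smul_eval, smul_eval, ← mul_sub, norm_mul, mul_assoc, mul_assoc, ← mul_assoc C]
    exact mul_le_mul_of_nonneg_left (h k b y hy) (norm_nonneg _)

theorem norm_jet_mul_pow_sub_le {A B F : MvPolynomial (Fin n) ℂ} {ξ b c : Fin n → ℂ} {d m D : ℕ}
    {Y C₁ C₂ C₃ a t q : ℝ} (hA : ∀ z : ℂ, eval (z • ξ) A = eval (b + z • c) F)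
    (hF : F.IsHomogeneous d)
    (hpert : ∀ b' y : Fin n → ℂ, ‖y‖ ≤ Y →
      ‖eval (b' + y) F - eval y F‖ ≤ C₁ * ‖b'‖ * (1 + ‖b'‖) ^ D)
    (hc : ‖c‖ ≤ Y) (hC₁ : 0 ≤ C₁) (hC₂ : 0 ≤ C₂) (ht : 0 < t) (ht1 : t ≤ 1) (hq : 0 ≤ q)
    (hb : ‖b‖ ≤ C₂ * (q * t) ^ 2)
    (hB : ∀ z : ℂ, ‖z‖ = 1 → ‖eval (((t : ℂ) * z) • ξ) B‖ ^ m ≤ Real.exp (C₃ * (q + 1) - a * q ^ 2))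
    {j : ℕ} (hj : j ≤ d) :
    ‖jet j ξ (A * B ^ m) - (if j = d then eval c F * eval 0 B ^ m else 0)‖ ≤
      C₁ * C₂ * (1 + C₂) ^ D * Real.exp C₃ * t *
        Real.exp ((C₃ + 2 + 2 * D) * q - a * q ^ 2) := by
  set p : Polynomial ℂ := lineMap ((t : ℂ) • ξ) (A * B ^ m) -
    Polynomial.C ((t : ℂ) ^ d * eval c F) * lineMap ((t : ℂ) • ξ) (B ^ m) * Polynomial.X ^ d with hp
  have hcoeff : p.coeff j = (t : ℂ) ^ j *
      (jet j ξ (A * B ^ m) - (if j = d then eval c F * eval 0 B ^ m else 0)) := by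
    rw [hp, Polynomial.coeff_sub, coeff_lineMap, jet_smul, Polynomial.coeff_mul_X_pow']
    rcases hj.eq_or_lt with rfl | h
    · rw [if_pos le_rfl, if_pos rfl, Nat.sub_self, Polynomial.coeff_C_mul, coeff_lineMap,
        jet_zero, map_pow]
      ring
    · rw [if_neg (by omega), if_neg (by omega), sub_zero, sub_zero]
  set M := t ^ d * (C₁ * C₂ * (1 + C₂) ^ D * Real.exp C₃ * t *
        Real.exp ((C₃ + 2 + 2 * D) * q - a * q ^ 2)) with hM
  have hbound : ∀ z : ℂ, ‖z‖ = 1 → ‖p.eval z‖ ≤ M := by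
    intro z hz
    have ht0 : (t : ℂ) ≠ 0 := by exact_mod_cast ht.ne'
    have h1 : p.eval z = (t : ℂ) ^ d * ((eval ((t : ℂ)⁻¹ • b + z • c) F - eval (z • c) F) *
        eval (((t : ℂ) * z) • ξ) B ^ m) := by
      have h2 : b + ((t : ℂ) * z) • c = (t : ℂ) • ((t : ℂ)⁻¹ • b + z • c) := by
        rw [smul_add, smul_smul, smul_smul, mul_inv_cancel₀ ht0, one_smul]
      simp only [hp, Polynomial.eval_sub, Polynomial.eval_mul, Polynomial.eval_C,
        Polynomial.eval_pow, Polynomial.eval_X, eval_lineMap, map_mul, map_pow]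
      rw [smul_smul, mul_comm z, hA, h2, eval_smul_of_isHomogeneous hF,
        eval_smul_of_isHomogeneous hF]
      ring
    rw [h1, norm_mul, norm_mul, norm_pow, norm_pow, Complex.norm_real, Real.norm_of_nonneg ht.le, hM]
    refine mul_le_mul_of_nonneg_left ?_ (by positivity)
    have h3 : ‖(t : ℂ)⁻¹ • b‖ ≤ C₂ * t * q ^ 2 := by
      rw [norm_smul, norm_inv, Complex.norm_real, Real.norm_of_nonneg ht.le,
        inv_mul_le_iff₀ ht]
      refine hb.trans (le_of_eq (by ring))
    have hq1 : q ≤ Real.exp q := by linarith [Real.add_one_le_exp q]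
    have hq2 : q ^ 2 ≤ Real.exp (2 * q) := by
      rw [two_mul, Real.exp_add]; nlinarith
    have hq3 : 1 + ‖(t : ℂ)⁻¹ • b‖ ≤ (1 + C₂) * Real.exp (2 * q) := by
      have : 1 ≤ Real.exp (2 * q) := Real.one_le_exp (by positivity)
      have h5 : C₂ * t * q ^ 2 ≤ C₂ * Real.exp (2 * q) := by
        have : C₂ * t ≤ C₂ := mul_le_of_le_one_right hC₂ ht1
        exact mul_le_mul this hq2 (by positivity) hC₂
      linarith
    calc _ ≤ (C₁ * (C₂ * t * Real.exp (2 * q)) * ((1 + C₂) * Real.exp (2 * q)) ^ D) *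
          Real.exp (C₃ * (q + 1) - a * q ^ 2) := by
          refine mul_le_mul ((hpert _ _ ?_).trans ?_) (hB z hz) (by positivity) (by positivity)
          · rw [norm_smul, hz, one_mul]; exact hc
          · have : ‖(t : ℂ)⁻¹ • b‖ ≤ C₂ * t * Real.exp (2 * q) :=
              h3.trans (mul_le_mul_of_nonneg_left hq2 (by positivity))
            gcongr
      _ = _ := by
          rw [mul_pow, ← Real.exp_nat_mul]
          have e : Real.exp ((C₃ + 2 + 2 * D) * q - a * q ^ 2) * Real.exp C₃ =
            Real.exp (2 * q) * Real.exp (D * (2 * q)) * Real.exp (C₃ * (q + 1) - a * q ^ 2) := by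
            rw [← Real.exp_add, ← Real.exp_add, ← Real.exp_add]; congr 1; ring
          linear_combination (-(C₁ * C₂ * (1 + C₂) ^ D * t)) * e
  have h4 := norm_coeff_le_of_circle p hbound j
  rw [hcoeff, norm_mul, norm_pow, Complex.norm_real, Real.norm_of_nonneg ht.le, hM] at h4
  have h5 : t ^ d ≤ t ^ j := pow_le_pow_of_le_one ht.le ht1 hj
  have h6 : 0 < t ^ j := by positivity
  refine le_of_mul_le_mul_left (h4.trans (mul_le_mul_of_nonneg_right h5 (by positivity))) h6

theorem norm_add_pow_le_exp {w e : ℂ} {a ρ B C t : ℝ} {m : ℕ} (ha : 0 ≤ a)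
    (hw : ‖w‖ ≤ Real.exp (-(a * ρ ^ 2))) (hρ : 0 ≤ ρ) (hB : ρ ≤ B) (hC : 0 ≤ C)
    (he : ‖e‖ ≤ C * (ρ * t + t ^ 2)) (ht : 0 < t) (hm : m * t ^ 2 = 1) :
    ‖w + e‖ ^ m ≤ Real.exp (Real.exp (a * B ^ 2) * C * (ρ / t + 1) - a * (ρ / t) ^ 2) := by
  have hs : 0 ≤ C * (ρ * t + t ^ 2) := by positivity
  have h1 : ‖w + e‖ ≤ Real.exp (Real.exp (a * B ^ 2) * (C * (ρ * t + t ^ 2)) - a * ρ ^ 2) := by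
    have h2 : 1 + Real.exp (a * B ^ 2) * (C * (ρ * t + t ^ 2)) ≤
        Real.exp (Real.exp (a * B ^ 2) * (C * (ρ * t + t ^ 2))) := by
      linarith [Real.add_one_le_exp (Real.exp (a * B ^ 2) * (C * (ρ * t + t ^ 2)))]
    have h3 : 1 ≤ Real.exp (-(a * ρ ^ 2)) * Real.exp (a * B ^ 2) := by
      rw [← Real.exp_add]
      refine Real.one_le_exp ?_
      have : ρ ^ 2 ≤ B ^ 2 := by gcongr
      nlinarith
    rw [sub_eq_add_neg, Real.exp_add, mul_comm]
    refine (norm_add_le _ _).trans ?_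
    refine le_trans ?_ (mul_le_mul_of_nonneg_left h2 (Real.exp_pos _).le)
    rw [mul_add, mul_one, ← mul_assoc]
    refine add_le_add hw (he.trans (le_mul_of_one_le_left hs h3))
  refine (pow_le_pow_left₀ (norm_nonneg _) h1 m).trans ?_
  rw [← Real.exp_nat_mul]
  refine Real.exp_le_exp.2 (le_of_eq ?_)
  have : (m : ℝ) = (t ^ 2)⁻¹ := by field_simp; linarith
  rw [this]
  field_simp

end Perturb

section Step
open MeasureTheory Filter Topology Matrix

variable {n : ℕ} {G : Set (Matrix (Fin n) (Fin n) ℂ)} {v : Fin n → ℂ}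

theorem Frame.exists_weight (hG : IsReductiveGroup ℂ n G) (Fr : Frame G v) :
    ∃ B : MvPolynomial (Fin n) ℂ, ∃ e : Matrix (Fin n) (Fin n) ℂ → (Fin n → ℂ) → ℂ,
      (∀ k ∈ Fr.K, ∀ y, eval y (shift v (act k B)) = Fr.wt k + e k y) ∧ (∀ k ∈ Fr.K, e k 0 = 0) ∧
      ∃ C : ℝ, 0 ≤ C ∧ ∀ k ∈ Fr.K, ∀ y, ‖y‖ ≤ 1 →
        ‖e k y‖ ≤ C * (Fr.rho k * ‖y‖ + ‖y‖ ^ 2) := by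
  obtain ⟨p, hp1, hp2, hp3⟩ := Fr.exists_invariant_linear hG
  have hR := Fr.R_pos
  have hR' : (Fr.R : ℂ) ≠ 0 := by exact_mod_cast hR.ne'
  obtain ⟨C₁, hC₁, h1⟩ := norm_eval_le_of_jet (shift v p - linPoly Fr.ell) 2
  obtain ⟨C₂, hC₂, h2⟩ := exists_norm_le Fr.S
  have hjet : ∀ y, ∀ j < 2, jet j y (shift v p - linPoly Fr.ell) = 0 := by
    intro y j hj
    interval_cases j
    · rw [jet_zero, map_sub, eval_shift, eval_linPoly, add_zero, hp2, map_zero, sub_zero]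
    · rw [map_sub, hp3, jet_one_linPoly, sub_self]
  refine ⟨Fr.wtPoly - C (Fr.R : ℂ)⁻¹ * p,
    fun k y => (Fr.ell (k *ᵥ y) - eval (v + y) p) / Fr.R, fun k hk y => ?_, fun k hk => ?_,
    (C₁ + C₂) / Fr.R, by positivity, fun k hk y hy => ?_⟩
  · have h3 : k *ᵥ (v + y) - v = (k *ᵥ v - v) + k *ᵥ y := by rw [mulVec_add]; abel
    rw [eval_shift, eval_act, map_sub, Fr.eval_wtPoly, map_mul, eval_C, hp1 k (Fr.sub hk),
      Frame.wt, h3, map_add Fr.ell]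
    ring
  · beta_reduce
    rw [mulVec_zero, map_zero, add_zero, hp2, sub_zero, zero_div]
  · have h3 := h1 y hy (hjet y)
    rw [map_sub, eval_shift, eval_linPoly] at h3
    have h4 := (Fr.ell_mulVec_of_rho hk y).trans (mul_le_mul_of_nonneg_left (h2 y) (Fr.rho_nonneg k))
    have h5 : Fr.ell (k *ᵥ y) - eval (v + y) p =
      (Fr.ell (k *ᵥ y) - Fr.ell y) - (eval (v + y) p - Fr.ell y) := by ring
    rw [norm_div, Complex.norm_real, Real.norm_of_nonneg hR.le, h5, div_mul_eq_mul_div]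
    refine div_le_div_of_nonneg_right ((norm_sub_le _ _).trans ((add_le_add h4 h3).trans ?_)) hR.le
    have h6 : 0 ≤ C₁ * (Fr.rho k * ‖y‖) := by have := Fr.rho_nonneg k; positivity
    have h7 : 0 ≤ C₂ * ‖y‖ ^ 2 := by positivity
    nlinarith

theorem Frame.approx_tendsto (hG : IsReductiveGroup ℂ n G) (Fr : Frame G v)
    {N : Submodule ℂ (Fin n → ℂ)} {pr : (Fin n → ℂ) →ₗ[ℂ] (Fin n → ℂ)} (hprN : ∀ x ∈ N, pr x = x)
    (hpr : ∀ A ∈ lieAlgebra ℂ n G, pr (A *ᵥ v) = 0)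
    (hN : ∀ h ∈ Fr.K, h *ᵥ v = v → ∀ x ∈ N, h *ᵥ x ∈ N)
    {Φ : MvPolynomial (Fin n) ℂ →ₗ[ℂ] MvPolynomial (Fin n) ℂ}
    (hΦ : ∀ h ∈ Fr.K, h *ᵥ v = v → ∀ P, ∀ x ∈ N, eval x (Φ (act h P)) = eval (h *ᵥ x) (Φ P))
    (d : ℕ) :
    ∃ Θ : ℕ → MvPolynomial (Fin n) ℂ →ₗ[ℂ] MvPolynomial (Fin n) ℂ,
      (∀ m, ∀ g ∈ G, ∀ P, Θ m (act g P) = act g (Θ m P)) ∧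
      ∀ P, ∀ x ∈ N, ∀ j ≤ d, Tendsto (fun m => jet j x (shift v (Θ m P))) atTop
        (𝓝 (if j = d then jet d x (Φ P) else 0)) := by
  obtain ⟨μ, hμ⟩ := Fr.exists_isMean
  have := hμ.prob
  have L := Fr.laplace hG hμ
  obtain ⟨B, e, hB1, hB2, Ce, hCe, hB3⟩ := Fr.exists_weight hG
  let M := LinearMap.toMatrix' pr
  have hM : ∀ x, M *ᵥ x = pr x := fun x => LinearMap.toMatrix'_mulVec pr x
  let T₀ : MvPolynomial (Fin n) ℂ →ₗ[ℂ] MvPolynomial (Fin n) ℂ :=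
    (affSub M (-pr v)).toLinearMap ∘ₗ homogeneousComponent d ∘ₗ Φ
  have hT₀ : ∀ Q y, eval y (T₀ Q) = eval (pr (y - v)) (homogeneousComponent d (Φ Q)) := by
    intro Q y
    change eval y (affSub M (-pr v) (homogeneousComponent d (Φ Q))) = _
    rw [eval_affSub, hM, map_sub, sub_eq_add_neg]
  have hav := fun m : ℕ => Fr.average hμ (LinearMap.mulRight ℂ (B ^ m) ∘ₗ T₀)
  choose Θ hΘ1 hΘ2 using hav
  refine ⟨fun m => (lapZ μ (fun k : Fr.K => Fr.wt k) m)⁻¹ • Θ m, fun m g hg P => ?_,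
    fun P x hx j hj => ?_⟩
  · simp only [LinearMap.smul_apply, hΘ1 m g hg, map_smul]
  let F : Fr.K → MvPolynomial (Fin n) ℂ := fun k =>
    homogeneousComponent d (Φ (act (k : Matrix (Fin n) (Fin n) ℂ)⁻¹ P))
  let c : Fr.K → Fin n → ℂ := fun k => pr ((k : Matrix (Fin n) (Fin n) ℂ) *ᵥ x)
  let b : Fr.K → Fin n → ℂ := fun k => pr ((k : Matrix (Fin n) (Fin n) ℂ) *ᵥ v - v)
  have hprc : Continuous pr := LinearMap.continuous_of_finiteDimensional _
  have hcc : Continuous c := by fun_prop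
  have hCS : CompactSpace Fr.K := isCompact_iff_compactSpace.1 Fr.cpt
  have hFn : F ∈ niceMaps (contAlg Fr.K) _ :=
    nice_map (homogeneousComponent d ∘ₗ Φ) (nice_act_inv Fr.grp P)
  have hFc : Continuous fun k => eval (c k) (F k) := by
    have h1 := nice_affSub_apply (A := fun _ : Fr.K => (1 : Matrix (Fin n) (Fin n) ℂ)) (b := c)
      (fun i j => continuous_const) (fun i => (continuous_apply i).comp hcc) hFn
    have h2 := nice_apply (aeval (0 : Fin n → ℂ)).toLinearMap h1
    have h3 : (fun k => eval (c k) (F k)) = fun k => (aeval (0 : Fin n → ℂ)).toLinearMap (affSub 1 (c k) (F k)) := by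
      ext k
      have h4 := eval_affSub 1 (c k) 0 (F k)
      rw [one_mulVec, zero_add] at h4
      rw [← h4]; rfl
    rw [h3]; exact h2
  have hdec : ∀ (k : Fr.K) (m : ℕ), shift v (act (k : Matrix (Fin n) (Fin n) ℂ)
      ((LinearMap.mulRight ℂ (B ^ m) ∘ₗ T₀) (act (k : Matrix (Fin n) (Fin n) ℂ)⁻¹ P))) =
      shift v (act (k : Matrix (Fin n) (Fin n) ℂ) (T₀ (act (k : Matrix (Fin n) (Fin n) ℂ)⁻¹ P))) *
        shift v (act (k : Matrix (Fin n) (Fin n) ℂ) B) ^ m := by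
    intro k m
    rw [LinearMap.comp_apply, LinearMap.mulRight_apply, map_mul, map_mul, map_pow, map_pow]
  let f : ℕ → Fr.K → ℂ := fun m k => jet j x (shift v (act (k : Matrix (Fin n) (Fin n) ℂ)
      ((LinearMap.mulRight ℂ (B ^ m) ∘ₗ T₀) (act (k : Matrix (Fin n) (Fin n) ℂ)⁻¹ P))))
  have hfc : ∀ m, Continuous (f m) := fun m =>
    nice_apply (jet j x ∘ₗ (shift v).toLinearMap) (nice_conj Fr.grp (LinearMap.mulRight ℂ (B ^ m) ∘ₗ T₀) P)
  have hwc : Continuous fun k : Fr.K => Fr.wt k := Fr.continuous_wt.comp continuous_subtype_val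
  let s : ℕ → Fr.K → ℂ := fun m k => if j = d then eval (c k) (F k) * Fr.wt k ^ m else 0
  have hsc : ∀ m, Continuous (s m) := by
    intro m
    by_cases h : j = d
    · simp only [s, if_pos h]; fun_prop
    · simp only [s, if_neg h]; exact continuous_const
  have hslim : Tendsto (fun m => (lapZ μ (fun k : Fr.K => Fr.wt k) m)⁻¹ * ∫ k, s m k ∂μ) atTop
      (𝓝 (if j = d then jet d x (Φ P) else 0)) := by
    by_cases h : j = d
    · simp only [s, if_pos h]
      refine Fr.tendsto_const hG hμ hFc fun k hk => ?_
      have hkv := Fr.rho_eq_zero.1 hk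
      have hkx := hN k k.2 hkv x hx
      simp only [c, F]
      rw [hprN _ hkx, ← jet_apply]
      refine jet_congr (fun z => ?_) d
      rw [← mulVec_smul, ← hΦ k k.2 hkv _ _ (N.smul_mem z hx), act_act_inv Fr.grp k.2]
    · simp only [s, if_neg h, integral_zero, mul_zero]; exact tendsto_const_nhds
  have hdiff : Tendsto (fun m => (lapZ μ (fun k : Fr.K => Fr.wt k) m)⁻¹ * ∫ k, (f m k - s m k) ∂μ) atTop (𝓝 0) := by
    obtain ⟨Y, hY⟩ := isCompact_univ.exists_bound_of_continuousOn hcc.continuousOn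
    have hY' : ∀ k, ‖c k‖ ≤ |Y| := fun k => (hY k trivial).trans (le_abs_self Y)
    obtain ⟨C₁, hC₁, D, hpert⟩ := nice_norm_eval_add_sub_le hFn (abs_nonneg Y)
    obtain ⟨C₂, hC₂, hest⟩ := Fr.estimates hG pr hpr
    obtain ⟨a, ha, hdecay⟩ := L.decay
    obtain ⟨Bd, hBd0, hBd⟩ := L.bdd
    set Cx := Ce * (‖x‖ + ‖x‖ ^ 2) with hCx
    set C₃ := Real.exp (a * Bd ^ 2) * Cx with hC₃
    set K₀ := C₁ * C₂ * (1 + C₂) ^ D * Real.exp C₃ with hK₀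
    have hlim : Tendsto (fun m : ℕ => K₀ * (Real.sqrt m)⁻¹) atTop (𝓝 0) := by
      have h1 : Tendsto (fun m : ℕ => Real.sqrt m) atTop atTop :=
        Real.tendsto_sqrt_atTop.comp tendsto_natCast_atTop_atTop
      simpa using h1.inv_tendsto_atTop.const_mul K₀
    refine L.tendsto_zero hlim ha (A := C₃ + 2 + 2 * D) ?_
    filter_upwards [eventually_ge_atTop 1,
      tendsto_natCast_atTop_atTop.eventually_ge_atTop (‖x‖ ^ 2)] with m hm hmx k
    have hm1 : (1 : ℝ) ≤ m := by exact_mod_cast hm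
    have hsq1 : 1 ≤ Real.sqrt m := Real.one_le_sqrt.2 hm1
    have hsq0 : 0 < Real.sqrt m := by linarith
    set t := (Real.sqrt m)⁻¹ with ht
    have ht0 : 0 < t := inv_pos.2 hsq0
    have ht1 : t ≤ 1 := inv_le_one_of_one_le₀ hsq1
    have hmt : m * t ^ 2 = 1 := by
      rw [ht, inv_pow, Real.sq_sqrt (by linarith)]; field_simp
    have htx : t * ‖x‖ ≤ 1 := by
      rw [ht, inv_mul_le_iff₀ hsq0, mul_one]
      exact Real.le_sqrt_of_sq_le hmx
    have hqt : Real.sqrt m * Fr.rho k = Fr.rho k / t := by rw [ht]; field_simp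
    have hρ := Fr.rho_nonneg (k : Matrix (Fin n) (Fin n) ℂ)
    rw [hqt]
    simp only [f, hdec]
    have e0 : eval 0 (shift v (act (k : Matrix (Fin n) (Fin n) ℂ) B)) = Fr.wt k := by
      rw [hB1 k k.2, hB2 k k.2, add_zero]
    have hs : s m k = if j = d then eval (c k) (F k) *
        eval 0 (shift v (act (k : Matrix (Fin n) (Fin n) ℂ) B)) ^ m else 0 := by rw [e0]
    rw [hs]
    refine norm_jet_mul_pow_sub_le (F := F k) (b := b k) (c := c k) (Y := |Y|) (fun z => ?_)
      (homogeneousComponent_isHomogeneous d _) (hpert k) (hY' k) hC₁ hC₂.le ht0 ht1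
      (div_nonneg hρ ht0.le) ?_ (fun z hz => ?_) hj
    · rw [eval_shift, eval_act, hT₀]
      simp only [F, b, c]
      rw [mulVec_add, mulVec_smul, add_sub_right_comm, map_add, map_smul]
    · rw [div_mul_cancel₀ _ ht0.ne']
      exact (hest k k.2).1
    · rw [hB1 k k.2]
      have hn : ‖((t : ℂ) * z) • x‖ = t * ‖x‖ := by
        rw [norm_smul, norm_mul, hz, Complex.norm_real, Real.norm_of_nonneg ht0.le, mul_one]
      have h2 := hB3 k k.2 (((t : ℂ) * z) • x) (by rw [hn]; exact htx)
      rw [hn] at h2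
      refine norm_add_pow_le_exp ha.le (hdecay k) hρ (hBd k) (by positivity) (h2.trans ?_) ht0 hmt
      rw [hCx, mul_assoc]
      refine mul_le_mul_of_nonneg_left ?_ hCe
      have h3 : 0 ≤ ‖x‖ ^ 2 * (Fr.rho k * t) := by positivity
      have h4 : 0 ≤ ‖x‖ * t ^ 2 := by positivity
      nlinarith
  have hsum := hdiff.add hslim
  rw [zero_add] at hsum
  refine hsum.congr fun m => ?_
  have i1 := continuous_integrable_of_compact Fr.cpt μ (hfc m)
  have i2 := continuous_integrable_of_compact Fr.cpt μ (hsc m)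
  rw [← mul_add, integral_sub i1 i2, sub_add_cancel]
  rw [LinearMap.smul_apply, map_smul, map_smul, smul_eq_mul]
  congr 1
  exact (hΘ2 m P (jet j x ∘ₗ (shift v).toLinearMap)).symm

end Step

section Approx
open MeasureTheory Filter Topology Matrix

variable {n : ℕ} {G : Set (Matrix (Fin n) (Fin n) ℂ)} {v : Fin n → ℂ}

theorem conj_mem_lieAlgebra (hG : IsMatSubgroup ℂ n G) {h A : Matrix (Fin n) (Fin n) ℂ} (hh : h ∈ G)
    (hA : A ∈ lieAlgebra ℂ n G) : h * A * h⁻¹ ∈ lieAlgebra ℂ n G := by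
  intro t
  have h1 := hA t
  have h2 : mexp ℂ n (t • (h * A * h⁻¹)) = h * mexp ℂ n (t • A) * h⁻¹ := by
    rw [mexp_eq_exp, mexp_eq_exp, ← Matrix.exp_conj h (t • A) (hG.2.2 h hh).1]
    simp
  rw [h2]
  exact hG.2.1 _ (hG.2.1 _ hh _ h1) _ (hG.2.2 h hh).2

theorem mulVec_mem_orbitTangent (hG : IsMatSubgroup ℂ n G) {h : Matrix (Fin n) (Fin n) ℂ}
    (hh : h ∈ isotropy ℂ n G v) {x : Fin n → ℂ} (hx : x ∈ orbitTangent ℂ n G v) :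
    h *ᵥ x ∈ orbitTangent ℂ n G v := by
  induction hx using Submodule.span_induction with
  | mem x hx =>
    obtain ⟨A, hA, rfl⟩ := hx
    refine Submodule.subset_span ⟨_, conj_mem_lieAlgebra hG hh.1 hA, ?_⟩
    have h1 : h⁻¹ *ᵥ v = v := by
      conv_lhs => rw [← hh.2]
      rw [mulVec_mulVec, hG.inv_mul hh.1, one_mulVec]
    beta_reduce
    rw [← mulVec_mulVec, h1, mulVec_mulVec]
  | zero => rw [mulVec_zero]; exact zero_mem _
  | add x y _ _ h1 h2 => rw [mulVec_add]; exact add_mem h1 h2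
  | smul a x _ h1 => rw [mulVec_smul]; exact Submodule.smul_mem _ a h1

theorem exists_proj_of_isCompl {T N : Submodule ℂ (Fin n → ℂ)} (hc : IsCompl N T) :
    ∃ pr : (Fin n → ℂ) →ₗ[ℂ] (Fin n → ℂ), (∀ x ∈ N, pr x = x) ∧ (∀ x, pr x ∈ N) ∧
      (∀ x ∈ T, pr x = 0) ∧ (∀ x, x - pr x ∈ T) ∧
      ∀ h : Matrix (Fin n) (Fin n) ℂ, (∀ x ∈ T, h *ᵥ x ∈ T) → (∀ x ∈ N, h *ᵥ x ∈ N) →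
        ∀ x, pr (h *ᵥ x) = h *ᵥ pr x := by
  let pr : (Fin n → ℂ) →ₗ[ℂ] (Fin n → ℂ) := N.subtype ∘ₗ N.projectionOnto _ hc
  have h1 : ∀ x ∈ N, pr x = x := fun x hx => by
    have := Submodule.projectionOnto_apply_left hc ⟨x, hx⟩
    exact congrArg Subtype.val this
  have h2 : ∀ x, pr x ∈ N := fun x => (N.projectionOnto _ hc x).2
  have h3 : ∀ x ∈ T, pr x = 0 := fun x hx => by
    have := (Submodule.projectionOnto_apply_eq_zero_iff hc).2 hx
    exact congrArg Subtype.val this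
  have h4 : ∀ x, x - pr x ∈ T := fun x => by
    obtain ⟨y, hy, z, hz, rfl⟩ := Submodule.mem_sup.1 (hc.sup_eq_top ▸ Submodule.mem_top : x ∈ N ⊔ _)
    rw [map_add, h1 y hy, h3 z hz, add_zero, add_sub_cancel_left]; exact hz
  refine ⟨pr, h1, h2, h3, h4, fun h hT hN x => ?_⟩
  have h5 : h *ᵥ x = h *ᵥ pr x + h *ᵥ (x - pr x) := by rw [← mulVec_add, add_sub_cancel]
  rw [h5, map_add, h3 _ (hT _ (h4 x)), add_zero, h1 _ (hN _ (h2 x))]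

theorem IsSliceComplement.exists_proj {N : Submodule ℂ (Fin n → ℂ)} (hG : IsMatSubgroup ℂ n G)
    (hs : IsSliceComplement ℂ n G v N) :
    ∃ pr : (Fin n → ℂ) →ₗ[ℂ] (Fin n → ℂ), (∀ x ∈ N, pr x = x) ∧ (∀ x, pr x ∈ N) ∧
      (∀ x ∈ orbitTangent ℂ n G v, pr x = 0) ∧ (∀ x, x - pr x ∈ orbitTangent ℂ n G v) ∧
      ∀ h ∈ isotropy ℂ n G v, ∀ x, pr (h *ᵥ x) = h *ᵥ pr x := by
  obtain ⟨pr, h1, h2, h3, h4, h5⟩ := exists_proj_of_isCompl hs.1.symm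
  exact ⟨pr, h1, h2, h3, h4, fun h hh => h5 h (fun x => mulVec_mem_orbitTangent hG hh) (hs.2 h hh)⟩

/-- Equivariant linear endomorphisms of the polynomial ring. -/
def equivMaps (G : Set (Matrix (Fin n) (Fin n) ℂ)) :
    Submodule ℂ (MvPolynomial (Fin n) ℂ →ₗ[ℂ] MvPolynomial (Fin n) ℂ) where
  carrier := {Θ | ∀ g ∈ G, ∀ P, Θ (act g P) = act g (Θ P)}
  zero_mem' := fun g _ P => by simp
  add_mem' := fun {a b} ha hb g hg P => by simp [ha g hg, hb g hg]
  smul_mem' := fun c a ha g hg P => by simp [ha g hg]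

theorem mem_equivMaps {Θ : MvPolynomial (Fin n) ℂ →ₗ[ℂ] MvPolynomial (Fin n) ℂ} :
    Θ ∈ equivMaps G ↔ ∀ g ∈ G, ∀ P, Θ (act g P) = act g (Θ P) := Iff.rfl

theorem Frame.mem_isotropy (Fr : Frame G v) {h : Matrix (Fin n) (Fin n) ℂ} (hh : h ∈ Fr.K)
    (hv : h *ᵥ v = v) : h ∈ isotropy ℂ n G v := ⟨Fr.sub hh, hv⟩

theorem Frame.approx_step (hG : IsReductiveGroup ℂ n G) (Fr : Frame G v)
    {N : Submodule ℂ (Fin n → ℂ)} (hs : IsSliceComplement ℂ n G v N)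
    {Φ : MvPolynomial (Fin n) ℂ →ₗ[ℂ] MvPolynomial (Fin n) ℂ}
    (hΦ : ∀ h ∈ Fr.K, h *ᵥ v = v → ∀ P, ∀ x ∈ N, eval x (Φ (act h P)) = eval (h *ᵥ x) (Φ P))
    (U : Submodule ℂ (MvPolynomial (Fin n) ℂ)) [FiniteDimensional ℂ U] (d : ℕ) :
    ∃ Θ ∈ equivMaps G, ∀ P ∈ U, ∀ x ∈ N, ∀ j ≤ d,
      jet j x (shift v (Θ P)) = if j = d then jet d x (Φ P) else 0 := by
  obtain ⟨pr, hp1, hp2, hp3, -, -⟩ := hs.exists_proj hG.1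
  obtain ⟨Θ, hΘ1, hΘ2⟩ := Fr.approx_tendsto hG hp1
    (fun A hA => hp3 _ (Submodule.subset_span ⟨A, hA, rfl⟩))
    (fun h hh hv x hx => hs.2 h (Fr.mem_isotropy hh hv) x hx) hΦ d
  let Λ : (MvPolynomial (Fin n) ℂ →ₗ[ℂ] MvPolynomial (Fin n) ℂ) →ₗ[ℂ] (Fin (d + 1) × U × N → ℂ) :=
    LinearMap.pi fun i => (jet (i.1 : ℕ) (i.2.2 : Fin n → ℂ) ∘ₗ (shift v).toLinearMap) ∘ₗ
      LinearMap.applyₗ (i.2.1 : MvPolynomial (Fin n) ℂ)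
  have hΛ : ∀ Θ i, Λ Θ i = jet (i.1 : ℕ) (i.2.2 : Fin n → ℂ) (shift v (Θ i.2.1)) := fun _ _ => rfl
  let Ψ : (Fin (d + 1) → (U →ₗ[ℂ] restrictTotalDegree (Fin n) ℂ d)) →ₗ[ℂ] (Fin (d + 1) × U × N → ℂ) :=
    LinearMap.pi fun i => (((aeval (i.2.2 : Fin n → ℂ)).toLinearMap ∘ₗ
      (restrictTotalDegree (Fin n) ℂ d).subtype) ∘ₗ LinearMap.applyₗ i.2.1) ∘ₗ LinearMap.proj i.1
  have hΨ : ∀ φ i, Ψ φ i = eval (i.2.2 : Fin n → ℂ) (φ i.1 i.2.1 : MvPolynomial (Fin n) ℂ) := fun _ _ => rfl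
  have hmem : (fun i : Fin (d + 1) × U × N => if (i.1 : ℕ) = d then jet d (i.2.2 : Fin n → ℂ) (Φ i.2.1) else 0) ∈
      Submodule.map Λ (equivMaps G) := by
    refine mem_of_tendsto_of_finiteDimensional _ (LinearMap.range Ψ) (u := fun m => Λ (Θ m))
      (fun m => Submodule.mem_map_of_mem (hΘ1 m)) (fun m => ?_) fun i => ?_
    · refine ⟨fun j => LinearMap.codRestrict _ (homogeneousComponent j ∘ₗ (shift v).toLinearMap ∘ₗ
        Θ m ∘ₗ U.subtype) fun P => ?_, ?_⟩
      · rw [mem_restrictTotalDegree]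
        exact (homogeneousComponent_isHomogeneous _ _).totalDegree_le.trans (Nat.lt_succ_iff.1 j.2)
      · ext i; rw [hΛ, hΨ, jet_apply]; rfl
    · exact hΘ2 i.2.1 i.2.2 i.2.2.2 i.1 (Nat.lt_succ_iff.1 i.1.2)
  obtain ⟨Θ', h1, h2⟩ := hmem
  refine ⟨Θ', h1, fun P hP x hx j hj => ?_⟩
  exact congrFun h2 (⟨j, Nat.lt_succ_iff.2 hj⟩, ⟨P, hP⟩, ⟨x, hx⟩)

theorem Frame.approx (hG : IsReductiveGroup ℂ n G) (Fr : Frame G v)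
    {N : Submodule ℂ (Fin n → ℂ)} (hs : IsSliceComplement ℂ n G v N)
    {Φ : MvPolynomial (Fin n) ℂ →ₗ[ℂ] MvPolynomial (Fin n) ℂ}
    (hΦ : ∀ h ∈ Fr.K, h *ᵥ v = v → ∀ P, ∀ x ∈ N, eval x (Φ (act h P)) = eval (h *ᵥ x) (Φ P))
    (U : Submodule ℂ (MvPolynomial (Fin n) ℂ)) [FiniteDimensional ℂ U] (d : ℕ) :
    ∃ Θ ∈ equivMaps G, ∀ P ∈ U, ∀ x ∈ N, ∀ j < d, jet j x (shift v (Θ P)) = jet j x (Φ P) := by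
  induction d with
  | zero => exact ⟨0, zero_mem _, fun _ _ _ _ j hj => absurd hj (Nat.not_lt_zero j)⟩
  | succ d ih =>
    obtain ⟨Θ, h1, h2⟩ := ih
    obtain ⟨Θ', h3, h4⟩ := Fr.approx_step hG hs (Φ := Φ - (shift v).toLinearMap ∘ₗ Θ)
      (fun h hh hv P x hx => by
        simp only [LinearMap.sub_apply, map_sub, LinearMap.comp_apply, AlgHom.toLinearMap_apply]
        rw [hΦ h hh hv P x hx, mem_equivMaps.1 h1 h (Fr.sub hh), ← act_shift hv, eval_act]) U d
    refine ⟨Θ + Θ', add_mem h1 h3, fun P hP x hx j hj => ?_⟩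
    have h5 := h4 P hP x hx j (Nat.lt_succ_iff.1 hj)
    rw [LinearMap.add_apply, map_add, map_add, h5]
    rcases (Nat.lt_succ_iff.1 hj).lt_or_eq with h | rfl
    · rw [if_neg h.ne, h2 P hP x hx j h, add_zero]
    · simp

/-- Polynomials invariant under the compact isotropy group on a slice are approximated by invariants. -/
theorem Frame.approx_invariant (hG : IsReductiveGroup ℂ n G) (Fr : Frame G v)
    {N : Submodule ℂ (Fin n → ℂ)} (hs : IsSliceComplement ℂ n G v N) {q : MvPolynomial (Fin n) ℂ}
    (hq : ∀ h ∈ Fr.K, h *ᵥ v = v → ∀ x ∈ N, eval (h *ᵥ x) q = eval x q) (d : ℕ) :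
    ∃ p, Invariant ℂ n G p ∧ ∀ x ∈ N, ∀ j < d, jet j x (shift v p) = jet j x q := by
  obtain ⟨Θ, h1, h2⟩ := Fr.approx hG hs (Φ := (aeval (0 : Fin n → ℂ)).toLinearMap.smulRight q)
    (fun h hh hv P x hx => by
      have h3 : aeval (0 : Fin n → ℂ) (act h P) = aeval (0 : Fin n → ℂ) P := by
        have := eval_act h 0 P
        rw [mulVec_zero] at this
        exact this
      simp only [LinearMap.smulRight_apply, AlgHom.toLinearMap_apply, h3, smul_eval, hq h hh hv x hx])
    (ℂ ∙ 1) d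
  refine ⟨Θ 1, invariant_iff_act.2 fun g hg => by rw [← mem_equivMaps.1 h1 g hg, map_one],
    fun x hx j hj => ?_⟩
  rw [h2 1 (Submodule.mem_span_singleton_self 1) x hx j hj]
  simp

theorem eval_eq_of_jets {P Q : MvPolynomial (Fin n) ℂ} {x y : Fin n → ℂ}
    (h : ∀ j ≤ max P.totalDegree Q.totalDegree, jet j x P = jet j y Q) : eval x P = eval y Q := by
  rw [eval_eq_sum_jet x (le_max_left P.totalDegree Q.totalDegree),
    eval_eq_sum_jet y (le_max_right P.totalDegree Q.totalDegree)]
  exact Finset.sum_congr rfl fun j hj => h j (Nat.lt_succ_iff.1 (Finset.mem_range.1 hj))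

theorem Frame.invariantOn (hG : IsReductiveGroup ℂ n G) (Fr : Frame G v)
    {N : Submodule ℂ (Fin n → ℂ)} (hs : IsSliceComplement ℂ n G v N) {q : MvPolynomial (Fin n) ℂ}
    (hq : ∀ h ∈ Fr.K, h *ᵥ v = v → ∀ x ∈ N, eval (h *ᵥ x) q = eval x q) :
    InvariantOn ℂ n (isotropy ℂ n G v) N q := by
  intro g hg x hx
  obtain ⟨p, hp1, hp2⟩ := Fr.approx_invariant hG hs hq (max q.totalDegree q.totalDegree + 1)
  refine eval_eq_of_jets fun j hj => ?_
  rw [← hp2 _ (hs.2 g hg x hx) j (Nat.lt_succ_iff.2 hj), ← hp2 _ hx j (Nat.lt_succ_iff.2 hj)]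
  refine jet_congr (fun z => ?_) j
  rw [← mulVec_smul, eval_shift, eval_shift, ← hp1 g hg.1 (v + z • x), mulVec_add, hg.2]

end Approx

section SliceExists
open MeasureTheory Filter Topology Matrix

variable {n : ℕ} {G : Set (Matrix (Fin n) (Fin n) ℂ)} {v : Fin n → ℂ}

/-- A matrix commuting with the compact isotropy group commutes with the isotropy group. -/
theorem Frame.commute_of_commute (hG : IsReductiveGroup ℂ n G) (Fr : Frame G v)
    {w : Matrix (Fin n) (Fin n) ℂ} (hw : ∀ h ∈ Fr.K, h *ᵥ v = v → w * h = h * w)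
    {g : Matrix (Fin n) (Fin n) ℂ} (hg : g ∈ isotropy ℂ n G v) : w * g = g * w := by
  obtain ⟨μ, hμ⟩ := Fr.exists_isMean
  have := hμ.prob
  have hinvc : Continuous fun k : Fr.K => (k : Matrix (Fin n) (Fin n) ℂ)⁻¹ :=
    IsMatSubgroup.continuous_inv Fr.grp
  let c : Fin n → Fin n → Fr.K → ℂ := fun i l k =>
    ((k : Matrix (Fin n) (Fin n) ℂ)⁻¹ * w * (k : Matrix (Fin n) (Fin n) ℂ)) i l
  have hcc : ∀ i l, Continuous (c i l) := fun i l => by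
    have h1 : Continuous fun k : Fr.K => (k : Matrix (Fin n) (Fin n) ℂ)⁻¹ * w * (k : Matrix (Fin n) (Fin n) ℂ) := by
      fun_prop
    exact h1.matrix_elem i l
  have hInt : ∀ f ∈ contAlg Fr.K, Integrable f μ := fun f hf =>
    continuous_integrable_of_compact Fr.cpt μ hf
  have hfam : ∀ (m : ℕ) i l, (fun k : Fr.K => c i l k • act (k : Matrix (Fin n) (Fin n) ℂ) (Fr.wtPoly ^ m)) ∈
      niceMaps (contAlg Fr.K) _ := fun m i l =>
    nice_smul (hcc i l) (nice_affSub (A := fun k : Fr.K => (k : Matrix (Fin n) (Fin n) ℂ)) (b := fun _ => 0)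
      (fun i j => continuous_subtype_val.matrix_elem i j) (fun _ => continuous_const) _)
  choose P hP _ using fun m i l => nice_integral μ hInt (hfam m i l)
  have hPe : ∀ m i l u, eval u (P m i l) = ∫ k : Fr.K, c i l k *
      eval ((k : Matrix (Fin n) (Fin n) ℂ) *ᵥ u) Fr.wtPoly ^ m ∂μ := by
    intro m i l u
    refine (hP m i l (aeval u).toLinearMap).trans (integral_congr_ae (ae_of_all _ fun k => ?_))
    change eval u (c i l k • act (k : Matrix (Fin n) (Fin n) ℂ) (Fr.wtPoly ^ m)) = _
    rw [smul_eval, eval_act, map_pow]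
  have hcont : ∀ i l m u, Integrable (fun k : Fr.K => c i l k *
      eval ((k : Matrix (Fin n) (Fin n) ℂ) *ᵥ u) Fr.wtPoly ^ m) μ := fun i l m u => by
    refine continuous_integrable_of_compact Fr.cpt μ ?_
    have h1 := continuous_eval_poly Fr.wtPoly
    have h2 := hcc i l
    fun_prop
  have hK : ∀ m i j, ∀ g ∈ Fr.K, ∑ l, eval (g *ᵥ v) (P m i l) * g l j = ∑ l, g i l * eval v (P m l j) := by
    intro m i j g hg
    have h1 : ∀ l, eval (g *ᵥ v) (P m i l) * g l j = ∫ k : Fr.K, (c i l k *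
        eval ((k : Matrix (Fin n) (Fin n) ℂ) *ᵥ (g *ᵥ v)) Fr.wtPoly ^ m) * g l j ∂μ := fun l => by
      rw [integral_mul_const, ← hPe]
    have h2 : ∀ l, g i l * eval v (P m l j) = ∫ k : Fr.K, g i l * (c l j k *
        eval ((k : Matrix (Fin n) (Fin n) ℂ) *ᵥ v) Fr.wtPoly ^ m) ∂μ := fun l => by
      rw [integral_const_mul, ← hPe]
    rw [Finset.sum_congr rfl fun l _ => h1 l, Finset.sum_congr rfl fun l _ => h2 l,
      ← integral_finsetSum _ fun l _ => (hcont i l m _).mul_const _,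
      ← integral_finsetSum _ fun l _ => (hcont l j m _).const_mul _]
    have h3 := hμ.right g hg fun k => (g * (k⁻¹ * w * k)) i j * eval (k *ᵥ v) Fr.wtPoly ^ m
    refine Eq.trans (integral_congr_ae (ae_of_all _ fun k => ?_)) (h3.trans
      (integral_congr_ae (ae_of_all _ fun k => ?_)))
    · beta_reduce
      have h4 : g * (((k : Matrix (Fin n) (Fin n) ℂ) * g)⁻¹ * w * (k * g)) = (k : Matrix (Fin n) (Fin n) ℂ)⁻¹ * w * k * g := by
        rw [Matrix.mul_inv_rev]
        simp only [← mul_assoc]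
        rw [Fr.grp.mul_inv hg, one_mul]
      rw [h4, ← mulVec_mulVec, Matrix.mul_apply, Finset.sum_mul]
      exact Finset.sum_congr rfl fun l _ => by simp only [c]; ring
    · beta_reduce
      rw [Matrix.mul_apply, Finset.sum_mul]
      exact Finset.sum_congr rfl fun l _ => by simp only [c]; ring
  have hGm : ∀ m i j, ∑ l, eval v (P m i l) * g l j = ∑ l, g i l * eval v (P m l j) := by
    intro m i j
    have h1 : (fun x : Fin n × Fin n → ℂ => ∑ l, eval (Matrix.of (fun a b => x (a, b)) *ᵥ v) (P m i l) * x (l, j) -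
        ∑ l, x (i, l) * eval v (P m l j)) ∈ polyAlg (Fin n × Fin n) := by
      have hX : ∀ ij, (fun x : Fin n × Fin n → ℂ => x ij) ∈ polyAlg (Fin n × Fin n) :=
        fun ij => ⟨X ij, by ext; simp⟩
      have e1 : ∀ l, (fun x : Fin n × Fin n → ℂ => eval (Matrix.of (fun a b => x (a, b)) *ᵥ v) (P m i l)) ∈
          polyAlg (Fin n × Fin n) := fun l => by
        have := nice_apply (aeval v).toLinearMap (nice_affSub (𝒜 := polyAlg (Fin n × Fin n))
          (A := fun x => Matrix.of (fun a b => x (a, b))) (b := fun _ => 0) (fun a b => hX (a, b))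
          (fun _ => zero_mem _) (P m i l))
        convert this using 2 with x
        exact (eval_act _ _ _).symm
      refine sub_mem ?_ ?_
      · have := sum_mem (S := polyAlg (Fin n × Fin n)) (t := Finset.univ) fun l _ => mul_mem (e1 l) (hX (l, j))
        convert this using 1
        ext x; simp
      · have := sum_mem (S := polyAlg (Fin n × Fin n)) (t := Finset.univ) fun l _ =>
          mul_mem (hX (i, l)) (algebraMap_mem (polyAlg (Fin n × Fin n)) (eval v (P m l j)))
        convert this using 1
        ext x; simp
    obtain ⟨p, hp⟩ := h1
    have h2 := Fr.dense p (fun k hk =>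
      (congrFun hp (fun ij => k ij.1 ij.2)).symm.trans (sub_eq_zero.2 (hK m i j k hk))) g hg.1
    have h3 := sub_eq_zero.1 ((congrFun hp (fun ij => g ij.1 ij.2)).trans h2)
    change ∑ l, eval (g *ᵥ v) (P m i l) * g l j = _ at h3
    rw [hg.2] at h3
    exact h3
  have hlim : ∀ i l, Tendsto (fun m => (lapZ μ (fun k : Fr.K => Fr.wt k) m)⁻¹ * eval v (P m i l)) atTop (𝓝 (w i l)) := by
    intro i l
    refine (Fr.tendsto_const hG hμ (hcc i l) (c := w i l) fun k hk => ?_).congr fun m => ?_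
    · have h1 := hw k k.2 (Fr.rho_eq_zero.1 hk)
      simp only [c]
      rw [mul_assoc, h1, ← mul_assoc, Fr.grp.inv_mul k.2, one_mul]
    · rw [hPe]
      congr 1
      refine integral_congr_ae (ae_of_all _ fun k => ?_)
      beta_reduce
      rw [Fr.eval_wtPoly, Frame.wt]
  ext i j
  rw [Matrix.mul_apply, Matrix.mul_apply]
  refine tendsto_nhds_unique (tendsto_finsetSum _ fun l _ => (hlim i l).mul_const (g l j))
    ((tendsto_finsetSum Finset.univ fun l _ => (hlim l j).const_mul (g i l)).congr fun m => ?_)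
  have h1 := congrArg (fun z => (lapZ μ (fun k : Fr.K => Fr.wt k) m)⁻¹ * z) (hGm m i j)
  beta_reduce at h1
  rw [Finset.mul_sum, Finset.mul_sum] at h1
  rw [Finset.sum_congr rfl fun l _ => show (lapZ μ (fun k : Fr.K => Fr.wt k) m)⁻¹ * eval v (P m i l) * g l j =
    (lapZ μ (fun k : Fr.K => Fr.wt k) m)⁻¹ * (eval v (P m i l) * g l j) from mul_assoc _ _ _, h1]
  exact Finset.sum_congr rfl fun l _ => by ring

theorem Frame.exists_sliceComplement (hG : IsReductiveGroup ℂ n G) (Fr : Frame G v) :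
    ∃ N, IsSliceComplement ℂ n G v N := by
  let T := orbitTangent ℂ n G v
  let N : Submodule ℂ (Fin n → ℂ) := (Submodule.map Fr.S T)ᗮ.comap Fr.S
  have hN : ∀ x, x ∈ N ↔ ∀ y ∈ T, inner ℂ (Fr.S y) (Fr.S x) = 0 := fun x => by
    simp only [N, Submodule.mem_comap, Submodule.mem_orthogonal, Submodule.mem_map]
    exact ⟨fun h y hy => h _ ⟨y, hy, rfl⟩, fun h u ⟨y, hy, e⟩ => e ▸ h y hy⟩
  have hc : IsCompl T N := by
    refine ⟨Submodule.disjoint_def.2 fun x hx hx' => ?_, codisjoint_iff.2 (eq_top_iff.2 fun x _ => ?_)⟩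
    · have := inner_self_eq_zero.1 ((hN x).1 hx' x hx)
      exact (map_eq_zero_iff _ Fr.inj).1 this
    · obtain ⟨a, ⟨t, ht, rfl⟩, b, hb, e⟩ := Submodule.mem_sup.1
        ((Submodule.sup_orthogonal_of_hasOrthogonalProjection (K := Submodule.map Fr.S T)) ▸ Submodule.mem_top :
          Fr.S x ∈ Submodule.map Fr.S T ⊔ (Submodule.map Fr.S T)ᗮ)
      refine Submodule.mem_sup.2 ⟨t, ht, x - t, ?_, by abel⟩
      rw [Submodule.mem_comap, map_sub, ← e, add_sub_cancel_left]
      exact hb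
  obtain ⟨pr, h1, h2, -, -, h5⟩ := exists_proj_of_isCompl hc.symm
  refine ⟨N, hc, fun g hg x hx => ?_⟩
  have hcomm := Fr.commute_of_commute hG (w := LinearMap.toMatrix' pr) (fun h hh hv => ?_) hg
  · have h6 : pr (g *ᵥ x) = g *ᵥ pr x := by
      rw [← LinearMap.toMatrix'_mulVec, ← LinearMap.toMatrix'_mulVec pr x, mulVec_mulVec, hcomm, mulVec_mulVec]
    rw [h1 x hx] at h6
    rw [← h6]; exact h2 _
  · have h7 := h5 h (fun x => mulVec_mem_orbitTangent hG.1 (Fr.mem_isotropy hh hv)) fun x hx => by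
      rw [hN] at hx ⊢
      intro y hy
      have hh' := (Fr.grp.2.2 h hh).2
      have h8 : h⁻¹ *ᵥ v = v := by
        conv_lhs => rw [← hv]
        rw [mulVec_mulVec, Fr.grp.inv_mul hh, one_mulVec]
      have h9 := hx _ (mulVec_mem_orbitTangent hG.1 (Fr.mem_isotropy hh' h8) hy)
      have h10 := Fr.inner_mulVec hh (h⁻¹ *ᵥ y) x
      rw [mulVec_mulVec, Fr.grp.mul_inv hh, one_mulVec, h9] at h10
      exact h10
    apply Matrix.toLin'.injective
    refine LinearMap.ext fun x => ?_
    rw [Matrix.toLin'_apply, Matrix.toLin'_apply, ← mulVec_mulVec, ← mulVec_mulVec,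
      LinearMap.toMatrix'_mulVec, LinearMap.toMatrix'_mulVec, h7]

end SliceExists

section Order
open NormedSpace Filter Topology Matrix

attribute [local instance] Matrix.linftyOpNormedRing Matrix.linftyOpNormedAlgebra

variable {n : ℕ} {G : Set (Matrix (Fin n) (Fin n) ℂ)} {v : Fin n → ℂ}

theorem exists_curve (hG : IsMatSubgroup ℂ n G) {t : Fin n → ℂ} (ht : t ∈ orbitTangent ℂ n G v) :
    ∃ γ : ℂ → Matrix (Fin n) (Fin n) ℂ, (∀ z, γ z ∈ G) ∧ γ 0 = 1 ∧ Differentiable ℂ γ ∧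
      ∃ B, HasDerivAt γ B 0 ∧ B *ᵥ v = t := by
  induction ht using Submodule.span_induction with
  | mem t ht =>
    obtain ⟨A, hA, rfl⟩ := ht
    have h1 := fun z => hasDerivAt_exp_smul_const A (z : ℂ)
    refine ⟨fun z => exp (z • A), fun z => ?_, ?_, fun z => (h1 z).differentiableAt, _, h1 0, ?_⟩
    · have := hA z
      rw [mexp_eq_exp] at this
      exact this
    · beta_reduce
      rw [zero_smul]; exact NormedSpace.exp_zero
    · rw [zero_smul]
      exact congrArg (fun M => M *ᵥ v) ((congrArg (fun M => M * A) NormedSpace.exp_zero).trans (one_mul A))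
  | zero => exact ⟨fun _ => 1, fun _ => hG.1, rfl, differentiable_const _, 0, hasDerivAt_const _ _, zero_mulVec _⟩
  | add s t _ _ h1 h2 =>
    obtain ⟨α, a1, a2, a3, A, a5, a4⟩ := h1
    obtain ⟨β, b1, b2, b3, B, b5, b4⟩ := h2
    refine ⟨fun z => α z * β z, fun z => hG.2.1 _ (a1 z) _ (b1 z), by beta_reduce; rw [a2, b2, mul_one],
      a3.mul b3, _, a5.mul b5, ?_⟩
    rw [a2, b2, mul_one, one_mul, add_mulVec, a4, b4]
  | smul c t _ h1 =>
    obtain ⟨α, a1, a2, a3, A, a5, a4⟩ := h1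
    have h4 : HasDerivAt (fun z : ℂ => c * z) c 0 := by simpa using (hasDerivAt_id (0 : ℂ)).const_mul c
    have h5 : HasDerivAt α A (c * 0) := by rw [mul_zero]; exact a5
    exact ⟨fun z => α (c * z), fun z => a1 _, by beta_reduce; rw [mul_zero, a2], a3.comp (differentiable_id.const_mul c),
      _, h5.scomp 0 h4, by rw [smul_mulVec, a4]⟩

theorem tendsto_leading {c : ℕ → ℂ → ℂ} {c₀ : ℕ → ℂ} {m D : ℕ} (hm : m ≤ D)
    (h : ∀ j, Tendsto (c j) (𝓝[≠] 0) (𝓝 (c₀ j))) (h0 : ∀ j < m, ∀ z, c j z = 0) :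
    Tendsto (fun z => (∑ j ∈ Finset.range (D + 1), z ^ j * c j z) * (z ^ m)⁻¹) (𝓝[≠] 0) (𝓝 (c₀ m)) := by
  have hid : Tendsto (fun z : ℂ => z) (𝓝[≠] 0) (𝓝 0) := tendsto_id.mono_left nhdsWithin_le_nhds
  have h1 : Tendsto (fun z => ∑ j ∈ Finset.range (D + 1), if j < m then 0 else z ^ (j - m) * c j z) (𝓝[≠] 0)
      (𝓝 (∑ j ∈ Finset.range (D + 1), if j = m then c₀ m else 0)) := by
    refine tendsto_finsetSum _ fun j _ => ?_
    rcases lt_trichotomy j m with hj | rfl | hj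
    · simp only [hj, if_true, hj.ne, if_false]; exact tendsto_const_nhds
    · simpa using h j
    · have h2 := (hid.pow (j - m)).mul (h j)
      rw [zero_pow (Nat.sub_pos_of_lt hj).ne', zero_mul] at h2
      simpa only [hj.not_gt, if_false, hj.ne'] using h2
  rw [Finset.sum_ite_eq' , if_pos (Finset.mem_range.2 (Nat.lt_succ_iff.2 hm))] at h1
  refine h1.congr' ?_
  filter_upwards [self_mem_nhdsWithin] with z hz
  rw [Finset.sum_mul]
  refine Finset.sum_congr rfl fun j _ => ?_
  split_ifs with hj
  · rw [h0 j hj]; simp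
  · have hz' : z ≠ 0 := hz
    rw [← Nat.sub_add_cancel (not_lt.1 hj), pow_add, Nat.add_sub_cancel]
    field_simp

theorem eval_smul_eq_sum_jet {D : ℕ} (z : ℂ) (ξ : Fin n → ℂ) {P : MvPolynomial (Fin n) ℂ}
    (h : P.totalDegree ≤ D) : eval (z • ξ) P = ∑ j ∈ Finset.range (D + 1), z ^ j * jet j ξ P := by
  rw [eval_eq_sum_jet _ h]
  exact Finset.sum_congr rfl fun j _ => jet_smul j z ξ P

theorem totalDegree_shift_act_le (g : Matrix (Fin n) (Fin n) ℂ) (P : MvPolynomial (Fin n) ℂ) :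
    (shift v (act g P)).totalDegree ≤ P.totalDegree :=
  (totalDegree_affSub_le _ _ _).trans (totalDegree_affSub_le _ _ _)

/-- Vanishing order along the slices of all translates controls the vanishing order at the point. -/
theorem jet_eq_zero_of_slice (hG : IsMatSubgroup ℂ n G) {N : Submodule ℂ (Fin n → ℂ)}
    (hN : orbitTangent ℂ n G v ⊔ N = ⊤) {k : ℕ} {f : MvPolynomial (Fin n) ℂ}
    (hf : ∀ g ∈ G, ∀ x ∈ N, ∀ j < k, jet j x (shift v (act g f)) = 0) :
    ∀ j < k, ∀ y, jet j y (shift v f) = 0 := by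
  intro m
  induction m using Nat.strong_induction_on with
  | _ m ih =>
  intro hm y
  obtain ⟨t, ht, x, hx, rfl⟩ := Submodule.mem_sup.1 (hN ▸ Submodule.mem_top : y ∈ orbitTangent ℂ n G v ⊔ N)
  obtain ⟨γ, γG, γ0, γd, B, γB, γt⟩ := exists_curve hG ht
  have hγ : Continuous γ := γd.continuous
  let D := max f.totalDegree m
  have hD : f.totalDegree ≤ D := le_max_left _ _
  let w : ℂ → Fin n → ℂ := fun z => z⁻¹ • (γ z *ᵥ v - v) + γ z *ᵥ x
  have hw : Tendsto w (𝓝[≠] 0) (𝓝 (t + x)) := by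
    refine Tendsto.add ?_ ?_
    · have h1 := hasDerivAt_iff_tendsto_slope_zero.1 γB
      have h2 : Continuous fun A : Matrix (Fin n) (Fin n) ℂ => A *ᵥ v := by fun_prop
      have h3 := (h2.tendsto _).comp h1
      rw [γt] at h3
      refine h3.congr fun z => ?_
      simp only [Function.comp, zero_add, γ0, smul_mulVec, sub_mulVec, one_mulVec]
    · have h2 : Continuous fun z => γ z *ᵥ x := by fun_prop
      have h3 := h2.tendsto 0
      rw [γ0, one_mulVec] at h3
      exact h3.mono_left nhdsWithin_le_nhds
  have e1 : ∀ z, eval (γ z *ᵥ (v + z • x)) f =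
      ∑ j ∈ Finset.range (D + 1), z ^ j * jet j x (shift v (act (γ z) f)) := fun z => by
    rw [← eval_smul_eq_sum_jet z x ((totalDegree_shift_act_le _ _).trans hD), eval_shift, eval_act]
  have e2 : ∀ z ≠ 0, eval (γ z *ᵥ (v + z • x)) f =
      ∑ j ∈ Finset.range (D + 1), z ^ j * jet j (w z) (shift v f) := fun z hz => by
    rw [← eval_smul_eq_sum_jet z (w z) ((totalDegree_affSub_le _ _ _).trans hD), eval_shift]
    congr 2
    simp only [w, smul_add, smul_smul, mul_inv_cancel₀ hz, one_smul, mulVec_add, mulVec_smul]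
    abel
  have l1 := tendsto_leading (c := fun j z => jet j x (shift v (act (γ z) f)))
    (c₀ := fun j => jet j x (shift v (act (γ 0) f))) (m := m) (D := D) (le_max_right _ _) (fun j => by
      have h1 : Continuous fun z => jet j x (shift v (act (γ z) f)) :=
        nice_apply (jet j x ∘ₗ (shift v).toLinearMap) (nice_affSub (𝒜 := contAlg ℂ) (A := γ) (b := fun _ => 0)
          (fun i j => hγ.matrix_elem i j) (fun _ => continuous_const) f)
      exact (h1.tendsto 0).mono_left nhdsWithin_le_nhds) fun j hj z => hf _ (γG z) x hx j (hj.trans hm)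
  have l2 := tendsto_leading (c := fun j z => jet j (w z) (shift v f))
    (c₀ := fun j => jet j (t + x) (shift v f)) (m := m) (D := D) (le_max_right _ _) (fun j => by
      have h1 : Continuous fun y => jet j y (shift v f) := by
        simp only [jet_apply]; exact continuous_eval_poly _
      exact (h1.tendsto _).comp hw) fun j hj z => ih j hj (hj.trans hm) _
  have l3 := tendsto_nhds_unique l2 (l1.congr' (by
    filter_upwards [self_mem_nhdsWithin] with z hz
    rw [← e1, e2 z hz]))
  rw [l3]
  exact hf _ (γG 0) x hx m hm

theorem mem_ker_eval_pow {k : ℕ} {f : MvPolynomial (Fin n) ℂ}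
    (h : ∀ j < k, ∀ y, jet j y (shift v f) = 0) : f ∈ RingHom.ker (eval v) ^ k := by
  have h1 : shift v f ∈ idealOfVars (Fin n) ℂ ^ k := by
    rw [mem_pow_idealOfVars_iff']
    intro α hα
    have h2 : homogeneousComponent α.degree (shift v f) = 0 :=
      poly_ext fun y => by rw [← jet_apply, h _ hα, map_zero]
    have h3 := coeff_homogeneousComponent α.degree (shift v f) α
    rw [if_pos rfl, h2] at h3
    rw [← h3]; simp
  have h2 := Ideal.mem_map_of_mem (shift (-v)) h1
  have h3 : shift (-v) (shift v f) = f := poly_ext fun x => by rw [eval_shift, eval_shift]; congr 2; abel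
  rw [h3, Ideal.map_pow] at h2
  refine Ideal.pow_right_mono ?_ k h2
  rw [Ideal.map_le_iff_le_comap, idealOfVars, Ideal.span_le]
  rintro _ ⟨i, rfl⟩
  change eval v (shift (-v) (X i)) = 0
  rw [eval_shift]; simp

end Order

section Slice
open MeasureTheory Filter Topology Matrix

variable {n : ℕ} {G : Set (Matrix (Fin n) (Fin n) ℂ)} {v : Fin n → ℂ}

/-- The ideal generated by the invariant functions vanishing on the null cone of a slice together with
the vanishing ideal of the slice. -/
def sliceIdeal (H : Set (Matrix (Fin n) (Fin n) ℂ)) (N : Submodule ℂ (Fin n → ℂ)) :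
    Ideal (MvPolynomial (Fin n) ℂ) :=
  Ideal.span ({p | InvariantOn ℂ n H N p ∧ ∀ x ∈ sliceNullCone ℂ n H N, eval x p = 0} ∪
      {p | ∀ x ∈ (N : Set (Fin n → ℂ)), eval x p = 0})

theorem mem_sliceIdeal_of_vanish {H : Set (Matrix (Fin n) (Fin n) ℂ)} {N : Submodule ℂ (Fin n → ℂ)}
    {p : MvPolynomial (Fin n) ℂ} (h : ∀ x ∈ N, eval x p = 0) : p ∈ sliceIdeal H N :=
  Ideal.subset_span (Or.inr h)

theorem exists_linear_section {E F : Type*} [AddCommGroup E] [Module ℂ E] [AddCommGroup F] [Module ℂ F]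
    (L : E →ₗ[ℂ] F) : ∃ τ : F →ₗ[ℂ] E, ∀ w ∈ LinearMap.range L, L (τ w) = w := by
  obtain ⟨s, hs⟩ := L.rangeRestrict.exists_rightInverse_of_surjective L.range_rangeRestrict
  obtain ⟨τ, hτ⟩ := s.exists_extend
  refine ⟨τ, fun w hw => ?_⟩
  have h1 := LinearMap.congr_fun hτ ⟨w, hw⟩
  have h2 := LinearMap.congr_fun hs ⟨w, hw⟩
  have h3 : τ w = s ⟨w, hw⟩ := h1
  rw [h3]
  exact congrArg Subtype.val h2

theorem exists_sliceIdeal_section (H : Set (Matrix (Fin n) (Fin n) ℂ)) (N : Submodule ℂ (Fin n → ℂ)) :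
    ∃ s : Finset (MvPolynomial (Fin n) ℂ),
      (∀ q ∈ s, InvariantOn ℂ n H N q ∧ ∀ x ∈ sliceNullCone ℂ n H N, eval x q = 0) ∧
      ∃ σ : MvPolynomial (Fin n) ℂ → MvPolynomial (Fin n) ℂ →ₗ[ℂ] MvPolynomial (Fin n) ℂ,
        ∀ Q ∈ sliceIdeal H N, ∀ x ∈ N, eval x Q = ∑ q ∈ s, eval x q * eval x (σ q Q) := by
  classical
  obtain ⟨s, hs, hs'⟩ := Submodule.fg_span_iff_fg_span_finset_subset
    {p | InvariantOn ℂ n H N p ∧ ∀ x ∈ sliceNullCone ℂ n H N, eval x p = 0} |>.1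
    (IsNoetherian.noetherian (R := MvPolynomial (Fin n) ℂ) _)
  let L : (MvPolynomial (Fin n) ℂ → MvPolynomial (Fin n) ℂ) →ₗ[ℂ] (N → ℂ) :=
    evalOn (fun x : N => (x : Fin n → ℂ)) ∘ₗ
      ∑ q ∈ s, LinearMap.mulLeft ℂ q ∘ₗ LinearMap.proj q
  have hL : ∀ b x, L b x = ∑ q ∈ s, eval (x : Fin n → ℂ) q * eval (x : Fin n → ℂ) (b q) := fun b x => by
    simp [L]
  obtain ⟨τ, hτ⟩ := exists_linear_section L
  refine ⟨s, fun q hq => hs hq, fun q => LinearMap.proj q ∘ₗ τ ∘ₗ evalOn (fun x : N => (x : Fin n → ℂ)),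
    fun Q hQ x hx => ?_⟩
  have h1 : evalOn (fun x : N => (x : Fin n → ℂ)) Q ∈ LinearMap.range L := by
    rw [sliceIdeal, Ideal.span_union] at hQ
    obtain ⟨a, ha, b, hb, rfl⟩ := Submodule.mem_sup.1 hQ
    have hb' : ∀ x ∈ N, eval x b = 0 := (Ideal.span_le (I := vanishingIdeal ℂ n (N : Set (Fin n → ℂ)))).2
      (fun p hp => hp) hb
    have ha' : a ∈ Submodule.span (MvPolynomial (Fin n) ℂ) (s : Set (MvPolynomial (Fin n) ℂ)) := hs' ▸ ha
    obtain ⟨f, -, hf⟩ := Submodule.mem_span_finset.1 ha'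
    refine ⟨f, ?_⟩
    ext x
    rw [hL, evalOn_apply, map_add, hb' x x.2, add_zero, ← hf, map_sum]
    exact Finset.sum_congr rfl fun q _ => by rw [smul_eq_mul, map_mul, mul_comm]
  have h2 := congrFun (hτ _ h1) ⟨x, hx⟩
  rw [hL, evalOn_apply] at h2
  exact h2.symm

/-- The stabilizer of the base point in the compact form. -/
def Frame.stab (Fr : Frame G v) : Set (Matrix (Fin n) (Fin n) ℂ) := {h | h ∈ Fr.K ∧ h *ᵥ v = v}

theorem Frame.stab_isCompact (Fr : Frame G v) : IsCompact Fr.stab := by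
  have h1 : IsClosed {h : Matrix (Fin n) (Fin n) ℂ | h *ᵥ v = v} :=
    isClosed_eq (by fun_prop) continuous_const
  exact Fr.cpt.inter_right h1

theorem IsMatSubgroup.inv_mulVec {K : Set (Matrix (Fin n) (Fin n) ℂ)} (hK : IsMatSubgroup ℂ n K)
    {h : Matrix (Fin n) (Fin n) ℂ} (hh : h ∈ K) (hv : h *ᵥ v = v) : h⁻¹ *ᵥ v = v := by
  conv_lhs => rw [← hv]
  rw [mulVec_mulVec, hK.inv_mul hh, one_mulVec]

theorem Frame.stab_isMatSubgroup (Fr : Frame G v) : IsMatSubgroup ℂ n Fr.stab :=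
  ⟨⟨Fr.grp.1, one_mulVec _⟩, fun a ha b hb => ⟨Fr.grp.2.1 _ ha.1 _ hb.1, by
    rw [← mulVec_mulVec, hb.2, ha.2]⟩, fun a ha => ⟨(Fr.grp.2.2 a ha.1).1, (Fr.grp.2.2 a ha.1).2,
      Fr.grp.inv_mulVec ha.1 ha.2⟩⟩

theorem Frame.exists_isotropy_mean (Fr : Frame G v) : ∃ μ : Measure Fr.stab, IsProbabilityMeasure μ ∧
    ∀ T : MvPolynomial (Fin n) ℂ →ₗ[ℂ] MvPolynomial (Fin n) ℂ,
      ∃ Θ : MvPolynomial (Fin n) ℂ →ₗ[ℂ] MvPolynomial (Fin n) ℂ,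
        (∀ k ∈ Fr.stab, ∀ P, Θ (act k P) = act k (Θ P)) ∧
        (∀ P (l : MvPolynomial (Fin n) ℂ →ₗ[ℂ] ℂ), l (Θ P) =
          ∫ k : Fr.stab, l (act (k : Matrix (Fin n) (Fin n) ℂ)
            (T (act (k : Matrix (Fin n) (Fin n) ℂ)⁻¹ P))) ∂μ) ∧
        ∀ P (W : Submodule ℂ (MvPolynomial (Fin n) ℂ)),
          (∀ k ∈ Fr.stab, act k (T (act k⁻¹ P)) ∈ W) → Θ P ∈ W := by
  obtain ⟨μ, h1, -, h3, -⟩ := exists_mean Fr.stab_isCompact Fr.stab_isMatSubgroup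
  exact ⟨μ, h1, exists_average Fr.stab_isCompact Fr.stab_isMatSubgroup h1 h3⟩

/-- The polynomials all of whose translates restrict into the slice ideal. -/
def sliceCore (G : Set (Matrix (Fin n) (Fin n) ℂ)) (v : Fin n → ℂ) (N : Submodule ℂ (Fin n → ℂ)) :
    Ideal (MvPolynomial (Fin n) ℂ) where
  carrier := {P | ∀ g ∈ G, shift v (act g P) ∈ sliceIdeal (isotropy ℂ n G v) N}
  zero_mem' := fun g _ => by simp
  add_mem' := fun ha hb g hg => by simpa using add_mem (ha g hg) (hb g hg)
  smul_mem' := fun c a ha g hg => by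
    simpa using Ideal.mul_mem_left _ (shift v (act g c)) (ha g hg)

theorem act_mem_sliceCore (hG : IsMatSubgroup ℂ n G) {N : Submodule ℂ (Fin n → ℂ)}
    {P : MvPolynomial (Fin n) ℂ} (hP : P ∈ sliceCore G v N) {g : Matrix (Fin n) (Fin n) ℂ} (hg : g ∈ G) :
    act g P ∈ sliceCore G v N := fun h hh => by
  rw [act_act]; exact hP _ (hG.2.1 _ hg _ hh)

theorem zero_mem_sliceNullCone (H : Set (Matrix (Fin n) (Fin n) ℂ)) (N : Submodule ℂ (Fin n → ℂ)) :
    (0 : Fin n → ℂ) ∈ sliceNullCone ℂ n H N := ⟨zero_mem _, fun _ _ => rfl⟩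

theorem jet_eq_of_eval_eq {N : Submodule ℂ (Fin n → ℂ)} {P Q : MvPolynomial (Fin n) ℂ}
    (h : ∀ x ∈ N, eval x P = eval x Q) {x : Fin n → ℂ} (hx : x ∈ N) (j : ℕ) : jet j x P = jet j x Q :=
  jet_congr (fun z => h _ (N.smul_mem z hx)) j

theorem invariant_mem_invariantIdeal {p : MvPolynomial (Fin n) ℂ} (hp : Invariant ℂ n G p)
    (h : eval v p = 0) : p ∈ invariantIdeal ℂ n G (piFiber ℂ n G v) :=
  Ideal.subset_span ⟨hp, fun u hu => (hu p hp).trans h⟩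

theorem Frame.mem_sup_pow (hG : IsReductiveGroup ℂ n G) (Fr : Frame G v)
    {N : Submodule ℂ (Fin n → ℂ)} (hs : IsSliceComplement ℂ n G v N) {P : MvPolynomial (Fin n) ℂ}
    (hP : P ∈ sliceCore G v N) (k : ℕ) :
    P ∈ invariantIdeal ℂ n G (piFiber ℂ n G v) ⊔ RingHom.ker (eval v) ^ (k + 1) := by
  obtain ⟨s, hs1, σ, hσ⟩ := exists_sliceIdeal_section (isotropy ℂ n G v) N
  obtain ⟨μ, hμ, hav⟩ := Fr.exists_isotropy_mean
  choose a ha1 ha2 _ using fun q => hav (σ q ∘ₗ (shift v).toLinearMap)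
  have hN : ∀ k ∈ Fr.stab, k ∈ isotropy ℂ n G v := fun k hk => ⟨Fr.sub hk.1, hk.2⟩
  have key : ∀ Q ∈ sliceCore G v N, ∀ x ∈ N, eval x (shift v Q) = eval x (∑ q ∈ s, q * a q Q) := by
    intro Q hQ x hx
    have h1 : ∀ q, eval x (a q Q) = ∫ k : Fr.stab, eval ((k : Matrix (Fin n) (Fin n) ℂ) *ᵥ x)
        (σ q (shift v (act (k : Matrix (Fin n) (Fin n) ℂ)⁻¹ Q))) ∂μ := fun q => by
      refine (ha2 q Q (aeval x).toLinearMap).trans (integral_congr_ae (ae_of_all _ fun k => ?_))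
      exact eval_act _ _ _
    have h2 : ∀ q, Integrable (fun k : Fr.stab => eval ((k : Matrix (Fin n) (Fin n) ℂ) *ᵥ x)
        (σ q (shift v (act (k : Matrix (Fin n) (Fin n) ℂ)⁻¹ Q)))) μ := fun q => by
      refine continuous_integrable_of_compact Fr.stab_isCompact μ ?_
      have := nice_apply (aeval x).toLinearMap
        (nice_conj Fr.stab_isMatSubgroup (σ q ∘ₗ (shift v).toLinearMap) Q)
      refine Continuous.congr this fun k => ?_
      exact eval_act _ _ _
    rw [map_sum]
    simp only [map_mul, h1]
    simp only [← integral_const_mul]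
    rw [← integral_finsetSum _ fun q _ => (h2 q).const_mul _]
    have h3 : ∀ k : Fr.stab, (∑ q ∈ s, eval x q * eval ((k : Matrix (Fin n) (Fin n) ℂ) *ᵥ x)
        (σ q (shift v (act (k : Matrix (Fin n) (Fin n) ℂ)⁻¹ Q)))) = eval x (shift v Q) := by
      intro k
      have hk := hN k k.2
      have h4 := hσ _ (hQ (k : Matrix (Fin n) (Fin n) ℂ)⁻¹ (hG.1.2.2 _ hk.1).2) _ (hs.2 k hk x hx)
      rw [Finset.sum_congr rfl fun q hq => by rw [← (hs1 q hq).1 k hk x hx], ← h4, eval_shift, eval_act,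
        eval_shift, mulVec_add, mulVec_mulVec, hG.1.inv_mul hk.1, one_mulVec, hG.1.inv_mulVec hk.1 hk.2]
    simp only [h3]
    simp
  have happ := fun q => Fr.approx hG hs (Φ := a q) (fun h hh hv P x _ => by
    rw [ha1 q h ⟨hh, hv⟩, eval_act]) (restrictTotalDegree (Fin n) ℂ P.totalDegree) (k + 1)
  choose Θ hΘ1 hΘ2 using happ
  have hinv : ∀ q : s, ∃ p, Invariant ℂ n G p ∧ ∀ x ∈ N, ∀ j < k + 1, jet j x (shift v p) = jet j x (q : MvPolynomial (Fin n) ℂ) :=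
    fun q => Fr.approx_invariant hG hs (fun h hh hv x hx => (hs1 q q.2).1 h ⟨Fr.sub hh, hv⟩ x hx) (k + 1)
  choose p hp1 hp2 using hinv
  let D : MvPolynomial (Fin n) ℂ → MvPolynomial (Fin n) ℂ := fun Q => ∑ q : s, p q * Θ q Q
  have hD : D P ∈ invariantIdeal ℂ n G (piFiber ℂ n G v) := by
    refine sum_mem fun q _ => Ideal.mul_mem_right _ _ (invariant_mem_invariantIdeal (hp1 q) ?_)
    have h1 := hp2 q 0 (zero_mem _) 0 (Nat.succ_pos k)
    rw [jet_zero, jet_zero, eval_shift, add_zero, (hs1 q q.2).2 0 (zero_mem_sliceNullCone _ _)] at h1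
    exact h1
  have hDg : ∀ g ∈ G, act g (D P) = D (act g P) := fun g hg => by
    simp only [D, map_sum, map_mul]
    exact Finset.sum_congr rfl fun q _ => by
      rw [invariant_iff_act.1 (hp1 q) g hg, mem_equivMaps.1 (hΘ1 q) g hg]
  refine Submodule.mem_sup.2 ⟨D P, hD, P - D P, mem_ker_eval_pow (jet_eq_zero_of_slice hG.1 hs.1.sup_eq_top
    fun g hg x hx j hj => ?_), by abel⟩
  have hU : act g P ∈ restrictTotalDegree (Fin n) ℂ P.totalDegree := by
    rw [mem_restrictTotalDegree]; exact totalDegree_affSub_le _ _ _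
  rw [map_sub, map_sub, map_sub, hDg g hg, jet_eq_of_eval_eq (key _ (act_mem_sliceCore hG.1 hP hg)) hx,
    ← Finset.sum_coe_sort s, map_sum]
  simp only [D, map_sum, ← Finset.sum_sub_distrib]
  refine Finset.sum_eq_zero fun q _ => ?_
  rw [map_mul (shift v), jet_mul, jet_mul, sub_eq_zero]
  refine Finset.sum_congr rfl fun i hi => ?_
  have hi' := Finset.HasAntidiagonal.mem_antidiagonal.1 hi
  rw [hp2 q x hx i.1 (by omega), hΘ2 q _ hU x hx i.2 (by omega)]

end Slice

section Core
open MeasureTheory Filter Topology Matrix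

variable {n : ℕ} {G : Set (Matrix (Fin n) (Fin n) ℂ)} {v : Fin n → ℂ}

/-- Krull's intersection theorem at a point of affine space. -/
theorem exists_mul_mem_of_mem_sup_pow (J : Ideal (MvPolynomial (Fin n) ℂ)) {P : MvPolynomial (Fin n) ℂ}
    (h : ∀ k : ℕ, P ∈ J ⊔ RingHom.ker (eval v) ^ k) : ∃ δ, eval v δ = 1 ∧ δ * P ∈ J := by
  have h1 : Submodule.mkQ J P ∈ (⨅ i : ℕ, RingHom.ker (eval v) ^ i • ⊤ :
      Submodule (MvPolynomial (Fin n) ℂ) (MvPolynomial (Fin n) ℂ ⧸ J)) := by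
    refine Submodule.mem_iInf _ |>.2 fun k => ?_
    obtain ⟨a, ha, b, hb, rfl⟩ := Submodule.mem_sup.1 (h k)
    have h2 : Submodule.mkQ J a = 0 := by rw [Submodule.mkQ_apply, Submodule.Quotient.mk_eq_zero]; exact ha
    have h3 : Submodule.mkQ J b = b • Submodule.mkQ J 1 := by
      rw [← map_smul, smul_eq_mul, mul_one]
    rw [map_add, h2, zero_add, h3]
    exact Submodule.smul_mem_smul hb trivial
  obtain ⟨⟨r, hr⟩, hr'⟩ := (Ideal.mem_iInf_smul_pow_eq_bot_iff _ _).1 h1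
  refine ⟨1 - r, ?_, ?_⟩
  · rw [map_sub, (RingHom.mem_ker).1 hr, map_one, sub_zero]
  · rw [← map_smul, ← sub_eq_zero, ← map_sub, Submodule.mkQ_apply, Submodule.Quotient.mk_eq_zero] at hr'
    have : (1 - r) * P = -(r • P - P) := by rw [smul_eq_mul]; ring
    rw [this]
    exact neg_mem hr'

theorem exists_mul_mem_of_fg {I J : Ideal (MvPolynomial (Fin n) ℂ)}
    (h : ∀ P ∈ I, ∃ δ, eval v δ = 1 ∧ δ * P ∈ J) : ∃ δ, eval v δ = 1 ∧ ∀ P ∈ I, δ * P ∈ J := by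
  classical
  obtain ⟨s, hs⟩ := (isNoetherianRing_iff_ideal_fg _).1 (inferInstance :
    IsNoetherianRing (MvPolynomial (Fin n) ℂ)) I
  have h' : ∀ P : s, ∃ δ, eval v δ = 1 ∧ δ * (P : MvPolynomial (Fin n) ℂ) ∈ J := fun P =>
    h P (hs ▸ Ideal.subset_span P.2)
  choose δ h1 h2 using h'
  refine ⟨∏ P, δ P, by simp [map_prod, h1], fun P hP => ?_⟩
  have : I ≤ J.colon {∏ P, δ P} := by
    rw [← hs, Ideal.span, Submodule.span_le]
    intro Q hQ
    refine Submodule.mem_colon_singleton.2 ?_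
    rw [← Finset.mul_prod_erase _ δ (Finset.mem_univ ⟨Q, hQ⟩), smul_eq_mul]
    have := Ideal.mul_mem_right (∏ P ∈ Finset.univ.erase ⟨Q, hQ⟩, δ P) J (h2 ⟨Q, hQ⟩)
    convert this using 1
    dsimp only
    ring
  have h3 := Submodule.mem_colon_singleton.1 (this hP)
  rwa [smul_eq_mul, mul_comm] at h3

theorem act_mem_invariantIdeal {F : Set (Fin n → ℂ)} {g : Matrix (Fin n) (Fin n) ℂ} (hg : g ∈ G)
    {P : MvPolynomial (Fin n) ℂ} (hP : P ∈ invariantIdeal ℂ n G F) :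
    act g P ∈ invariantIdeal ℂ n G F := by
  have : invariantIdeal ℂ n G F ≤ (invariantIdeal ℂ n G F).comap (act g) := by
    refine Ideal.span_le.2 fun p hp => ?_
    have h1 : act g p = p := invariant_iff_act.1 hp.1 g hg
    change act g p ∈ invariantIdeal ℂ n G F
    rw [h1]
    exact Ideal.subset_span hp
  exact this hP

/-- An ideal stable under `G`, containing the invariants vanishing at `v`, and with a member not vanishing
at `v`, is the whole ring when the orbit of `v` is closed. -/
theorem Frame.eq_top_of_stable (hG : IsReductiveGroup ℂ n G) (hv : HasClosedOrbit ℂ n G v)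
    (Fr : Frame G v) {I : Ideal (MvPolynomial (Fin n) ℂ)}
    (hJ : ∀ p, Invariant ℂ n G p → eval v p = 0 → p ∈ I)
    (hI : ∀ g ∈ G, ∀ P ∈ I, act g P ∈ I) {δ : MvPolynomial (Fin n) ℂ} (hδ : δ ∈ I) (h1 : eval v δ = 1) :
    I = ⊤ := by
  have htop : I ⊔ vanishingIdeal ℂ n (orbit ℂ n G v) = ⊤ := by
    rw [Ideal.eq_top_iff_one, ← Ideal.radical_eq_top.trans (Ideal.eq_top_iff_one _),
      ← vanishingIdeal_zeroLocus_eq_radical (K := ℂ), Ideal.eq_top_iff_one]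
    intro x hx
    exfalso
    have hx1 : x ∈ orbit ℂ n G v := hv fun p hp => by
      have := hx p (Submodule.mem_sup_right hp)
      rwa [aeval_eq_eval] at this
    obtain ⟨g, hg, rfl⟩ := hx1
    have h2 := hx (act g⁻¹ δ) (Submodule.mem_sup_left (hI _ (hG.1.2.2 g hg).2 _ hδ))
    rw [aeval_eq_eval] at h2
    change eval (g *ᵥ v) _ = 0 at h2
    rw [eval_act, mulVec_mulVec, hG.1.inv_mul hg, one_mulVec, h1] at h2
    exact one_ne_zero h2
  obtain ⟨a, ha, b, hb, hab⟩ := Submodule.mem_sup.1 ((Ideal.eq_top_iff_one _).1 htop)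
  obtain ⟨μ, hμ⟩ := Fr.exists_isMean
  have := hμ.prob
  let T : MvPolynomial (Fin n) ℂ →ₗ[ℂ] MvPolynomial (Fin n) ℂ :=
    (aeval (0 : Fin n → ℂ)).toLinearMap.smulRight a
  have hT : ∀ k : Matrix (Fin n) (Fin n) ℂ, act k (T (act k⁻¹ 1)) = act k a := fun k => by simp [T]
  obtain ⟨Θ, hΘ1, hΘ2, hΘ3⟩ := exists_average Fr.cpt Fr.grp hμ.prob hμ.right T
  have hinv : Invariant ℂ n G (Θ 1) := invariant_iff_act.2 fun g hg => by
    rw [← equivariant_of_dense Fr.dense hΘ1 g hg, map_one]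
  have hmem : Θ 1 ∈ I := hΘ3 1 (I.restrictScalars ℂ) fun k hk => by
    rw [hT]; exact hI k (Fr.sub hk) a ha
  have hval : eval v (Θ 1) = 1 := by
    refine (hΘ2 1 (aeval v).toLinearMap).trans ?_
    have h3 : ∀ k : Fr.K, (aeval v).toLinearMap (act (k : Matrix (Fin n) (Fin n) ℂ)
          (T (act (k : Matrix (Fin n) (Fin n) ℂ)⁻¹ 1))) = (1 : ℂ) := fun k => by
      rw [hT]
      change eval v (act _ a) = 1
      have h4 : eval ((k : Matrix (Fin n) (Fin n) ℂ) *ᵥ v) b = 0 := hb _ ⟨k, Fr.sub k.2, rfl⟩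
      rw [eval_act, ← add_zero (eval _ a), ← h4, ← map_add, hab, map_one]
    simp only [h3]
    simp
  refine (Ideal.eq_top_iff_one _).2 ?_
  have h5 : 1 - Θ 1 ∈ I := hJ _ (fun g hg x => by rw [map_sub, map_sub, hinv g hg x, map_one (eval _), map_one (eval _)])
    (by rw [map_sub, hval, map_one, sub_self])
  simpa using add_mem h5 hmem

theorem Frame.sliceCore_le (hG : IsReductiveGroup ℂ n G) (hv : HasClosedOrbit ℂ n G v) (Fr : Frame G v)
    {N : Submodule ℂ (Fin n → ℂ)} (hs : IsSliceComplement ℂ n G v N) :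
    sliceCore G v N ≤ invariantIdeal ℂ n G (piFiber ℂ n G v) := by
  obtain ⟨δ, h1, h2⟩ := exists_mul_mem_of_fg (v := v) (I := sliceCore G v N)
    (J := invariantIdeal ℂ n G (piFiber ℂ n G v)) fun P hP =>
      exists_mul_mem_of_mem_sup_pow _ fun k => by
        have h3 : RingHom.ker (eval v) ^ (k + 1) ≤ RingHom.ker (eval v) ^ k :=
          Ideal.pow_le_pow_right k.le_succ
        exact sup_le_sup_left h3 (invariantIdeal ℂ n G (piFiber ℂ n G v)) (Fr.mem_sup_pow hG hs hP k)
  let I : Ideal (MvPolynomial (Fin n) ℂ) :=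
    (invariantIdeal ℂ n G (piFiber ℂ n G v)).colon (sliceCore G v N : Set (MvPolynomial (Fin n) ℂ))
  have hI : ∀ Q, Q ∈ I ↔ ∀ P ∈ sliceCore G v N, Q * P ∈ invariantIdeal ℂ n G (piFiber ℂ n G v) :=
    fun Q => Submodule.mem_colon
  have htop : I = ⊤ := by
    refine Fr.eq_top_of_stable hG hv (fun p hp h => (hI p).2 fun P _ => Ideal.mul_mem_right _ _
      (invariant_mem_invariantIdeal hp h)) (fun g hg Q hQ => (hI _).2 fun P hP => ?_) ((hI δ).2 h2) h1
    have h3 := act_mem_invariantIdeal hg ((hI Q).1 hQ _ (act_mem_sliceCore hG.1 hP (hG.1.2.2 g hg).2))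
    rwa [map_mul, act_act_inv hG.1 hg] at h3
  intro P hP
  simpa using (hI 1).1 ((Ideal.eq_top_iff_one _).1 htop) P hP

/-- Points of the null cone of the slice lie over the base point. -/
theorem add_mem_piFiber {N : Submodule ℂ (Fin n → ℂ)} {x : Fin n → ℂ}
    (hx : x ∈ sliceNullCone ℂ n (isotropy ℂ n G v) N) : v + x ∈ piFiber ℂ n G v := by
  intro p hp
  have := hx.2 (shift v p) fun h hh y _ => by
    rw [eval_shift, eval_shift, ← hp h hh.1 (v + y), mulVec_add, hh.2]
  rwa [eval_shift, eval_shift, add_zero] at this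

theorem invariantOn_shift {N : Submodule ℂ (Fin n → ℂ)} {p : MvPolynomial (Fin n) ℂ}
    (hp : Invariant ℂ n G p) : InvariantOn ℂ n (isotropy ℂ n G v) N (shift v p) := fun h hh y _ => by
  rw [eval_shift, eval_shift, ← hp h hh.1 (v + y), mulVec_add, hh.2]

theorem Frame.isGReduced_of_coreducedOn (hG : IsReductiveGroup ℂ n G) (hv : HasClosedOrbit ℂ n G v)
    (Fr : Frame G v) {N : Submodule ℂ (Fin n → ℂ)} (hs : IsSliceComplement ℂ n G v N)
    (hc : CoreducedOn ℂ n (isotropy ℂ n G v) N) : IsGReduced ℂ n G (piFiber ℂ n G v) := by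
  refine le_antisymm (Ideal.span_le.2 fun p hp => hp.2) fun P hP => Fr.sliceCore_le hG hv hs fun g hg => ?_
  have hc' : vanishingIdeal ℂ n (sliceNullCone ℂ n (isotropy ℂ n G v) N) =
    sliceIdeal (isotropy ℂ n G v) N := hc
  rw [← hc']
  intro x hx
  rw [eval_shift, eval_act]
  exact hP _ fun p hp => (hp g hg _).trans (add_mem_piFiber hx p hp)

end Core

section Order
open MeasureTheory Filter Topology Matrix

variable {n : ℕ} {G : Set (Matrix (Fin n) (Fin n) ℂ)} {v : Fin n → ℂ}

theorem mem_ker_eval_zero_pow {k : ℕ} {f : MvPolynomial (Fin n) ℂ} (h : ∀ j < k, ∀ y, jet j y f = 0) :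
    f ∈ RingHom.ker (eval (0 : Fin n → ℂ)) ^ k :=
  mem_ker_eval_pow fun j hj y => by
    rw [← h j hj y]
    exact jet_congr (fun z => by rw [eval_shift, zero_add]) j

/-- A polynomial with small order of vanishing replaced on a slice by one lying in a power of the
maximal ideal. -/
theorem exists_sub_mem_vanishingIdeal (hG : IsMatSubgroup ℂ n G) {N : Submodule ℂ (Fin n → ℂ)}
    (hs : IsSliceComplement ℂ n G v N) {k : ℕ} {Q : MvPolynomial (Fin n) ℂ}
    (h : ∀ x ∈ N, ∀ j < k, jet j x Q = 0) :
    ∃ Q' ∈ RingHom.ker (eval (0 : Fin n → ℂ)) ^ k, Q - Q' ∈ vanishingIdeal ℂ n (N : Set (Fin n → ℂ)) := by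
  obtain ⟨pr, h1, h2, -, -, -⟩ := hs.exists_proj hG
  have h3 : ∀ x, LinearMap.toMatrix' pr *ᵥ x = pr x := fun x => by
    rw [← Matrix.toLin'_apply, Matrix.toLin'_toMatrix']
  refine ⟨act (LinearMap.toMatrix' pr) Q, mem_ker_eval_zero_pow fun j hj y => ?_, fun x hx => ?_⟩
  · refine Eq.trans (jet_affSub _ _ _ _) ?_
    rw [h3]
    exact h _ (h2 y) j hj
  · rw [map_sub, eval_act, h3, h1 x hx, sub_self]

theorem Frame.exists_invariant_average (hG : IsReductiveGroup ℂ n G) (Fr : Frame G v)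
    {N : Submodule ℂ (Fin n → ℂ)} (hs : IsSliceComplement ℂ n G v N) :
    ∃ μ : Measure Fr.stab, IsProbabilityMeasure μ ∧ ∀ f : MvPolynomial (Fin n) ℂ,
      eval 0 f = 0 → ∃ q ∈ sliceIdeal (isotropy ℂ n G v) N,
        ∀ x, eval x q = ∫ k : Fr.stab, eval ((k : Matrix (Fin n) (Fin n) ℂ) *ᵥ x) f ∂μ := by
  obtain ⟨μ, hμ, hav⟩ := Fr.exists_isotropy_mean
  refine ⟨μ, hμ, fun f hf => ?_⟩
  let T : MvPolynomial (Fin n) ℂ →ₗ[ℂ] MvPolynomial (Fin n) ℂ :=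
    (aeval (0 : Fin n → ℂ)).toLinearMap.smulRight f
  have hT : ∀ k : Matrix (Fin n) (Fin n) ℂ, act k (T (act k⁻¹ 1)) = act k f := fun k => by simp [T]
  obtain ⟨Θ, h1, h2, -⟩ := hav T
  have h3 : ∀ x, eval x (Θ 1) = ∫ k : Fr.stab, eval ((k : Matrix (Fin n) (Fin n) ℂ) *ᵥ x) f ∂μ := fun x => by
    refine (h2 1 (aeval x).toLinearMap).trans (integral_congr_ae (ae_of_all _ fun k => ?_))
    beta_reduce
    rw [hT]
    exact eval_act _ _ _
  have hinv : InvariantOn ℂ n (isotropy ℂ n G v) N (Θ 1) := Fr.invariantOn hG hs fun h hh hv x _ => by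
    rw [← eval_act, ← h1 h ⟨hh, hv⟩, map_one (act h)]
  refine ⟨Θ 1, Ideal.subset_span (Or.inl ⟨hinv, fun x hx => ?_⟩), h3⟩
  rw [hx.2 _ hinv, h3]
  simp only [mulVec_zero, hf]
  simp

/-- Equivariant maps vanishing to a high order along a slice take values in the slice ideal. -/
theorem Frame.exists_order (hG : IsReductiveGroup ℂ n G) (Fr : Frame G v)
    {N : Submodule ℂ (Fin n → ℂ)} (hs : IsSliceComplement ℂ n G v N)
    (U : Submodule ℂ (MvPolynomial (Fin n) ℂ)) [FiniteDimensional ℂ U]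
    (hU : ∀ k ∈ Fr.stab, ∀ P ∈ U, act k P ∈ U) :
    ∃ d : ℕ, ∀ Δ ∈ equivMaps Fr.stab, (∀ P ∈ U, ∀ x ∈ N, ∀ j < d, jet j x (Δ P) = 0) →
      ∀ P ∈ U, Δ P ∈ sliceIdeal (isotropy ℂ n G v) N := by
  classical
  obtain ⟨s, hsU⟩ : U.FG := (Submodule.fg_iff_finiteDimensional U).2 inferInstance
  let I : Ideal (MvPolynomial (Fin n) ℂ) := RingHom.ker (eval (0 : Fin n → ℂ))
  let V : Ideal (MvPolynomial (Fin n) ℂ) := vanishingIdeal ℂ n (N : Set (Fin n → ℂ))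
  let f : equivMaps Fr.stab → (s → MvPolynomial (Fin n) ℂ ⧸ V) := fun Δ i =>
    Submodule.mkQ V ((Δ : MvPolynomial (Fin n) ℂ →ₗ[ℂ] MvPolynomial (Fin n) ℂ) i)
  have hf : ∀ Δ i, f Δ i = Submodule.mkQ V
    ((Δ : MvPolynomial (Fin n) ℂ →ₗ[ℂ] MvPolynomial (Fin n) ℂ) i) := fun _ _ => rfl
  let E : Submodule (MvPolynomial (Fin n) ℂ) (s → MvPolynomial (Fin n) ℂ ⧸ V) :=
    Submodule.span (MvPolynomial (Fin n) ℂ) (Set.range f)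
  obtain ⟨k, hk⟩ := I.exists_pow_inf_eq_pow_smul E
  obtain ⟨μ, hμ, hav⟩ := Fr.exists_invariant_average hG hs
  refine ⟨k + 1, fun Δ hΔ hjet => ?_⟩
  have hsmem : ∀ i : s, (i : MvPolynomial (Fin n) ℂ) ∈ U := fun i => hsU ▸ Submodule.subset_span i.2
  have h1 : f ⟨Δ, hΔ⟩ ∈ I ^ (k + 1) • (⊤ : Submodule (MvPolynomial (Fin n) ℂ) (s → MvPolynomial (Fin n) ℂ ⧸ V)) := by
    rw [← Finset.univ_sum_single (f ⟨Δ, hΔ⟩)]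
    refine sum_mem fun i _ => ?_
    obtain ⟨Q, hQ1, hQ2⟩ := exists_sub_mem_vanishingIdeal hG.1 hs fun x hx j hj =>
      hjet i (hsmem i) x hx j hj
    have h2 : f ⟨Δ, hΔ⟩ i = Q • Submodule.mkQ V 1 := by
      rw [hf, ← map_smul, smul_eq_mul, mul_one, ← sub_eq_zero, ← map_sub, Submodule.mkQ_apply,
        Submodule.Quotient.mk_eq_zero]
      exact hQ2
    rw [h2, Pi.single_smul]
    exact Submodule.smul_mem_smul hQ1 trivial
  have h2 : f ⟨Δ, hΔ⟩ ∈ I • E := by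
    have h3 : f ⟨Δ, hΔ⟩ ∈ I ^ (k + 1) • (⊤ : Submodule (MvPolynomial (Fin n) ℂ)
      (s → MvPolynomial (Fin n) ℂ ⧸ V)) ⊓ E := ⟨h1, Submodule.subset_span ⟨_, rfl⟩⟩
    rw [hk (k + 1) k.le_succ, Nat.add_sub_cancel_left, pow_one] at h3
    exact Submodule.smul_mono le_rfl inf_le_right h3
  obtain ⟨a, ha, hsum⟩ := (Submodule.mem_ideal_smul_span_iff_exists_sum I f _).1 h2
  have h4 : ∀ P ∈ U, ∀ x ∈ N, eval x (Δ P) = ∑ D ∈ a.support,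
      eval x (a D) * eval x ((D : MvPolynomial (Fin n) ℂ →ₗ[ℂ] MvPolynomial (Fin n) ℂ) P) := by
    intro P hP x hx
    rw [← hsU] at hP
    induction hP using Submodule.span_induction with
    | mem i hi =>
      have h5 := congrFun hsum ⟨i, hi⟩
      rw [Finsupp.sum, Finset.sum_apply] at h5
      simp only [Pi.smul_apply, hf] at h5
      simp only [← map_smul] at h5
      rw [← map_sum, ← sub_eq_zero, ← map_sub, Submodule.mkQ_apply, Submodule.Quotient.mk_eq_zero] at h5
      have h6 := h5 x hx
      rw [map_sub, sub_eq_zero, map_sum] at h6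
      rw [← h6]
      exact Finset.sum_congr rfl fun D _ => by rw [smul_eq_mul, map_mul]
    | zero => simp
    | add P Q _ _ hp hq => simp only [map_add, hp, hq, mul_add, Finset.sum_add_distrib]
    | smul c P _ hp =>
      simp only [map_smul, smul_eval, hp, Finset.mul_sum]
      exact Finset.sum_congr rfl fun D _ => by ring
  have hq : ∀ D, ∃ q ∈ sliceIdeal (isotropy ℂ n G v) N,
        ∀ x, eval x q = ∫ k : Fr.stab, eval ((k : Matrix (Fin n) (Fin n) ℂ) *ᵥ x) (a D) ∂μ :=
    fun D => hav _ (ha D)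
  choose q hq1 hq2 using hq
  have hInt : ∀ D x, Integrable (fun k : Fr.stab => eval ((k : Matrix (Fin n) (Fin n) ℂ) *ᵥ x) (a D)) μ :=
    fun D x => continuous_integrable_of_compact Fr.stab_isCompact μ
      ((continuous_eval_poly (a D)).comp
        (Continuous.matrix_mulVec continuous_subtype_val continuous_const))
  intro P hP
  have h5 : Δ P - ∑ D ∈ a.support, q D * (D : MvPolynomial (Fin n) ℂ →ₗ[ℂ] MvPolynomial (Fin n) ℂ) P ∈
      sliceIdeal (isotropy ℂ n G v) N := by
    refine mem_sliceIdeal_of_vanish fun x hx => ?_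
    rw [map_sub, sub_eq_zero, map_sum]
    simp only [map_mul, hq2, ← integral_mul_const]
    rw [← integral_finsetSum _ fun D _ => (hInt D x).mul_const _]
    have h6 : ∀ k : Fr.stab, (∑ D ∈ a.support, eval ((k : Matrix (Fin n) (Fin n) ℂ) *ᵥ x) (a D) *
        eval x ((D : MvPolynomial (Fin n) ℂ →ₗ[ℂ] MvPolynomial (Fin n) ℂ) P)) = eval x (Δ P) := by
      intro k
      have hkinv := (Fr.stab_isMatSubgroup.2.2 _ k.2).2
      have h7 := h4 _ (hU _ hkinv P hP) _ (hs.2 k ⟨Fr.sub k.2.1, k.2.2⟩ x hx)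
      have h8 : ∀ D ∈ equivMaps Fr.stab, eval ((k : Matrix (Fin n) (Fin n) ℂ) *ᵥ x)
          (D (act (k : Matrix (Fin n) (Fin n) ℂ)⁻¹ P)) = eval x (D P) := fun D hD => by
        rw [← eval_act, ← hD k k.2, act_act_inv Fr.stab_isMatSubgroup k.2]
      rw [h8 Δ hΔ] at h7
      rw [h7]
      exact Finset.sum_congr rfl fun D _ => by rw [h8 D D.2]
    simp only [h6]
    simp
  have h9 := add_mem h5 (sum_mem fun D (_ : D ∈ a.support) => Ideal.mul_mem_right
    ((D : MvPolynomial (Fin n) ℂ →ₗ[ℂ] MvPolynomial (Fin n) ℂ) P) _ (hq1 D))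
  rwa [sub_add_cancel] at h9

end Order

section Reduced
open MeasureTheory Filter Topology Matrix

variable {n : ℕ} {G : Set (Matrix (Fin n) (Fin n) ℂ)} {v : Fin n → ℂ}

theorem sliceIdeal_le (H : Set (Matrix (Fin n) (Fin n) ℂ)) (N : Submodule ℂ (Fin n → ℂ)) :
    sliceIdeal H N ≤ vanishingIdeal ℂ n (sliceNullCone ℂ n H N) := by
  refine Ideal.span_le.2 ?_
  rintro p (hp | hp)
  · exact hp.2
  · exact fun x hx => hp x hx.1

theorem vanishingIdeal_sliceNullCone_le_radical {H : Set (Matrix (Fin n) (Fin n) ℂ)}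
    {N T : Submodule ℂ (Fin n → ℂ)} (hc : IsCompl N T) :
    vanishingIdeal ℂ n (sliceNullCone ℂ n H N) ≤ (sliceIdeal H N).radical := by
  obtain ⟨pr, h1, h2, -⟩ := exists_proj_of_isCompl hc
  rw [← vanishingIdeal_zeroLocus_eq_radical (K := ℂ)]
  intro p hp x hx
  have hx' : ∀ q ∈ sliceIdeal H N, eval x q = 0 := fun q hq => by
    have := hx q hq
    rwa [aeval_eq_eval] at this
  rw [aeval_eq_eval]
  have hxN : x ∈ N := by
    have : x = pr x := by
      ext i
      have h3 := hx' (X i - linPoly (LinearMap.proj i ∘ₗ pr)) (mem_sliceIdeal_of_vanish fun y hy => by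
        rw [map_sub, eval_X, eval_linPoly, LinearMap.comp_apply, h1 y hy]; simp)
      rw [map_sub, eval_X, eval_linPoly, sub_eq_zero] at h3
      exact h3
    rw [this]; exact h2 x
  refine hp x ⟨hxN, fun q hq => ?_⟩
  have h4 := hx' (q - C (eval 0 q)) (Ideal.subset_span (Or.inl ⟨fun g hg y hy => by
    rw [map_sub, map_sub, hq g hg y hy, eval_C, eval_C], fun y hy => by
      rw [map_sub, hy.2 q hq, eval_C, sub_self]⟩))
  rwa [map_sub, eval_C, sub_eq_zero] at h4

theorem mulVec_mem_sliceNullCone {N : Submodule ℂ (Fin n → ℂ)} (hs : IsSliceComplement ℂ n G v N)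
    {h : Matrix (Fin n) (Fin n) ℂ} (hh : h ∈ isotropy ℂ n G v) {x : Fin n → ℂ}
    (hx : x ∈ sliceNullCone ℂ n (isotropy ℂ n G v) N) :
    h *ᵥ x ∈ sliceNullCone ℂ n (isotropy ℂ n G v) N :=
  ⟨hs.2 h hh x hx.1, fun p hp => (hp h hh x hx.1).trans (hx.2 p hp)⟩

theorem shift_mem_sliceIdeal {N : Submodule ℂ (Fin n → ℂ)} {P : MvPolynomial (Fin n) ℂ}
    (hP : P ∈ invariantIdeal ℂ n G (piFiber ℂ n G v)) :
    shift v P ∈ sliceIdeal (isotropy ℂ n G v) N := by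
  have : invariantIdeal ℂ n G (piFiber ℂ n G v) ≤ (sliceIdeal (isotropy ℂ n G v) N).comap (shift v) := by
    refine Ideal.span_le.2 fun p hp => ?_
    refine Ideal.subset_span (Or.inl ⟨invariantOn_shift hp.1, fun x hx => ?_⟩)
    exact (eval_shift v x p).trans (hp.2 _ (add_mem_piFiber hx))
  exact this hP

/-- An equivariant projection onto a stable subspace of polynomials. -/
theorem Frame.exists_equivariant_projection (Fr : Frame G v) (W : Submodule ℂ (MvPolynomial (Fin n) ℂ))
    (hW : ∀ k ∈ Fr.stab, ∀ P ∈ W, act k P ∈ W) :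
    ∃ Φ ∈ equivMaps Fr.stab, (∀ P, Φ P ∈ W) ∧ ∀ P ∈ W, Φ P = P := by
  obtain ⟨μ, hμ, hav⟩ := Fr.exists_isotropy_mean
  obtain ⟨g, hg⟩ := W.subtype.exists_leftInverse_of_injective W.ker_subtype
  obtain ⟨Φ, h1, h2, h3⟩ := hav (W.subtype ∘ₗ g)
  refine ⟨Φ, h1, fun P => h3 P W fun k hk => hW k hk _ (Subtype.mem _), fun P hP => poly_ext fun x => ?_⟩
  refine (h2 P (aeval x).toLinearMap).trans ?_
  have h4 : ∀ k : Fr.stab, (aeval x).toLinearMap (act (k : Matrix (Fin n) (Fin n) ℂ)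
      ((W.subtype ∘ₗ g) (act (k : Matrix (Fin n) (Fin n) ℂ)⁻¹ P))) = eval x P := fun k => by
    have h5 := hW _ (Fr.stab_isMatSubgroup.2.2 _ k.2).2 P hP
    have h6 : g (act (k : Matrix (Fin n) (Fin n) ℂ)⁻¹ P) = ⟨_, h5⟩ := LinearMap.congr_fun hg ⟨_, h5⟩
    rw [LinearMap.comp_apply, h6, Submodule.subtype_apply, act_act_inv Fr.stab_isMatSubgroup k.2]
    rfl
  simp only [h4]
  simp

theorem Frame.coreducedOn_of_isGReduced (hG : IsReductiveGroup ℂ n G) (hv : HasClosedOrbit ℂ n G v)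
    (Fr : Frame G v) {N : Submodule ℂ (Fin n → ℂ)} (hs : IsSliceComplement ℂ n G v N)
    (hr : IsGReduced ℂ n G (piFiber ℂ n G v)) : CoreducedOn ℂ n (isotropy ℂ n G v) N := by
  refine le_antisymm (fun h hh => ?_) (sliceIdeal_le _ _)
  change h ∈ sliceIdeal (isotropy ℂ n G v) N
  let U := restrictTotalDegree (Fin n) ℂ h.totalDegree
  let Z := vanishingIdeal ℂ n (sliceNullCone ℂ n (isotropy ℂ n G v) N)
  have hU : ∀ g : Matrix (Fin n) (Fin n) ℂ, ∀ P ∈ U, act g P ∈ U := fun g P hP => by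
    rw [mem_restrictTotalDegree] at hP ⊢
    exact (totalDegree_affSub_le _ _ _).trans hP
  have hhU : h ∈ U := by rw [mem_restrictTotalDegree]
  obtain ⟨Φ, hΦ1, hΦ2, hΦ3⟩ := Fr.exists_equivariant_projection (U ⊓ Z.restrictScalars ℂ)
    fun k hk P hP => ⟨hU k P hP.1, fun x hx => by
      rw [eval_act]; exact hP.2 _ (mulVec_mem_sliceNullCone hs ⟨Fr.sub hk.1, hk.2⟩ hx)⟩
  obtain ⟨d, hd⟩ := Fr.exists_order hG hs U fun k _ => hU k
  obtain ⟨Θ, hΘ1, hΘ2⟩ := Fr.approx hG hs (Φ := Φ) (fun k hk hv P x _ => by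
    rw [hΦ1 k ⟨hk, hv⟩, eval_act]) U d
  have hΔ : ∀ P ∈ U, shift v (Θ P) - Φ P ∈ sliceIdeal (isotropy ℂ n G v) N :=
    hd ((shift v).toLinearMap ∘ₗ Θ - Φ) (fun k hk P => by
      change shift v (Θ (act k P)) - Φ (act k P) = act k (shift v (Θ P) - Φ P)
      rw [hΘ1 k (Fr.sub hk.1), hΦ1 k hk, map_sub, act_shift hk.2]) fun P hP x hx j hj => by
        change jet j x (shift v (Θ P) - Φ P) = 0
        rw [map_sub, hΘ2 P hP x hx j hj, sub_self]
  obtain ⟨r, hr'⟩ : ∃ r, Z ^ r ≤ sliceIdeal (isotropy ℂ n G v) N :=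
    Ideal.exists_pow_le_of_le_radical_of_fg (vanishingIdeal_sliceNullCone_le_radical hs.1.symm)
      ((isNoetherianRing_iff_ideal_fg _).1 inferInstance Z)
  have hcore : Θ h ^ r ∈ sliceCore G v N := fun g hg => by
    rw [map_pow, map_pow, ← hΘ1 g hg]
    refine hr' (Ideal.pow_mem_pow ?_ r)
    have h1 := add_mem (sliceIdeal_le _ _ (hΔ _ (hU g h hhU))) (hΦ2 (act g h)).2
    rwa [sub_add_cancel] at h1
  have hΘh : Θ h ∈ invariantIdeal ℂ n G (piFiber ℂ n G v) := by
    have h1 := Fr.sliceCore_le hG hv hs hcore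
    rw [show invariantIdeal ℂ n G (piFiber ℂ n G v) = vanishingIdeal ℂ n (piFiber ℂ n G v) from hr] at h1 ⊢
    intro x hx
    have h2 := h1 x hx
    rw [map_pow] at h2
    exact eq_zero_of_pow_eq_zero h2
  have h3 := sub_mem (shift_mem_sliceIdeal (N := N) hΘh) (hΔ h hhU)
  rwa [sub_sub_cancel, hΦ3 h ⟨hhU, hh⟩] at h3

end Reduced

/-- **Proposition 3.1(3).** Let `G` be a complex reductive group, `V = ℂⁿ` a `G`-module and
`Gv` a closed orbit.  The fiber `π⁻¹(π(v))` is `G`-reduced if and only if the slice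
representation `(N_v, G_v)` is coreduced. -/
theorem fiber_G_reduced_iff_slice_coreduced
    (n : ℕ) (G : Set (Matrix (Fin n) (Fin n) ℂ)) (hG : IsReductiveGroup ℂ n G)
    (v : Fin n → ℂ) (hv : HasClosedOrbit ℂ n G v) :
    IsGReduced ℂ n G (piFiber ℂ n G v) ↔
      ∀ N : Submodule ℂ (Fin n → ℂ), IsSliceComplement ℂ n G v N →
        CoreducedOn ℂ n (isotropy ℂ n G v) N := by
  obtain ⟨Fr⟩ := exists_frame hG hv
  refine ⟨fun hr N hs => Fr.coreducedOn_of_isGReduced hG hv hs hr, fun h => ?_⟩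
  obtain ⟨N, hs⟩ := Fr.exists_sliceComplement hG
  exact Fr.isGReduced_of_coreducedOn hG hv hs (h N hs)

end ZPaper
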